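/- Let γ₁ := min(2γ, 1, 2(d−1)(1−γ)) and let A, B₀ ≥ 1 be given constants. There exist constants C = C(d, γ, η) and C' = C'(d, γ, η, A, B₀) such that the following holds for all sufficiently large L. Let n be a positive integer with n ≤ (log L)³ and let ≺ be a strict partial order on {1,…,n}. Let λ₁,…,λ_n ∈ [1, (log L)⁴] and a_j, b_j ∈ ℝ^d for 1 ≤ j ≤ n, and for each j let x̃_j be one of the linear expressions x_j, x_j ± x_{j'}, x_j ± y_{j'} for some j' ≺ j, and let ỹ_j be one of y_j, y_j ± x_{j''}, y_j ± y_{j''} for some j'' ≺ j; set E := {(x₁,…,x_n,y₁,…,y_n) ∈ (ℝ^d)^{2n} : |x̃_j − a_j| ≤ λ_j and |ỹ_j − b_j| ≤ λ_j for all 1 ≤ j ≤ n}. Suppose W : (ℝ^d)^{2n} → ℂ is supported in E, and the Fourier transform of W and the Fourier transform of each first-order partial derivative of W have L¹ norm at most A^n. Let J ⊂ {1,…,n} and let Ψ(Ω₁,…,Ω_n) := ∏_{j∈J} (χ_∞(Ω_j)/Ω_j) · Ψ₁(Ω[J^c]), where Ψ₁ is a function of the variables (Ω_j)_{j∉J}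 satisfying ‖∂^ρ Ψ₁‖_{L¹} ≤ B₀^n·(4|ρ|)! for every multi-index ρ, and ‖ max_{j∉J} ⟨Ω_j⟩^{1−η/2} · Ψ₁ ‖_{L¹} ≤ B₀^n. Define the lattice sum I := ∑ W(x₁,…,x_n,y₁,…,y_n)·Ψ(L^{2γ}δ(x₁·y₁), …, L^{2γ}δ(x_n·y_n)), the sum taken over all (x₁,…,x_n,y₁,…,y_n) ∈ (ℤ_L^d)^{2n}. Then | I − L^{2dn} ∫_{(ℝ^d)^{2n}} W(x₁,…,x_n,y₁,…,y_n)·Ψ(L^{2γ}δ(x₁·y₁), …, L^{2γ}δ(x_n·y_n)) dx₁⋯dx_n dy₁⋯dy_n | ≤ (λ₁⋯λ_n)^C · (C'·L^{2d−2γ}·δ^{−1})^n · L^{−γ₁+η}. -/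

import Mathlib

open MeasureTheory
open scoped RealInnerProductSpace ENNReal NNReal BigOperators

noncomputable section

/-- `e(z) = e^{2πiz}`. -/
def efun (t : ℝ) : ℂ := Complex.exp (2 * (Real.pi : ℂ) * Complex.I * (t : ℂ))

/-- The rescaled lattice `ℤ_L^d = (L⁻¹ℤ)^d` inside `ℝ^d`. -/
def ZLat (d : ℕ) (L : ℝ) : Set (EuclideanSpace ℝ (Fin d)) :=
  {x | ∀ i, ∃ m : ℤ, x i = (m : ℝ) / L}

/-- Directional derivative of a function along a vector. -/
def pderivAlong {X : Type*} [NormedAddCommGroup X] [NormedSpace ℝ X]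
    (v : X) (f : X → ℂ) : X → ℂ :=
  fun z => fderiv ℝ f z v

/-- Iterated directional (partial) derivatives along a list of directions. -/
def pderivList {X : Type*} [NormedAddCommGroup X] [NormedSpace ℝ X]
    (l : List X) (f : X → ℂ) : X → ℂ :=
  l.foldr pderivAlong f

/-- Japanese bracket `⟨x⟩ = (1+x²)^{1/2}`. -/
def jap (x : ℝ) : ℝ := Real.sqrt (1 + x ^ 2)

/-- The standard pairing on `(ℝ^d)^n × (ℝ^d)^n`. -/
def pairingV (d n : ℕ)
    (z ξ : (Fin n → EuclideanSpace ℝ (Fin d)) × (Fin n → EuclideanSpace ℝ (Fin d))) : ℝ :=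
  (∑ j, ⟪z.1 j, ξ.1 j⟫) + ∑ j, ⟪z.2 j, ξ.2 j⟫

/-- The Fourier transform on `(ℝ^d)^{2n}`. -/
def ftV (d n : ℕ)
    (W : (Fin n → EuclideanSpace ℝ (Fin d)) × (Fin n → EuclideanSpace ℝ (Fin d)) → ℂ)
    (ξ : (Fin n → EuclideanSpace ℝ (Fin d)) × (Fin n → EuclideanSpace ℝ (Fin d))) : ℂ :=
  ∫ z, W z * efun (-pairingV d n z ξ)

/-- The function `Ψ(Ω) = ∏_{j∈J} (χ_∞(Ω_j)/Ω_j) ⋅ Ψ₁(Ω[Jᶜ])`, where `χ_∞ = 1 - χ₀`. -/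
def PsiFun {n : ℕ} (χ₀ : ℝ → ℝ) (J : Finset (Fin n))
    (Ψ₁ : ({j : Fin n // j ∉ J} → ℝ) → ℂ) (Ω : Fin n → ℝ) : ℂ :=
  ((∏ j ∈ J, (1 - χ₀ (Ω j)) / Ω j : ℝ) : ℂ) * Ψ₁ (fun j => Ω j.1)

set_option synthInstance.maxSize 1000

/-! ### The character `e(t)` -/

theorem efun_eq_exp (t : ℝ) : efun t = Complex.exp (((2 * Real.pi * t : ℝ) : ℂ) * Complex.I) := by
  unfold efun; congr 1; push_cast; ring

theorem efun_eq_fourierChar (t : ℝ) : efun t = Real.fourierChar t := by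
  rw [efun_eq_exp, Real.fourierChar_apply]

theorem efun_zero : efun 0 = 1 := by simp [efun]

theorem efun_add (a b : ℝ) : efun (a + b) = efun a * efun b := by
  unfold efun; rw [← Complex.exp_add]; congr 1; push_cast; ring

theorem norm_efun (t : ℝ) : ‖efun t‖ = 1 := by
  rw [efun_eq_exp, Complex.norm_exp_ofReal_mul_I]

theorem enorm_efun (t : ℝ) : ‖efun t‖ₑ = 1 := by
  rw [← ofReal_norm, norm_efun]; simp

theorem contDiff_efun {n : WithTop ℕ∞} : ContDiff ℝ n efun := by
  unfold efun
  have h : ContDiff ℝ n (fun t : ℝ => (t : ℂ)) := Complex.ofRealCLM.contDiff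
  exact (contDiff_const.mul h).cexp

@[fun_prop]
theorem continuous_efun : Continuous efun := (contDiff_efun (n := 0)).continuous

theorem efun_sum {ι : Type*} (s : Finset ι) (f : ι → ℝ) :
    efun (∑ i ∈ s, f i) = ∏ i ∈ s, efun (f i) := by
  classical
  induction s using Finset.induction_on with
  | empty => simp [efun_zero]
  | insert a s ha ih => rw [Finset.sum_insert ha, Finset.prod_insert ha, efun_add, ih]

/-! ### A smooth partition of unity on the line -/

/-- A smooth bump supported in `[-1, 1]` whose integer translates sum to one. -/
def bump (u : ℝ) : ℝ := Real.smoothTransition (u + 1) - Real.smoothTransition u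

theorem contDiff_bump {n : ℕ∞} : ContDiff ℝ n bump := by
  unfold bump
  exact (Real.smoothTransition.contDiff.comp (contDiff_id.add contDiff_const)).sub
    Real.smoothTransition.contDiff

@[fun_prop]
theorem continuous_bump : Continuous bump := (contDiff_bump (n := 0)).continuous

theorem bump_eq_zero {u : ℝ} (hu : 1 ≤ |u|) : bump u = 0 := by
  unfold bump
  rcases le_abs.1 hu with h | h
  · rw [Real.smoothTransition.one_of_one_le h, Real.smoothTransition.one_of_one_le (by linarith)]
    simp
  · rw [Real.smoothTransition.zero_of_nonpos (by linarith),
      Real.smoothTransition.zero_of_nonpos (by linarith)]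
    simp

theorem bump_nonneg (u : ℝ) : 0 ≤ bump u :=
  sub_nonneg.2 (Real.smoothTransition.monotone (by linarith))

theorem bump_le_one (u : ℝ) : bump u ≤ 1 := by
  have h1 := Real.smoothTransition.le_one (u + 1)
  have h2 := Real.smoothTransition.nonneg u
  unfold bump; linarith

theorem norm_bump_le_one (u : ℝ) : ‖(bump u : ℂ)‖ ≤ 1 := by
  rw [Complex.norm_real, Real.norm_of_nonneg (bump_nonneg u)]; exact bump_le_one u

theorem bump_fract_add (x : ℝ) : bump (x - ⌊x⌋) + bump (x - (⌊x⌋ + 1)) = 1 := by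
  unfold bump
  rw [show x - (⌊x⌋ + 1) + 1 = x - ⌊x⌋ by ring,
    Real.smoothTransition.one_of_one_le (by linarith [Int.floor_le x]),
    Real.smoothTransition.zero_of_nonpos (x := x - (⌊x⌋ + 1)) (by linarith [Int.lt_floor_add_one x])]
  ring

theorem sum_bump_eq_one (x : ℝ) (S : Finset ℤ) (hS : ∀ p : ℤ, |x - p| < 1 → p ∈ S) :
    ∑ p ∈ S, bump (x - p) = 1 := by
  classical
  have hz : ∀ p : ℤ, p ∉ ({⌊x⌋, ⌊x⌋ + 1} : Finset ℤ) → bump (x - p) = 0 := by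
    intro p hp
    apply bump_eq_zero
    simp only [Finset.mem_insert, Finset.mem_singleton, not_or] at hp
    have h1 := Int.floor_le x
    have h2 := Int.lt_floor_add_one x
    rcases lt_or_gt_of_ne hp.1 with h | h
    · have : (p : ℝ) + 1 ≤ ⌊x⌋ := by exact_mod_cast h
      exact le_trans (by linarith) (le_abs_self _)
    · have h' : ⌊x⌋ + 1 < p := lt_of_le_of_ne h (Ne.symm hp.2)
      have : (⌊x⌋ : ℝ) + 1 + 1 ≤ p := by exact_mod_cast h'
      exact le_trans (by linarith) (neg_le_abs _)
  have h2 : ∑ p ∈ ({⌊x⌋, ⌊x⌋ + 1} : Finset ℤ), bump (x - p) = 1 := by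
    rw [Finset.sum_pair (by omega)]
    have := bump_fract_add x
    push_cast; exact this
  have h3 : ∑ p ∈ S, bump (x - p) = ∑ p ∈ S ∪ {⌊x⌋, ⌊x⌋ + 1}, bump (x - p) := by
    apply Finset.sum_subset Finset.subset_union_left
    intro p _ hp
    apply bump_eq_zero
    by_contra h
    exact hp (hS p (not_le.1 h))
  rw [h3, ← h2]
  symm
  exact Finset.sum_subset Finset.subset_union_right fun p _ hp => hz p hp

/-! ### Exponential sums and integrals against the bump -/

/-- The Fourier integral `∫ bump (y - p) e(θ y) dy`. -/
def bumpInt (p θ : ℝ) : ℂ := ∫ y : ℝ, (bump (y - p) : ℂ) * efun (θ * y)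

theorem hasCompactSupport_bump : HasCompactSupport bump := by
  apply HasCompactSupport.of_support_subset_isCompact (isCompact_Icc (a := (-1 : ℝ)) (b := 1))
  intro u hu
  by_contra h
  apply hu
  apply bump_eq_zero
  rw [Set.mem_Icc, ← abs_le] at h
  linarith

theorem schwartz_fourier_decay (f : SchwartzMap ℝ ℂ) (k : ℕ) :
    ∃ C : ℝ, 1 ≤ C ∧ ∀ θ : ℝ, ‖FourierTransform.fourier (⇑f) θ‖ ≤ C / (1 + |θ|) ^ k := by
  let g := FourierTransform.fourier f
  obtain ⟨C0, h0, hC0⟩ := g.decay 0 0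
  obtain ⟨C1, h1, hC1⟩ := g.decay k 0
  refine ⟨2 ^ k * (C0 + C1) + 1, by have : 0 < (2:ℝ)^k := by positivity
                                    nlinarith, fun θ => ?_⟩
  have e : FourierTransform.fourier (⇑f) θ = g θ := by rw [← SchwartzMap.fourier_coe]
  rw [e, le_div_iff₀ (by positivity)]
  have a0 := hC0 θ
  have a1 := hC1 θ
  simp only [norm_iteratedFDeriv_zero, pow_zero, one_mul, Real.norm_eq_abs] at a0 a1
  have hp : (1 + |θ|) ^ k ≤ 2 ^ k * (1 + |θ| ^ k) := by
    rcases le_total |θ| 1 with h | h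
    · calc (1 + |θ|) ^ k ≤ 2 ^ k := by gcongr; linarith
        _ ≤ 2 ^ k * (1 + |θ| ^ k) := by
          have : (0:ℝ) ≤ |θ| ^ k := by positivity
          nlinarith [show (0:ℝ) < 2 ^ k by positivity]
    · calc (1 + |θ|) ^ k ≤ (2 * |θ|) ^ k := by gcongr; linarith
        _ = 2 ^ k * |θ| ^ k := mul_pow _ _ _
        _ ≤ _ := by gcongr; linarith
  calc ‖g θ‖ * (1 + |θ|) ^ k ≤ ‖g θ‖ * (2 ^ k * (1 + |θ| ^ k)) := by gcongr
    _ = 2 ^ k * (‖g θ‖ + |θ| ^ k * ‖g θ‖) := by ring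
    _ ≤ 2 ^ k * (C0 + C1) := by gcongr
    _ ≤ _ := by linarith

theorem exists_bumpInt_bound :
    ∃ C : ℝ, 1 ≤ C ∧ ∀ p θ : ℝ, ‖bumpInt p θ‖ ≤ C / (1 + θ ^ 2) := by
  have hs : HasCompactSupport (fun u : ℝ => (bump u : ℂ)) :=
    hasCompactSupport_bump.comp_left (g := fun x : ℝ => (x : ℂ)) (by simp)
  have hc : ContDiff ℝ (⊤ : ℕ∞) (fun u : ℝ => (bump u : ℂ)) :=
    Complex.ofRealCLM.contDiff.comp contDiff_bump
  obtain ⟨C, h1, hC⟩ := schwartz_fourier_decay (hs.toSchwartzMap hc) 2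
  refine ⟨C, h1, fun p θ => ?_⟩
  have e : bumpInt p θ = efun (θ * p) *
      FourierTransform.fourier (⇑(hs.toSchwartzMap hc)) (-θ) := by
    rw [Real.fourier_real_eq, ← integral_const_mul, bumpInt,
      ← integral_add_right_eq_self _ p]
    congr 1; ext y
    rw [HasCompactSupport.toSchwartzMap_toFun, Circle.smul_def, ← efun_eq_fourierChar,
      smul_eq_mul, show -(y * -θ) = θ * y by ring, show θ * (y + p) = θ * p + θ * y by ring,
      efun_add, add_sub_cancel_right]
    ring
  rw [e, norm_mul, norm_efun, one_mul]
  refine (hC _).trans ?_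
  rw [abs_neg]
  gcongr
  nlinarith [abs_nonneg θ, sq_abs θ]

/-- A constant controlling the decay of the Fourier transform of `bump`. -/
def bumpC : ℝ := exists_bumpInt_bound.choose

theorem one_le_bumpC : 1 ≤ bumpC := exists_bumpInt_bound.choose_spec.1

theorem norm_bumpInt_le (p θ : ℝ) : ‖bumpInt p θ‖ ≤ bumpC / (1 + θ ^ 2) :=
  exists_bumpInt_bound.choose_spec.2 p θ

/-- The integers `m` with `|m / L - p| ≤ 1`. -/
def win (L : ℝ) (p : ℤ) : Finset ℤ := Finset.Icc ⌈L * (p - 1)⌉ ⌊L * (p + 1)⌋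

theorem mem_win {L : ℝ} (hL : 0 < L) (p m : ℤ) : m ∈ win L p ↔ |(m : ℝ) / L - p| ≤ 1 := by
  rw [win, Finset.mem_Icc, Int.ceil_le, Int.le_floor, abs_le]
  constructor
  · rintro ⟨h1, h2⟩
    constructor
    · have := (le_div_iff₀ hL).2 (by linarith : ((p : ℝ) - 1) * L ≤ m)
      linarith
    · have := (div_le_iff₀ hL).2 (by linarith : (m : ℝ) ≤ ((p : ℝ) + 1) * L)
      linarith
  · rintro ⟨h1, h2⟩
    constructor
    · have := (le_div_iff₀ hL).1 (by linarith : ((p : ℝ) - 1) ≤ m / L)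
      linarith
    · have := (div_le_iff₀ hL).1 (by linarith : (m : ℝ) / L ≤ ((p : ℝ) + 1))
      linarith

theorem bump_eq_zero_of_notMem_win {L : ℝ} (hL : 0 < L) {p m : ℤ} (h : m ∉ win L p) :
    bump ((m : ℝ) / L - p) = 0 := by
  apply bump_eq_zero
  rw [mem_win hL] at h
  exact (not_le.1 h).le

/-- The exponential sum `∑ bump (m / L - p) e(θ m / L)`. -/
def bumpSum (L : ℝ) (p : ℤ) (θ : ℝ) : ℂ :=
  ∑ m ∈ win L p, (bump ((m : ℝ) / L - p) : ℂ) * efun (θ * ((m : ℝ) / L))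

/-- The tail `∑_{k ≠ 0} 1 / (1 + (θ - L k)²)`. -/
def offSum (L θ : ℝ) : ℝ≥0∞ :=
  ∑' k : ℤ, if k = 0 then 0 else ENNReal.ofReal (1 / (1 + (θ - L * k) ^ 2))

/-- The full sum `∑_k 1 / (1 + (θ - L k)²)`. -/
def fullSum (L θ : ℝ) : ℝ≥0∞ :=
  ∑' k : ℤ, ENNReal.ofReal (1 / (1 + (θ - L * k) ^ 2))

theorem measurable_offSum (L : ℝ) : Measurable (offSum L) := by
  unfold offSum
  refine Measurable.tsum fun k => ?_
  split_ifs
  · exact measurable_const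
  · fun_prop

theorem bumpSum_poisson {L : ℝ} (hL : 0 < L) (p : ℤ) (θ : ℝ) :
    Summable (fun k : ℤ => (L : ℂ) * bumpInt p (θ - L * k)) ∧
    bumpSum L p θ = ∑' k : ℤ, (L : ℂ) * bumpInt p (θ - L * k) := by
  let f : ℝ → ℂ := fun t => (bump (t / L - p) : ℂ) * efun (θ * (t / L))
  have hs : HasCompactSupport f := by
    apply HasCompactSupport.of_support_subset_isCompact
      (isCompact_Icc (a := L * ((p : ℝ) - 1)) (b := L * (p + 1)))
    intro t ht
    have h : |t / L - p| < 1 := by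
      by_contra h
      exact ht (by simp only [f]; rw [bump_eq_zero (not_lt.1 h)]; simp)
    rw [abs_lt] at h
    have h1 := (lt_div_iff₀ hL).1 (by linarith [h.1] : ((p : ℝ) - 1) < t / L)
    have h2 := (div_lt_iff₀ hL).1 (by linarith [h.2] : t / L < ((p : ℝ) + 1))
    constructor <;> nlinarith
  have hc : ContDiff ℝ (⊤ : ℕ∞) f := by
    refine ContDiff.mul ?_ ?_
    · exact Complex.ofRealCLM.contDiff.comp
        (contDiff_bump.comp ((contDiff_id.div_const L).sub contDiff_const))
    · exact contDiff_efun.comp (contDiff_const.mul (contDiff_id.div_const L))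
  let F := hs.toSchwartzMap hc
  have hF : ∀ x, F x = f x := fun x => HasCompactSupport.toSchwartzMap_toFun hs hc x
  have hft : ∀ k : ℤ, (FourierTransform.fourier F) (k : ℝ) = (L : ℂ) * bumpInt p (θ - L * k) := by
    intro k
    rw [SchwartzMap.fourier_coe, Real.fourier_real_eq]
    have : ∀ y : ℝ, Real.fourierChar (-(y * k)) • F y =
        (fun t : ℝ => (bump (t - p) : ℂ) * efun ((θ - L * k) * t)) (y / L) := by
      intro y
      rw [hF, Circle.smul_def, ← efun_eq_fourierChar, smul_eq_mul]
      simp only [f]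
      rw [show (θ - L * k) * (y / L) = -(y * k) + θ * (y / L) by field_simp; ring, efun_add]
      ring
    rw [integral_congr_ae (Filter.Eventually.of_forall this)]
    refine (Measure.integral_comp_div
      (fun t : ℝ => (bump (t - p) : ℂ) * efun ((θ - L * k) * t)) L).trans ?_
    rw [abs_of_pos hL]
    simp [bumpInt]
  have hP := SchwartzMap.tsum_eq_tsum_fourier F 0
  constructor
  · simp_rw [← hft]
    obtain ⟨C, -, hC⟩ := (FourierTransform.fourier F).decay 2 0
    obtain ⟨C', -, hC'⟩ := (FourierTransform.fourier F).decay 0 0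
    have hsum : Summable (fun k : ℤ => C * (1 / |(k : ℝ)| ^ 2)) :=
      (Real.summable_one_div_int_pow.2 (by norm_num : 1 < 2)).mul_left C |>.congr
        (fun k => by simp)
    refine (Summable.of_norm_bounded_eventually hsum ?_)
    rw [Filter.eventually_cofinite]
    refine Set.Finite.subset (Set.finite_singleton (0 : ℤ)) ?_
    intro k hk
    by_contra h0
    apply hk
    have h0' : (k : ℝ) ≠ 0 := by exact_mod_cast h0
    have := hC (k : ℝ)
    rw [norm_iteratedFDeriv_zero, Real.norm_eq_abs] at this
    rw [mul_one_div, le_div_iff₀ (by positivity)]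
    linarith
  · simp_rw [← hft]
    have h1 : ∑' n : ℤ, F (0 + n) = bumpSum L p θ := by
      unfold bumpSum
      simp_rw [hF, zero_add]
      refine tsum_eq_sum fun m hm => ?_
      simp only [f]
      rw [bump_eq_zero_of_notMem_win hL hm]; simp
    rw [← h1, hP]
    refine tsum_congr fun n => ?_
    simp

theorem enorm_bumpInt_le (p θ : ℝ) :
    ‖bumpInt p θ‖ₑ ≤ ENNReal.ofReal bumpC * ENNReal.ofReal (1 / (1 + θ ^ 2)) := by
  rw [← ENNReal.ofReal_mul (by linarith [one_le_bumpC]), ← ofReal_norm]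
  apply ENNReal.ofReal_le_ofReal
  rw [mul_one_div]
  exact norm_bumpInt_le p θ

theorem enorm_bumpSum_sub_le {L : ℝ} (hL : 0 < L) (p : ℤ) (θ : ℝ) :
    ‖bumpSum L p θ - L * bumpInt p θ‖ₑ ≤ ENNReal.ofReal (L * bumpC) * offSum L θ := by
  obtain ⟨hs, he⟩ := bumpSum_poisson hL p θ
  rw [he, hs.tsum_eq_add_tsum_ite 0]
  simp only [Int.cast_zero, mul_zero, sub_zero, add_sub_cancel_left]
  refine enorm_tsum_le_tsum_enorm.trans ?_
  rw [offSum, ← ENNReal.tsum_mul_left]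
  refine ENNReal.tsum_le_tsum fun k => ?_
  split_ifs with h
  · simp
  · rw [enorm_mul, ENNReal.ofReal_mul hL.le, mul_assoc]
    refine mul_le_mul' ?_ (enorm_bumpInt_le _ _)
    rw [← ofReal_norm, Complex.norm_real, Real.norm_of_nonneg hL.le]

theorem enorm_bumpSum_le {L : ℝ} (hL : 0 < L) (p : ℤ) (θ : ℝ) :
    ‖bumpSum L p θ‖ₑ ≤ ENNReal.ofReal (L * bumpC) * fullSum L θ := by
  obtain ⟨hs, he⟩ := bumpSum_poisson hL p θ
  rw [he]
  refine enorm_tsum_le_tsum_enorm.trans ?_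
  rw [fullSum, ← ENNReal.tsum_mul_left]
  refine ENNReal.tsum_le_tsum fun k => ?_
  rw [enorm_mul, ENNReal.ofReal_mul hL.le, mul_assoc]
  refine mul_le_mul' ?_ (enorm_bumpInt_le _ _)
  rw [← ofReal_norm, Complex.norm_real, Real.norm_of_nonneg hL.le]

theorem offSum_le_fullSum (L θ : ℝ) : offSum L θ ≤ fullSum L θ :=
  ENNReal.tsum_le_tsum fun k => by split_ifs <;> simp

/-- The constant `∑_{k ∈ ℤ} 1 / (1 + k²)`. -/
def zC : ℝ := ∑' k : ℤ, 1 / (1 + (k : ℝ) ^ 2)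

theorem summable_zC : Summable fun k : ℤ => 1 / (1 + (k : ℝ) ^ 2) := by
  have h := (Real.summable_one_div_int_pow.2 (by norm_num : 1 < 2))
  refine Summable.of_norm_bounded_eventually h ?_
  rw [Filter.eventually_cofinite]
  refine Set.Finite.subset (Set.finite_singleton (0 : ℤ)) ?_
  intro k hk
  by_contra h0
  apply hk
  have h0' : (k : ℝ) ≠ 0 := by exact_mod_cast h0
  rw [Real.norm_of_nonneg (by positivity)]
  gcongr
  linarith

theorem zC_pos : 0 < zC :=
  summable_zC.tsum_pos (fun k => by positivity) 0 (by norm_num)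

theorem fullSum_le {L : ℝ} (hL : 1 ≤ L) (θ : ℝ) :
    fullSum L θ ≤ ENNReal.ofReal (8 * zC / (1 + (L * (θ / L - round (θ / L))) ^ 2)) := by
  have hL0 : 0 < L := by linarith
  set k₀ := round (θ / L)
  set v := θ / L - k₀
  have hv : |v| ≤ 1 / 2 := abs_sub_round _
  have hθ : θ = L * v + L * k₀ := by simp only [v]; field_simp; ring
  have e1 : fullSum L θ = ∑' k : ℤ, ENNReal.ofReal (1 / (1 + (L * (v - k)) ^ 2)) := by
    unfold fullSum
    rw [← (Equiv.addRight k₀).tsum_eq]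
    refine tsum_congr fun k => ?_
    rw [Equiv.coe_addRight]
    congr 4
    rw [hθ]; push_cast; ring
  have key : ∀ k : ℤ, 1 / (1 + (L * (v - k)) ^ 2) ≤
      (8 / (1 + (L * v) ^ 2)) * (1 / (1 + (k : ℝ) ^ 2)) := by
    intro k
    rw [div_mul_div_comm, div_le_div_iff₀ (by positivity) (by positivity)]
    have hv2 : v ^ 2 ≤ 1 / 4 := by
      rw [← sq_abs]; nlinarith [abs_nonneg v]
    rcases eq_or_ne k 0 with rfl | hk
    · simp; nlinarith [sq_nonneg (L * v)]
    · have hk1 : (1:ℝ) ≤ (k:ℝ) ^ 2 := by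
        have : (1:ℤ) ≤ k ^ 2 := by
          have := Int.one_le_abs hk
          rw [← sq_abs]; nlinarith
        exact_mod_cast this
      have h1 : (k:ℝ) ^ 2 / 4 ≤ (v - k) ^ 2 := by
        have hk2 : 1 ≤ |(k:ℝ)| := by
          have := Int.one_le_abs hk
          exact_mod_cast this
        have h3 : |(k:ℝ)| / 2 ≤ |v - k| := by
          have := abs_sub_abs_le_abs_sub (k : ℝ) v
          rw [abs_sub_comm v]
          linarith
        have h4 := mul_self_le_mul_self (by positivity) h3
        rw [← sq_abs (v - k), ← sq_abs (k:ℝ)]; nlinarith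
      have h2 : (L * v) ^ 2 ≤ L ^ 2 / 4 := by nlinarith [sq_nonneg L]
      have h3 : L ^ 2 * ((k:ℝ) ^ 2 / 4) ≤ (L * (v - k)) ^ 2 := by
        rw [mul_pow]; gcongr
      have hL2 : 1 ≤ L ^ 2 := by nlinarith
      have : (1 + (L * v) ^ 2) * (1 + (k:ℝ) ^ 2) ≤ (1 + L ^ 2 / 4) * (1 + (k:ℝ)^2) := by gcongr
      nlinarith
  rw [e1]
  calc _ ≤ ∑' k : ℤ, ENNReal.ofReal ((8 / (1 + (L * v) ^ 2)) * (1 / (1 + (k : ℝ) ^ 2))) :=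
        ENNReal.tsum_le_tsum fun k => ENNReal.ofReal_le_ofReal (key k)
    _ = ENNReal.ofReal (∑' k : ℤ, (8 / (1 + (L * v) ^ 2)) * (1 / (1 + (k : ℝ) ^ 2))) :=
        (ENNReal.ofReal_tsum_of_nonneg (fun k => by positivity) (summable_zC.mul_left _)).symm
    _ ≤ _ := by
        rw [tsum_mul_left]
        apply ENNReal.ofReal_le_ofReal
        rw [← zC]; apply le_of_eq; ring

theorem offSum_le_const {L : ℝ} (hL : 1 ≤ L) (θ : ℝ) : offSum L θ ≤ ENNReal.ofReal (8 * zC) := by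
  refine (offSum_le_fullSum L θ).trans ((fullSum_le hL θ).trans (ENNReal.ofReal_le_ofReal ?_))
  have := zC_pos
  exact div_le_self (by positivity) (by nlinarith [sq_nonneg (L * (θ / L - round (θ / L)))])

theorem norm_bumpSum_le {L : ℝ} (hL : 1 ≤ L) (p : ℤ) (θ : ℝ) :
    ‖bumpSum L p θ‖ ≤ 8 * zC * bumpC * L * (1 / (1 + (L * (θ / L - round (θ / L))) ^ 2)) := by
  have hz := zC_pos
  have hb := one_le_bumpC
  have h := (enorm_bumpSum_le (by linarith) p θ).trans (mul_le_mul' le_rfl (fullSum_le hL θ))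
  rw [← ENNReal.ofReal_mul (by nlinarith), ← ofReal_norm,
    ENNReal.ofReal_le_ofReal_iff (by positivity)] at h
  refine h.trans (le_of_eq ?_)
  ring

/-! ### Counting integers whose multiples of `t` are nearly integral -/

/-- `N` bounds the cardinality of every set of integers of diameter at most `L / 2` on which
`m ↦ t m` is, modulo integers, constant up to `1 / (2 L)`. -/
def CountBd (L t N : ℝ) : Prop :=
  ∀ (M : Finset ℤ) (k : ℤ → ℤ),
    (∀ m ∈ M, ∀ m' ∈ M, |(m : ℝ) - m'| ≤ L / 2 ∧ |t * (m - m') - (k m - k m')| < 1 / (2 * L)) →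
    (M.card : ℝ) ≤ N

theorem exists_dioph {L t : ℝ} (hL : 0 < L) (M : Finset ℤ) (k : ℤ → ℤ)
    (h : ∀ m ∈ M, ∀ m' ∈ M, |(m : ℝ) - m'| ≤ L / 2 ∧ |t * (m - m') - (k m - k m')| < 1 / (2 * L))
    (hM : 2 ≤ M.card) :
    ∃ q a : ℤ, 1 ≤ q ∧ (q : ℝ) * (M.card - 1) ≤ L / 2 ∧
      ((M.card : ℝ) - 1) * |t * q - a| ≤ 1 / (2 * L) := by
  classical
  have hne : M.Nonempty := Finset.card_pos.1 (by omega)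
  have hex : ∃ q : ℕ, 0 < q ∧ ∃ m ∈ M, ∃ m' ∈ M, m - m' = q := by
    obtain ⟨x, hx, y, hy, hxy⟩ := Finset.one_lt_card.1 (by omega : 1 < M.card)
    rcases lt_or_gt_of_ne hxy with hlt | hlt
    · exact ⟨(y - x).toNat, by omega, y, hy, x, hx, by omega⟩
    · exact ⟨(x - y).toNat, by omega, x, hx, y, hy, by omega⟩
  obtain ⟨hq0, m3, hm3, m2, hm2, hq⟩ := Nat.find_spec hex
  have hmin : ∀ m ∈ M, ∀ m' ∈ M, 0 < m - m' → (Nat.find hex : ℤ) ≤ m - m' := by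
    intro m hm m' hm' hpos
    have := Nat.find_min' hex (m := (m - m').toNat) ⟨by omega, m, hm, m', hm', by omega⟩
    omega
  set q : ℤ := (Nat.find hex : ℤ) with hqdef
  have hq1 : 1 ≤ q := by omega
  set m0 := M.min' hne
  set m1 := M.max' hne
  have hm0 : m0 ∈ M := M.min'_mem hne
  have hm1 : m1 ∈ M := M.max'_mem hne
  set Q := m1 - m0 with hQdef
  have hcard : (M.card : ℤ) ≤ Q / q + 1 := by
    have hinj : M.card ≤ (Finset.Icc (0 : ℤ) (Q / q)).card := by
      refine Finset.card_le_card_of_injOn (fun m => (m - m0) / q) ?_ ?_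
      · intro m hm
        have h1 : m0 ≤ m := M.min'_le m hm
        have h2 : m ≤ m1 := M.le_max' m hm
        simp only [Finset.coe_Icc, Set.mem_Icc]
        exact ⟨Int.ediv_nonneg (by omega) (by omega),
          Int.ediv_le_ediv (by omega) (by omega)⟩
      · intro m hm m' hm' he
        simp only at he
        by_contra hne'
        have e1 := Int.mul_ediv_add_emod (m - m0) q
        have e2 := Int.mul_ediv_add_emod (m' - m0) q
        have r1 := Int.emod_nonneg (m - m0) (by omega : q ≠ 0)
        have r2 := Int.emod_nonneg (m' - m0) (by omega : q ≠ 0)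
        have r3 := Int.emod_lt_of_pos (m - m0) (by omega : 0 < q)
        have r4 := Int.emod_lt_of_pos (m' - m0) (by omega : 0 < q)
        rw [he] at e1
        rcases lt_or_gt_of_ne hne' with hlt | hlt
        · have := hmin m' hm' m hm (by omega)
          omega
        · have := hmin m hm m' hm' (by omega)
          omega
    rw [Int.card_Icc] at hinj
    have : 0 ≤ Q / q := Int.ediv_nonneg (by have := M.min'_le m1 hm1; omega) (by omega)
    omega
  have hQ0 : 0 ≤ Q := by have := M.min'_le m1 hm1; omega
  have hcq : q * ((M.card : ℤ) - 1) ≤ Q := by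
    have := Int.mul_ediv_add_emod Q q
    have := Int.emod_nonneg Q (by omega : q ≠ 0)
    nlinarith
  have hcqR : (q : ℝ) * ((M.card : ℝ) - 1) ≤ Q := by exact_mod_cast hcq
  obtain ⟨hQL, hQA⟩ := h m1 hm1 m0 hm0
  obtain ⟨hqL, hqa⟩ := h m3 hm3 m2 hm2
  have eQ : (m1 : ℝ) - m0 = Q := by simp [hQdef]
  have eq' : (m3 : ℝ) - m2 = q := by exact_mod_cast hq
  set a := k m3 - k m2
  set A := k m1 - k m0
  have ea : (k m3 : ℝ) - k m2 = a := by simp [a]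
  have eA : (k m1 : ℝ) - k m0 = A := by simp [A]
  rw [eQ] at hQL hQA
  rw [eq'] at hqL hqa
  rw [ea] at hqa
  rw [eA] at hQA
  have hq1R : (1 : ℝ) ≤ q := by exact_mod_cast hq1
  have hQ0R : (0 : ℝ) ≤ Q := by exact_mod_cast hQ0
  rw [abs_of_nonneg hQ0R] at hQL
  rw [abs_of_nonneg (by linarith)] at hqL
  have hL2 : 0 < 1 / (2 * L) := by positivity
  have key : Q * a = q * A := by
    have h1 : |(Q : ℝ) * (t * q - a)| ≤ L / 2 * (1 / (2 * L)) := by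
      rw [abs_mul, abs_of_nonneg hQ0R]; gcongr
    have h2 : |(q : ℝ) * (t * Q - A)| ≤ L / 2 * (1 / (2 * L)) := by
      rw [abs_mul, abs_of_nonneg (by linarith)]; gcongr
    have h3 : L / 2 * (1 / (2 * L)) = 1 / 4 := by field_simp; norm_num
    rw [h3] at h1 h2
    have h4 : |((Q * a - q * A : ℤ) : ℝ)| < 1 := by
      have e : ((Q * a - q * A : ℤ) : ℝ) = q * (t * Q - A) - Q * (t * q - a) := by
        push_cast; ring
      rw [e]
      exact (abs_sub _ _).trans_lt (by linarith)
    have h5 : |Q * a - q * A| < 1 := by exact_mod_cast h4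
    have := Int.abs_lt_one_iff.1 h5
    omega
  have keyR : (Q : ℝ) * a = q * A := by exact_mod_cast key
  refine ⟨q, a, hq1, hcqR.trans hQL, ?_⟩
  have h1 : (Q : ℝ) * |t * q - a| = q * |t * Q - A| := by
    rw [← abs_of_nonneg hQ0R, ← abs_mul, abs_of_nonneg hQ0R]
    nth_rw 2 [← abs_of_nonneg (by linarith : (0 : ℝ) ≤ q)]
    rw [← abs_mul]
    congr 1; linear_combination -keyR
  have h2 : (q : ℝ) * (((M.card : ℝ) - 1) * |t * q - a|) ≤ q * (1 / (2 * L)) := by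
    calc (q : ℝ) * (((M.card : ℝ) - 1) * |t * q - a|)
        = (q * ((M.card : ℝ) - 1)) * |t * q - a| := by ring
      _ ≤ Q * |t * q - a| := by gcongr
      _ = q * |t * Q - A| := h1
      _ ≤ _ := by gcongr
  exact le_of_mul_le_mul_left h2 (by linarith)

theorem countBd_trivial {L : ℝ} (hL : 0 < L) (t : ℝ) : CountBd L t (L / 2 + 1) := by
  intro M k h
  rcases lt_or_ge M.card 2 with hM | hM
  · have : (M.card : ℝ) ≤ 1 := by exact_mod_cast (by omega : M.card ≤ 1)
    linarith
  · obtain ⟨q, a, hq, h1, -⟩ := exists_dioph hL M k h hM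
    have hq' : (1 : ℝ) ≤ q := by exact_mod_cast hq
    have hM' : (2 : ℝ) ≤ M.card := by exact_mod_cast hM
    nlinarith

theorem countBd_small {L t : ℝ} (hL : 1 ≤ L) (ht0 : t ≠ 0) (ht : |t| ≤ 1 / (2 * L)) :
    CountBd L t (1 + 1 / (2 * L * |t|)) := by
  intro M k h
  have htp : 0 < |t| := abs_pos.2 ht0
  rcases lt_or_ge M.card 2 with hM | hM
  · have : (M.card : ℝ) ≤ 1 := by exact_mod_cast (by omega : M.card ≤ 1)
    have : 0 < 1 / (2 * L * |t|) := by positivity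
    linarith
  · obtain ⟨q, a, hq, h1, h2⟩ := exists_dioph (by linarith) M k h hM
    have hq' : (1 : ℝ) ≤ q := by exact_mod_cast hq
    have hM' : (2 : ℝ) ≤ M.card := by exact_mod_cast hM
    have hqL : (q : ℝ) ≤ L / 2 := by nlinarith
    have h3 : |t * q - a| ≤ 1 / (2 * L) := by
      have := abs_nonneg (t * q - a); nlinarith
    have h4 : |t * q| ≤ 1 / 4 := by
      rw [abs_mul, abs_of_nonneg (by linarith : (0 : ℝ) ≤ q)]
      calc |t| * q ≤ (1 / (2 * L)) * (L / 2) := by gcongr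
        _ = 1 / 4 := by field_simp; norm_num
    have h5 : 1 / (2 * L) ≤ 1 / 2 := by
      rw [div_le_div_iff₀ (by positivity) (by norm_num)]; linarith
    have ha : a = 0 := by
      have : |(a : ℝ)| < 1 := by
        have e : (a : ℝ) = t * q - (t * q - a) := by ring
        rw [e]
        exact (abs_sub _ _).trans_lt (by linarith)
      exact Int.abs_lt_one_iff.1 (by exact_mod_cast this)
    rw [ha, Int.cast_zero, sub_zero, abs_mul, abs_of_nonneg (by linarith : (0 : ℝ) ≤ q)] at h2
    have h6 : ((M.card : ℝ) - 1) * |t| ≤ 1 / (2 * L) := by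
      refine le_trans ?_ h2
      have : |t| ≤ |t| * q := by nlinarith
      have h0 : (0 : ℝ) ≤ (M.card : ℝ) - 1 := by linarith
      exact mul_le_mul_of_nonneg_left this h0
    have h7 : (M.card : ℝ) - 1 ≤ 1 / (2 * L * |t|) := by
      rw [le_div_iff₀ (by positivity)]
      rw [le_div_iff₀ (by positivity)] at h6
      linarith
    linarith

/-- The majorant of the squared counting function near rationals with small denominator. -/
def weylV (L T t : ℝ) : ℝ :=
  ∑ q ∈ Finset.Icc 1 ⌊L⌋₊, ∑ a ∈ Finset.Icc 1 ⌊2 * (q : ℝ) * T⌋₊,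
    (L / q) ^ 2 / (1 + L ^ 4 * (|t| - a / q) ^ 2)

theorem weylV_nonneg (L T t : ℝ) : 0 ≤ weylV L T t :=
  Finset.sum_nonneg fun q _ => Finset.sum_nonneg fun a _ => by positivity

theorem weyl_data {L t T : ℝ} (hL : 1 ≤ L) (ht : 1 / (2 * L) < |t|) (hT : |t| ≤ T)
    (M : Finset ℤ) (k : ℤ → ℤ)
    (h : ∀ m ∈ M, ∀ m' ∈ M, |(m : ℝ) - m'| ≤ L / 2 ∧ |t * (m - m') - (k m - k m')| < 1 / (2 * L))
    (hM : 2 ≤ M.card) :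
    (M.card : ℝ) - 1 ≤ 2 * L * T ∧ ((M.card : ℝ) - 1) ^ 2 ≤ weylV L T t := by
  obtain ⟨q, a, hq, h1, h2⟩ := exists_dioph (by linarith) M k h hM
  have hq' : (1 : ℝ) ≤ q := by exact_mod_cast hq
  have hM' : (2 : ℝ) ≤ M.card := by exact_mod_cast hM
  have hqL : (q : ℝ) ≤ L / 2 := by nlinarith
  have h3 : |t * q - a| ≤ 1 / (2 * L) := by
    have := abs_nonneg (t * q - a); nlinarith
  set N := (M.card : ℝ) - 1
  have hN : 1 ≤ N := by simp only [N]; linarith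
  have hLpos : 0 < 1 / (2 * L) := by positivity
  have h5 : 1 / (2 * L) ≤ 1 / 2 := by
    rw [div_le_div_iff₀ (by positivity) (by norm_num)]; linarith
  have ha0 : a ≠ 0 := by
    rintro rfl
    rw [Int.cast_zero, sub_zero, abs_mul, abs_of_nonneg (by linarith : (0 : ℝ) ≤ q)] at h3
    nlinarith [abs_nonneg t]
  have ha1 : (1 : ℝ) ≤ |(a : ℝ)| := by exact_mod_cast Int.one_le_abs ha0
  have h4 : |(|t| * q - |(a : ℝ)|)| ≤ |t * q - a| := by
    have := abs_abs_sub_abs_le (t * q) (a : ℝ)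
    rwa [abs_mul, abs_of_nonneg (by linarith : (0 : ℝ) ≤ q)] at this
  have h6 : |(a : ℝ)| ≤ |t| * q + 1 / 2 := by
    have := (abs_le.1 (h4.trans h3)).1
    linarith
  have h7 : |t| * q ≤ q * T := by nlinarith
  have hqT : 1 / 2 ≤ q * T := by linarith
  have haT : |(a : ℝ)| ≤ 2 * q * T := by linarith
  have hT0 : 0 < T := lt_of_lt_of_le (hLpos.trans ht) hT
  refine ⟨?_, ?_⟩
  · have : N ≤ N * (2 * (q * T)) := by nlinarith
    nlinarith
  · have hterm : N ^ 2 ≤ (L / q) ^ 2 / (1 + L ^ 4 * (|t| - |(a : ℝ)| / q) ^ 2) := by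
      rw [le_div_iff₀ (by positivity)]
      have e1 : N * q ≤ L / 2 := by linarith
      have e2 : N * |(|t| * q - |(a : ℝ)|)| ≤ 1 / (2 * L) :=
        (mul_le_mul_of_nonneg_left h4 (by linarith)).trans h2
      have e3 : (|t| - |(a : ℝ)| / q) = (|t| * q - |(a : ℝ)|) / q := by field_simp
      have e4 : (N * (|t| * q - |(a : ℝ)|)) ^ 2 ≤ (1 / (2 * L)) ^ 2 := by
        rw [← sq_abs, abs_mul, abs_of_nonneg (by linarith : 0 ≤ N)]
        exact pow_le_pow_left₀ (by positivity) e2 2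
      have e5 : (N * q) ^ 2 ≤ (L / 2) ^ 2 := pow_le_pow_left₀ (by nlinarith) e1 2
      have hqq : (0:ℝ) < q ^ 2 := by positivity
      have e6 : L ^ 4 * (N * (|t| * q - |(a : ℝ)|)) ^ 2 ≤ L ^ 2 / 4 := by
        calc L ^ 4 * (N * (|t| * q - |(a : ℝ)|)) ^ 2 ≤ L ^ 4 * (1 / (2 * L)) ^ 2 := by gcongr
          _ = L ^ 2 / 4 := by field_simp; norm_num
      rw [e3, div_pow, div_pow, mul_add, mul_one, ← mul_div_assoc, ← mul_div_assoc,
        ← sub_nonneg]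
      have : L ^ 2 / (q:ℝ) ^ 2 - (N ^ 2 + N ^ 2 * (L ^ 4 * (|t| * q - |(a:ℝ)|) ^ 2) / (q:ℝ) ^ 2) =
          (L ^ 2 - (N * q) ^ 2 - L ^ 4 * (N * (|t| * q - |(a : ℝ)|)) ^ 2) / (q:ℝ) ^ 2 := by
        field_simp
        ring
      rw [this]
      apply div_nonneg _ hqq.le
      nlinarith
    refine hterm.trans ?_
    have eq1 : ((q.toNat : ℕ) : ℝ) = q := by
      exact_mod_cast Int.toNat_of_nonneg (by omega : 0 ≤ q)
    have hmq : q.toNat ∈ Finset.Icc 1 ⌊L⌋₊ := by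
      rw [Finset.mem_Icc]
      refine ⟨by omega, Nat.le_floor ?_⟩
      rw [eq1]; linarith
    have ea1 : ((a.natAbs : ℕ) : ℝ) = |(a : ℝ)| := by
      rw [Nat.cast_natAbs]; push_cast; rfl
    have hma : a.natAbs ∈ Finset.Icc 1 ⌊2 * ((q.toNat : ℕ) : ℝ) * T⌋₊ := by
      rw [Finset.mem_Icc]
      refine ⟨by omega, Nat.le_floor ?_⟩
      rw [ea1, eq1]; exact haT
    unfold weylV
    refine le_trans ?_ (Finset.single_le_sum
      (f := fun q : ℕ => ∑ a ∈ Finset.Icc 1 ⌊2 * (q : ℝ) * T⌋₊,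
        (L / q) ^ 2 / (1 + L ^ 4 * (|t| - a / q) ^ 2))
      (fun i _ => Finset.sum_nonneg fun a _ => by positivity) hmq)
    refine le_trans ?_ (Finset.single_le_sum
      (f := fun a : ℕ => (L / (q.toNat : ℕ)) ^ 2 / (1 + L ^ 4 * (|t| - a / (q.toNat : ℕ)) ^ 2))
      (fun i _ => by positivity) hma)
    rw [eq1, ea1]

theorem countBd_weyl {L t T : ℝ} (hL : 1 ≤ L) (ht : 1 / (2 * L) < |t|) (hT : |t| ≤ T) :
    CountBd L t (1 + 2 * L * T) ∧ CountBd L t (1 + Real.sqrt (weylV L T t)) := by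
  have hT0 : 0 < T := lt_of_lt_of_le ((by positivity : 0 < 1 / (2 * L)).trans ht) hT
  have hs := Real.sqrt_nonneg (weylV L T t)
  constructor
  all_goals
    intro M k h
    rcases lt_or_ge M.card 2 with hM | hM
    · have h1 : (M.card : ℝ) ≤ 1 := by exact_mod_cast (by omega : M.card ≤ 1)
      nlinarith [mul_pos (by linarith : 0 < L) hT0]
    · have h1 := weyl_data hL ht hT M k h hM
      first
        | linarith [h1.1]
        | linarith [Real.le_sqrt_of_sq_le h1.2]

/-! ### Bilinear exponential sums -/

/-- The bilinear exponential sum over a unit box of lattice points. -/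
def bilSum (L s ξ η : ℝ) (p q : ℤ) : ℂ :=
  ∑ m ∈ win L p, (bump ((m : ℝ) / L - p) : ℂ) * efun (ξ * ((m : ℝ) / L)) *
    bumpSum L q (η + s * ((m : ℝ) / L))

/-- The integral corresponding to `bilSum`. -/
def bilInt (s ξ η : ℝ) (p q : ℤ) : ℂ :=
  ∫ x : ℝ, (bump (x - p) : ℂ) * efun (ξ * x) * bumpInt q (η + s * x)

/-- The constant in the counting bound for bilinear sums. -/
def bilC : ℝ := 8 * zC * bumpC * (40 * zC)

theorem bilC_pos : 0 < bilC := by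
  have := zC_pos; have := one_le_bumpC; unfold bilC; positivity

theorem sum_inv_sq_le (S : Finset ℤ) : ∑ r ∈ S, 1 / (1 + (r : ℝ) ^ 2) ≤ zC :=
  summable_zC.sum_le_tsum S fun k _ => by positivity

theorem norm_bilSum_le {L s N : ℝ} (hL : 1 ≤ L) (h : CountBd L (s / L ^ 2) N)
    (ξ η : ℝ) (p q : ℤ) : ‖bilSum L s ξ η p q‖ ≤ bilC * L * N := by
  classical
  have hL0 : 0 < L := by linarith
  have hz := zC_pos
  have hb := one_le_bumpC
  set v : ℤ → ℝ := fun m => (η + s * ((m : ℝ) / L)) / L - round ((η + s * ((m : ℝ) / L)) / L)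
    with hv
  set r : ℤ → ℤ := fun m => ⌊2 * L * v m⌋ with hr
  set w : ℤ → ℤ := fun m => ⌊2 * ((m : ℝ) / L - p + 1)⌋ with hw
  have step1 : ‖bilSum L s ξ η p q‖ ≤
      8 * zC * bumpC * L * ∑ m ∈ win L p, 8 * (1 / (1 + (r m : ℝ) ^ 2)) := by
    unfold bilSum
    refine (norm_sum_le _ _).trans ?_
    rw [Finset.mul_sum]
    refine Finset.sum_le_sum fun m _ => ?_
    rw [norm_mul, norm_mul, norm_efun, mul_one]
    calc _ ≤ 1 * (8 * zC * bumpC * L * (1 / (1 + (L * v m) ^ 2))) :=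
          mul_le_mul (norm_bump_le_one _) (norm_bumpSum_le hL q _) (norm_nonneg _) zero_le_one
      _ ≤ _ := by
          rw [one_mul]
          refine mul_le_mul_of_nonneg_left ?_ (by positivity)
          rw [mul_one_div, div_le_div_iff₀ (by positivity) (by positivity)]
          have f1 := Int.floor_le (2 * L * v m)
          have f2 := Int.lt_floor_add_one (2 * L * v m)
          have : (r m : ℝ) ^ 2 ≤ 2 * (2 * L * v m) ^ 2 + 2 := by
            simp only [hr]
            nlinarith [sq_nonneg ((⌊2 * L * v m⌋ : ℝ) - 2 * (2 * L * v m))]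
          nlinarith [sq_nonneg (L * v m)]
  set S := (win L p).image fun m => (w m, r m)
  have hmaps : ∀ m ∈ win L p, (w m, r m) ∈ S := fun m hm => Finset.mem_image_of_mem _ hm
  have step2 : ∑ m ∈ win L p, 8 * (1 / (1 + (r m : ℝ) ^ 2)) ≤
      ∑ b ∈ S, N * (8 * (1 / (1 + (b.2 : ℝ) ^ 2))) := by
    rw [← Finset.sum_fiberwise_of_maps_to hmaps]
    refine Finset.sum_le_sum fun b _ => ?_
    have : ∀ m ∈ (win L p).filter (fun m => (w m, r m) = b),
        8 * (1 / (1 + (r m : ℝ) ^ 2)) = 8 * (1 / (1 + (b.2 : ℝ) ^ 2)) := by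
      intro m hm
      rw [← (Finset.mem_filter.1 hm).2]
    rw [Finset.sum_congr rfl this, Finset.sum_const, nsmul_eq_mul]
    refine mul_le_mul_of_nonneg_right ?_ (by positivity)
    refine h _ (fun m => round ((η + s * ((m : ℝ) / L)) / L)) fun m hm m' hm' => ?_
    have e1 := (Finset.mem_filter.1 hm).2
    have e2 := (Finset.mem_filter.1 hm').2
    have ew : w m = w m' := by rw [← e2] at e1; exact (Prod.ext_iff.1 e1).1
    have er : r m = r m' := by rw [← e2] at e1; exact (Prod.ext_iff.1 e1).2
    constructor
    · have := Int.abs_sub_lt_one_of_floor_eq_floor ew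
      have e : 2 * ((m : ℝ) / L - p + 1) - 2 * ((m' : ℝ) / L - p + 1) = 2 / L * (m - m') := by
        field_simp; ring
      rw [e, abs_mul, abs_of_pos (by positivity : 0 < 2 / L), div_mul_eq_mul_div,
        div_lt_one hL0] at this
      linarith
    · have := Int.abs_sub_lt_one_of_floor_eq_floor er
      rw [← mul_sub, abs_mul, abs_of_pos (by positivity : 0 < 2 * L)] at this
      rw [lt_div_iff₀ (by positivity)]
      have e : s / L ^ 2 * ((m : ℝ) - m') - (round ((η + s * ((m : ℝ) / L)) / L) -
          round ((η + s * ((m' : ℝ) / L)) / L)) = v m - v m' := by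
        simp only [hv]; field_simp; ring
      rw [e]; linarith
  have hN : 0 ≤ N := by
    have := h ∅ (fun _ => 0) (by simp)
    simpa using this
  have step3 : ∑ b ∈ S, N * (8 * (1 / (1 + (b.2 : ℝ) ^ 2))) ≤ N * (40 * zC) := by
    rw [← Finset.mul_sum]
    refine mul_le_mul_of_nonneg_left ?_ hN
    have hsub : S ⊆ (Finset.Icc (0 : ℤ) 4) ×ˢ (S.image Prod.snd) := by
      intro b hb
      rw [Finset.mem_product]
      refine ⟨?_, Finset.mem_image_of_mem _ hb⟩
      obtain ⟨m, hm, rfl⟩ := Finset.mem_image.1 hb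
      rw [mem_win hL0, abs_le] at hm
      rw [Finset.mem_Icc]
      constructor
      · exact Int.floor_nonneg.2 (by linarith)
      · have : w m < 5 := Int.floor_lt.2 (by push_cast; linarith)
        omega
    calc _ ≤ ∑ b ∈ (Finset.Icc (0 : ℤ) 4) ×ˢ (S.image Prod.snd), 8 * (1 / (1 + (b.2 : ℝ) ^ 2)) :=
          Finset.sum_le_sum_of_subset_of_nonneg hsub fun _ _ _ => by positivity
      _ = 40 * ∑ b ∈ S.image Prod.snd, (1 / (1 + (b : ℝ) ^ 2)) := by
          rw [Finset.sum_product]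
          dsimp only
          rw [Finset.sum_const, Int.card_Icc, ← Finset.mul_sum, nsmul_eq_mul,
            show (((4 : ℤ) + 1 - 0).toNat : ℝ) = 5 by norm_num [show Int.toNat 5 = 5 from rfl]]
          ring
      _ ≤ 40 * zC := by have := sum_inv_sq_le (S.image Prod.snd); linarith
  calc _ ≤ _ := step1
    _ ≤ 8 * zC * bumpC * L * (N * (40 * zC)) :=
        mul_le_mul_of_nonneg_left (step2.trans step3) (by positivity)
    _ = _ := by unfold bilC; ring

/-! ### Integrals of Lorentzians -/

theorem lintegral_comp_mul_left {g : ℝ → ℝ≥0∞} (hg : Measurable g) {a : ℝ} (ha : a ≠ 0) :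
    ∫⁻ s, g (a * s) = ENNReal.ofReal |a⁻¹| * ∫⁻ s, g s := by
  have h := lintegral_map (μ := (volume : Measure ℝ)) hg (measurable_const_mul a)
  rw [← h, Real.map_volume_mul_left ha, lintegral_smul_measure, smul_eq_mul]

/-- The Lorentzian `1 / (1 + u²)` as an extended nonnegative real. -/
def lor (u : ℝ) : ℝ≥0∞ := ENNReal.ofReal (1 / (1 + u ^ 2))

@[fun_prop]
theorem measurable_lor : Measurable lor := by unfold lor; fun_prop

theorem lor_le_one (u : ℝ) : lor u ≤ 1 := by
  unfold lor
  rw [ENNReal.ofReal_le_one]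
  exact (div_le_one (by positivity)).2 (by nlinarith)

theorem lintegral_lor : ∫⁻ s, lor s = ENNReal.ofReal Real.pi := by
  have := integral_univ_inv_one_add_sq
  unfold lor
  simp_rw [one_div]
  rw [← ofReal_integral_eq_lintegral_ofReal integrable_inv_one_add_sq
    (Filter.Eventually.of_forall fun x => by positivity), this]

theorem lintegral_lor_affine {x : ℝ} (hx : x ≠ 0) (c : ℝ) :
    ∫⁻ s, lor (x * s - c) = ENNReal.ofReal (Real.pi / |x|) := by
  rw [lintegral_comp_mul_left (g := fun u => lor (u - c)) (by fun_prop) hx,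
    lintegral_sub_right_eq_self, lintegral_lor, ← ENNReal.ofReal_mul (abs_nonneg _), abs_inv]
  congr 1; ring

theorem lintegral_lor_mul_lor (x c : ℝ) :
    ∫⁻ s, lor s * lor (x * s - c) ≤
      ENNReal.ofReal (2 * Real.pi * (1 + |x|) / (1 + x ^ 2 + c ^ 2)) := by
  have hpt : ∀ s, lor s * lor (x * s - c) ≤ ENNReal.ofReal (2 / (1 + x ^ 2 + c ^ 2)) *
      (ENNReal.ofReal (x ^ 2) * lor (x * s - c) + lor s) := by
    intro s
    unfold lor
    rw [← ENNReal.ofReal_mul (by positivity), ← ENNReal.ofReal_mul (by positivity),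
      ← ENNReal.ofReal_add (by positivity) (by positivity), ← ENNReal.ofReal_mul (by positivity)]
    apply ENNReal.ofReal_le_ofReal
    have e : 2 / (1 + x ^ 2 + c ^ 2) * (x ^ 2 * (1 / (1 + (x * s - c) ^ 2)) + 1 / (1 + s ^ 2)) =
        2 * (x ^ 2 * (1 + s ^ 2) + (1 + (x * s - c) ^ 2)) /
          ((1 + x ^ 2 + c ^ 2) * ((1 + s ^ 2) * (1 + (x * s - c) ^ 2))) := by
      field_simp
    rw [e, div_mul_div_comm, div_le_div_iff₀ (by positivity) (by positivity)]
    have h1 : 1 + x ^ 2 + c ^ 2 ≤ 2 * (x ^ 2 * (1 + s ^ 2) + (1 + (x * s - c) ^ 2)) := by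
      nlinarith [sq_nonneg (2 * (x * s) - c), sq_nonneg x]
    have h2 : 0 ≤ (1 + s ^ 2) * (1 + (x * s - c) ^ 2) := by positivity
    nlinarith [mul_le_mul_of_nonneg_right h1 h2]
  refine (lintegral_mono hpt).trans ?_
  rw [lintegral_const_mul _ (by fun_prop), lintegral_add_left (by fun_prop),
    lintegral_const_mul _ (by fun_prop), lintegral_lor]
  rcases eq_or_ne x 0 with rfl | hx
  · simp only [ne_eq, OfNat.ofNat_ne_zero, not_false_eq_true, zero_pow, ENNReal.ofReal_zero,
      zero_mul, zero_add, abs_zero, add_zero, mul_one]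
    rw [← ENNReal.ofReal_mul (by positivity)]
    apply le_of_eq; congr 1; ring
  · rw [lintegral_lor_affine hx, ← ENNReal.ofReal_mul (by positivity),
      ← ENNReal.ofReal_add (by positivity) (by positivity), ← ENNReal.ofReal_mul (by positivity)]
    apply ENNReal.ofReal_le_ofReal
    apply le_of_eq
    have : x ^ 2 * (Real.pi / |x|) = |x| * Real.pi := by
      rw [← sq_abs]; field_simp
    rw [this]; ring

theorem sum_arctan_bound {a : ℝ} (ha : 0 < a) (n : ℕ) :
    ∑ k ∈ Finset.range n, a / (1 + (a * ((k : ℝ) + 1)) ^ 2) ≤ Real.arctan (a * n) := by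
  induction n with
  | zero => simp
  | succ n ih =>
    rw [Finset.sum_range_succ]
    have h := (convex_Icc (a * n) (a * (n + 1))).mul_sub_le_image_sub_of_le_deriv
      (f := Real.arctan) Real.continuous_arctan.continuousOn
      Real.differentiable_arctan.differentiableOn
      (C := 1 / (1 + (a * ((n : ℝ) + 1)) ^ 2)) (fun x hx => by
        rw [interior_Icc] at hx
        rw [Real.deriv_arctan]
        have h0 : 0 ≤ a * n := by positivity
        have h1 := hx.1
        have h2 := hx.2
        exact one_div_le_one_div_of_le (by positivity) (by nlinarith))
      (a * n) ⟨le_rfl, by nlinarith⟩ (a * (n + 1)) ⟨by nlinarith, le_rfl⟩ (by nlinarith)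
    push_cast
    have e : 1 / (1 + (a * ((n : ℝ) + 1)) ^ 2) * (a * (n + 1) - a * n) =
      a / (1 + (a * ((n : ℝ) + 1)) ^ 2) := by ring
    linarith

theorem tsum_arctan_bound {a : ℝ} (ha : 0 < a) :
    ∑' k : ℕ, ENNReal.ofReal (a / (1 + (a * ((k : ℝ) + 1)) ^ 2)) ≤ ENNReal.ofReal (Real.pi / 2) := by
  refine ENNReal.tsum_le_of_sum_range_le fun n => ?_
  rw [← ENNReal.ofReal_sum_of_nonneg fun i _ => by positivity]
  exact ENNReal.ofReal_le_ofReal ((sum_arctan_bound ha n).trans (Real.arctan_lt_pi_div_two _).le)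

/-- The constant of `lintegral_lor_mul_offSum`. -/
def offC : ℝ := 32 * zC * Real.pi + 16 * Real.pi ^ 2

theorem offC_pos : 0 < offC := by
  have := zC_pos; have := Real.pi_pos; unfold offC; positivity

theorem lintegral_lor_mul_offSum {L : ℝ} (hL : 1 ≤ L) (x η : ℝ) :
    ∫⁻ s, lor s * offSum L (η + s * x) ≤ ENNReal.ofReal (offC * (1 + |η|) / L) := by
  have hπ := Real.pi_pos
  have hz := zC_pos
  have hL0 : 0 < L := by linarith
  rcases le_or_gt (L / 4) |η| with h | h
  · calc _ ≤ ∫⁻ s, lor s * ENNReal.ofReal (8 * zC) :=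
          lintegral_mono fun s => mul_le_mul' le_rfl (offSum_le_const hL _)
      _ = ENNReal.ofReal (Real.pi * (8 * zC)) := by
          rw [lintegral_mul_const _ measurable_lor, lintegral_lor,
            ← ENNReal.ofReal_mul hπ.le]
      _ ≤ _ := by
          apply ENNReal.ofReal_le_ofReal
          rw [le_div_iff₀ hL0]
          have : L ≤ 4 * |η| := by linarith
          calc Real.pi * (8 * zC) * L ≤ Real.pi * (8 * zC) * (4 * |η|) := by gcongr
            _ = 32 * zC * Real.pi * |η| := by ring
            _ ≤ offC * (1 + |η|) := by
              unfold offC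
              gcongr
              · have : 0 ≤ 16 * Real.pi ^ 2 := by positivity
                linarith
              · linarith
  · set X := 1 + |x|
    have hX : 1 ≤ X := by simp only [X]; linarith [abs_nonneg x]
    set a := L / (2 * X) with ha
    have ha0 : 0 < a := by positivity
    have hterm : ∀ k : ℕ, ∀ c : ℝ, L * (k + 1) / 2 ≤ |c| →
        ∫⁻ s, lor s * lor (x * s - c) ≤
          ENNReal.ofReal (8 * Real.pi / L) *
            ENNReal.ofReal (a / (1 + (a * ((k : ℝ) + 1)) ^ 2)) := by
      intro k c hc
      refine (lintegral_lor_mul_lor x c).trans ?_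
      rw [← ENNReal.ofReal_mul (by positivity)]
      apply ENNReal.ofReal_le_ofReal
      have hX2 : X ^ 2 / 2 ≤ 1 + x ^ 2 := by
        simp only [X]; nlinarith [sq_abs x, sq_nonneg (|x| - 1)]
      have hc2 : (L * (k + 1) / 2) ^ 2 ≤ c ^ 2 := by
        rw [← sq_abs c]; exact pow_le_pow_left₀ (by positivity) hc 2
      have hden : (X ^ 2 + (L * (k + 1) / 2) ^ 2) / 2 ≤ 1 + x ^ 2 + c ^ 2 := by
        nlinarith [sq_nonneg c]
      calc 2 * Real.pi * X / (1 + x ^ 2 + c ^ 2)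
          ≤ 2 * Real.pi * X / ((X ^ 2 + (L * (k + 1) / 2) ^ 2) / 2) := by gcongr
        _ = _ := by
          rw [ha]; field_simp; ring
    have hsplit : ∀ θ : ℝ, offSum L θ =
        ∑' k : ℕ, (lor (θ - L * ((k : ℝ) + 1)) + lor (θ + L * ((k : ℝ) + 1))) := by
      intro θ
      unfold offSum
      rw [tsum_of_nat_of_neg_add_one ENNReal.summable ENNReal.summable,
        tsum_eq_zero_add' ENNReal.summable]
      simp only [Nat.cast_zero, if_true, zero_add]
      rw [← ENNReal.tsum_add]
      refine tsum_congr fun k => ?_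
      rw [if_neg (by omega), if_neg (by omega)]
      unfold lor
      push_cast
      congr 5
      ring
    have hmeas : ∀ c : ℝ, Measurable fun s => lor s * lor (x * s - c) := fun c => by fun_prop
    have e1 : ∀ s, lor s * offSum L (η + s * x) =
        ∑' k : ℕ, (lor s * lor (x * s - (L * ((k : ℝ) + 1) - η)) +
          lor s * lor (x * s - (-(L * ((k : ℝ) + 1)) - η))) := by
      intro s
      rw [hsplit, ← ENNReal.tsum_mul_left]
      refine tsum_congr fun k => ?_
      rw [mul_add]
      congr 3 <;> ring
    simp_rw [e1]
    rw [lintegral_tsum (f := fun (k : ℕ) s => lor s * lor (x * s - (L * ((k : ℝ) + 1) - η)) +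
      lor s * lor (x * s - (-(L * ((k : ℝ) + 1)) - η))) (fun k => by fun_prop)]
    have hk : ∀ k : ℕ, ∫⁻ s, (lor s * lor (x * s - (L * ((k : ℝ) + 1) - η)) +
          lor s * lor (x * s - (-(L * ((k : ℝ) + 1)) - η))) ≤
        ENNReal.ofReal (16 * Real.pi / L) *
            ENNReal.ofReal (a / (1 + (a * ((k : ℝ) + 1)) ^ 2)) := by
      intro k
      rw [lintegral_add_left (hmeas _)]
      have hk1 : L ≤ L * ((k : ℝ) + 1) := by
        have : (0 : ℝ) ≤ k := Nat.cast_nonneg k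
        nlinarith
      rw [abs_lt] at h
      have b1 := hterm k (L * ((k : ℝ) + 1) - η) (by
        rw [le_abs]; left; linarith)
      have b2 := hterm k (-(L * ((k : ℝ) + 1)) - η) (by
        rw [le_abs]; right; linarith)
      refine (add_le_add b1 b2).trans ?_
      rw [← add_mul, ← ENNReal.ofReal_add (by positivity) (by positivity)]
      apply le_of_eq
      congr 2; ring
    refine (ENNReal.tsum_le_tsum hk).trans ?_
    rw [ENNReal.tsum_mul_left]
    refine (mul_le_mul' le_rfl (tsum_arctan_bound ha0)).trans ?_
    rw [← ENNReal.ofReal_mul (by positivity)]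
    apply ENNReal.ofReal_le_ofReal
    rw [div_mul_eq_mul_div]
    apply div_le_div_of_nonneg_right _ hL0.le
    unfold offC
    have h1 : 0 ≤ |η| := abs_nonneg η
    have h2 : 0 ≤ 32 * zC * Real.pi := by positivity
    have h3 : 0 ≤ Real.pi ^ 2 := by positivity
    nlinarith [mul_nonneg h2 h1, mul_nonneg h3 h1]

/-! ### Pointwise bounds for bilinear sums and integrals -/

theorem norm_bilSum_le_trivial {L : ℝ} (hL : 1 ≤ L) (s ξ η : ℝ) (p q : ℤ) :
    ‖bilSum L s ξ η p q‖ ≤ 2 * bilC * L ^ 2 := by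
  refine (norm_bilSum_le hL (countBd_trivial (by linarith) _) ξ η p q).trans ?_
  have := bilC_pos
  rw [mul_assoc]
  calc bilC * (L * (L / 2 + 1)) ≤ bilC * (2 * L ^ 2) := by
        refine mul_le_mul_of_nonneg_left ?_ this.le
        nlinarith
    _ = _ := by ring

theorem norm_bilSum_le_small {L s : ℝ} (hL : 1 ≤ L) (hs : |s| ≤ L / 2) (ξ η : ℝ) (p q : ℤ) :
    ‖bilSum L s ξ η p q‖ ≤ 3 * bilC * L ^ 2 / (1 + |s|) := by
  have hb := bilC_pos
  have hL0 : 0 < L := by linarith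
  have habs : 0 ≤ |s| := abs_nonneg s
  rw [le_div_iff₀ (by positivity)]
  rcases le_or_gt |s| 1 with h1 | h1
  · have h := norm_bilSum_le hL (countBd_trivial hL0 (s / L ^ 2)) ξ η p q
    calc _ ≤ bilC * L * (L / 2 + 1) * 2 := by gcongr; linarith
      _ = bilC * (L * (L + 2)) := by ring
      _ ≤ bilC * (3 * L ^ 2) := by
        refine mul_le_mul_of_nonneg_left ?_ hb.le
        nlinarith
      _ = _ := by ring
  · have hs0 : s ≠ 0 := by rintro rfl; simp at h1; linarith
    have ht : |s / L ^ 2| = |s| / L ^ 2 := by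
      rw [abs_div, abs_of_pos (by positivity : 0 < L ^ 2)]
    have h := norm_bilSum_le hL (countBd_small hL (t := s / L ^ 2) (by positivity) (by
      rw [ht, div_le_div_iff₀ (by positivity) (by positivity)]; nlinarith)) ξ η p q
    have e : 1 / (2 * L * |s / L ^ 2|) = L / (2 * |s|) := by
      rw [ht]; field_simp
    rw [e] at h
    calc _ ≤ bilC * L * (1 + L / (2 * |s|)) * (2 * |s|) := by gcongr; linarith
      _ = bilC * (L * (2 * |s| + L)) := by field_simp
      _ ≤ bilC * (3 * L ^ 2) := by
        refine mul_le_mul_of_nonneg_left ?_ hb.le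
        nlinarith
      _ = _ := by ring

theorem norm_bilSum_le_weyl {L s T : ℝ} (hL : 1 ≤ L) (hs : L / 2 < |s|) (hT : |s| ≤ T * L ^ 2)
    (ξ η : ℝ) (p q : ℤ) :
    ‖bilSum L s ξ η p q‖ ≤ 2 * bilC * L ^ 2 * (1 / L + T) ∧
    ‖bilSum L s ξ η p q‖ ^ 2 ≤ 2 * bilC ^ 2 * L ^ 2 * (1 + weylV L T (s / L ^ 2)) := by
  have hb := bilC_pos
  have hL0 : 0 < L := by linarith
  have ht : |s / L ^ 2| = |s| / L ^ 2 := by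
    rw [abs_div, abs_of_pos (by positivity : 0 < L ^ 2)]
  obtain ⟨h1, h2⟩ := countBd_weyl hL (t := s / L ^ 2) (T := T)
    (by rw [ht, div_lt_div_iff₀ (by positivity) (by positivity)]; nlinarith)
    (by rw [ht, div_le_iff₀ (by positivity)]; exact hT)
  have b1 := norm_bilSum_le hL h1 ξ η p q
  have b2 := norm_bilSum_le hL h2 ξ η p q
  constructor
  · refine b1.trans ?_
    have e : 2 * bilC * L ^ 2 * (1 / L + T) = bilC * L * (2 + 2 * L * T) := by field_simp
    rw [e]
    refine mul_le_mul_of_nonneg_left ?_ (by positivity)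
    linarith
  · refine (pow_le_pow_left₀ (norm_nonneg _) b2 2).trans ?_
    have hV := weylV_nonneg L T (s / L ^ 2)
    have hsq := Real.sq_sqrt hV
    have : (1 + Real.sqrt (weylV L T (s / L ^ 2))) ^ 2 ≤ 2 * (1 + weylV L T (s / L ^ 2)) := by
      nlinarith [sq_nonneg (1 - Real.sqrt (weylV L T (s / L ^ 2)))]
    calc _ = bilC ^ 2 * L ^ 2 * (1 + Real.sqrt (weylV L T (s / L ^ 2))) ^ 2 := by ring
      _ ≤ bilC ^ 2 * L ^ 2 * (2 * (1 + weylV L T (s / L ^ 2))) := by gcongr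
      _ = _ := by ring

theorem norm_bump_le_indicator (p : ℤ) (x : ℝ) :
    ‖(bump (x - p) : ℂ)‖ ≤ (Set.Icc ((p : ℝ) - 1) (p + 1)).indicator (fun _ => (1 : ℝ)) x := by
  by_cases h : x ∈ Set.Icc ((p : ℝ) - 1) (p + 1)
  · rw [Set.indicator_of_mem h]; exact norm_bump_le_one _
  · rw [Set.indicator_of_notMem h, bump_eq_zero]
    · simp
    · by_contra h'
      rw [not_le, abs_lt] at h'
      exact h ⟨by linarith, by linarith⟩

theorem norm_bilInt_le (s ξ η : ℝ) (p q : ℤ) :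
    ‖bilInt s ξ η p q‖ ≤ 6 * bumpC / (1 + |s|) := by
  have hb := one_le_bumpC
  have hpt : ∀ x : ℝ, ‖(bump (x - p) : ℂ) * efun (ξ * x) * bumpInt q (η + s * x)‖ ≤
      (Set.Icc ((p : ℝ) - 1) (p + 1)).indicator (fun _ => (1 : ℝ)) x *
        (bumpC / (1 + (η + s * x) ^ 2)) := by
    intro x
    rw [norm_mul, norm_mul, norm_efun, mul_one]
    exact mul_le_mul (norm_bump_le_indicator p x) (norm_bumpInt_le _ _) (norm_nonneg _)
      (Set.indicator_nonneg (fun _ _ => zero_le_one) _)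
  have hI : Integrable ((Set.Icc ((p : ℝ) - 1) (p + 1)).indicator (fun _ => bumpC)) :=
    (integrable_indicator_iff measurableSet_Icc).2 (by simp)
  have h1 : ‖bilInt s ξ η p q‖ ≤ 2 * bumpC := by
    have h := norm_integral_le_of_norm_le hI (f := fun x : ℝ =>
      (bump (x - p) : ℂ) * efun (ξ * x) * bumpInt q (η + s * x))
      (Filter.Eventually.of_forall fun x => by
        refine (hpt x).trans ?_
        by_cases hx : x ∈ Set.Icc ((p : ℝ) - 1) (p + 1)
        · rw [Set.indicator_of_mem hx, Set.indicator_of_mem hx, one_mul]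
          exact div_le_self (by linarith) (by nlinarith [sq_nonneg (η + s * x)])
        · rw [Set.indicator_of_notMem hx, Set.indicator_of_notMem hx, zero_mul])
    refine h.trans (le_of_eq ?_)
    rw [integral_indicator measurableSet_Icc, setIntegral_const]
    simp [Measure.real]
    left; norm_num
  have habs := abs_nonneg s
  rw [le_div_iff₀ (by positivity)]
  rcases eq_or_ne s 0 with rfl | hs
  · rw [abs_zero]; linarith
  have h2 : ‖bilInt s ξ η p q‖ ≤ bumpC * Real.pi / |s| := by
    have hg : Integrable (fun x : ℝ => bumpC * (1 + (η + s * x) ^ 2)⁻¹) := by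
      refine Integrable.const_mul ?_ _
      exact ((integrable_inv_one_add_sq.comp_add_left η).comp_mul_left' hs :)
    have h := norm_integral_le_of_norm_le hg (f := fun x : ℝ =>
      (bump (x - p) : ℂ) * efun (ξ * x) * bumpInt q (η + s * x))
      (Filter.Eventually.of_forall fun x => by
        refine (hpt x).trans ?_
        rw [div_eq_mul_inv]
        refine mul_le_of_le_one_left (by positivity) ?_
        exact Set.indicator_le_self' (fun _ _ => zero_le_one) x)
    refine h.trans (le_of_eq ?_)
    rw [integral_const_mul, Measure.integral_comp_mul_left (fun y => (1 + (η + y) ^ 2)⁻¹),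
      integral_add_left_eq_self (fun y : ℝ => (1 + y ^ 2)⁻¹) η, integral_univ_inv_one_add_sq, abs_inv,
      smul_eq_mul]
    ring
  have h3 : ‖bilInt s ξ η p q‖ * |s| ≤ bumpC * Real.pi :=
    (le_div_iff₀ (abs_pos.2 hs)).1 h2
  nlinarith [Real.pi_le_four]

attribute [fun_prop] measurable_offSum

/-! ### Comparison of bilinear sums and integrals -/

theorem integrable_bump_sub (p : ℝ) : Integrable fun x : ℝ => (bump (x - p) : ℂ) := by
  have h : Integrable bump := continuous_bump.integrable_of_hasCompactSupport hasCompactSupport_bump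
  exact (h.comp_sub_right p).ofReal

/-- The integrand of `bilInt` as a function of two variables. -/
def bilKer (s ξ η : ℝ) (p q : ℤ) (z : ℝ × ℝ) : ℂ :=
  (bump (z.1 - p) : ℂ) * (bump (z.2 - q) : ℂ) * efun (ξ * z.1 + η * z.2 + s * (z.1 * z.2))

theorem continuous_bilKer (s ξ η : ℝ) (p q : ℤ) : Continuous (bilKer s ξ η p q) := by
  unfold bilKer; fun_prop

theorem norm_bilKer (s ξ η : ℝ) (p q : ℤ) (z : ℝ × ℝ) :
    ‖bilKer s ξ η p q z‖ = ‖(bump (z.1 - p) : ℂ) * (bump (z.2 - q) : ℂ)‖ := by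
  rw [bilKer, norm_mul, norm_efun, mul_one]

theorem integrable_bilKer (s ξ η : ℝ) (p q : ℤ) : Integrable (bilKer s ξ η p q) := by
  have h : Integrable (fun z : ℝ × ℝ => (bump (z.1 - p) : ℂ) * (bump (z.2 - q) : ℂ)) :=
    (integrable_bump_sub p).mul_prod (integrable_bump_sub q)
  exact h.mono (continuous_bilKer s ξ η p q).aestronglyMeasurable
    (Filter.Eventually.of_forall fun z => (norm_bilKer s ξ η p q z).le)

theorem bilInt_eq_integral_bilKer (s ξ η : ℝ) (p q : ℤ) :
    bilInt s ξ η p q = ∫ z, bilKer s ξ η p q z := by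
  rw [Measure.volume_eq_prod, integral_prod _ (integrable_bilKer s ξ η p q), bilInt]
  congr 1; ext x
  rw [bumpInt, ← integral_const_mul]
  congr 1; ext y
  rw [bilKer, show ξ * x + η * y + s * (x * y) = ξ * x + (η + s * x) * y by ring, efun_add]
  ring

theorem bilInt_eq_swap (s ξ η : ℝ) (p q : ℤ) :
    bilInt s ξ η p q =
      ∫ y : ℝ, (bump (y - q) : ℂ) * efun (η * y) * bumpInt p (ξ + s * y) := by
  rw [bilInt_eq_integral_bilKer, Measure.volume_eq_prod,
    integral_prod_symm _ (integrable_bilKer s ξ η p q)]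
  congr 1; ext y
  rw [bumpInt, ← integral_const_mul]
  congr 1; ext x
  rw [bilKer, show ξ * x + η * y + s * (x * y) = η * y + (ξ + s * y) * x by ring, efun_add]
  ring

/-- Majorant for the difference of `bilSum` and `L² bilInt`. -/
def offMaj (L s ξ η : ℝ) (p q : ℤ) : ℝ≥0∞ :=
  ENNReal.ofReal (L * bumpC) * (∑ m ∈ win L p, offSum L (η + s * ((m : ℝ) / L)) +
    ENNReal.ofReal L * ∫⁻ y in Set.Icc ((q : ℝ) - 1) (q + 1), offSum L (ξ + s * y))

theorem measurable_offMaj (L ξ η : ℝ) (p q : ℤ) : Measurable fun s => offMaj L s ξ η p q := by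
  unfold offMaj
  have hm := measurable_offSum L
  refine Measurable.const_mul (Measurable.add ?_ (Measurable.const_mul ?_ _)) _
  · exact Finset.measurable_fun_sum _ fun m _ => hm.comp (by fun_prop)
  · exact Measurable.lintegral_prod_right' (f := fun z : ℝ × ℝ => offSum L (ξ + z.1 * z.2))
      (hm.comp (by fun_prop))

theorem enorm_bump_le_indicator (p : ℤ) (x : ℝ) :
    ‖(bump (x - p) : ℂ)‖ₑ ≤ (Set.Icc ((p : ℝ) - 1) (p + 1)).indicator (fun _ => (1 : ℝ≥0∞)) x := by
  have h := norm_bump_le_indicator p x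
  by_cases hx : x ∈ Set.Icc ((p : ℝ) - 1) (p + 1)
  · rw [Set.indicator_of_mem hx] at h ⊢
    rw [← ofReal_norm]
    simpa using h
  · rw [Set.indicator_of_notMem hx] at h ⊢
    rw [norm_le_zero_iff] at h
    simp [h]

theorem continuous_bumpInt (p : ℝ) : Continuous (bumpInt p) := by
  unfold bumpInt
  refine continuous_of_dominated (bound := fun y => ‖(bump (y - p) : ℂ)‖) ?_ ?_
    (integrable_bump_sub p).norm ?_
  · intro θ
    exact (by fun_prop : Continuous fun y : ℝ => (bump (y - p) : ℂ) * efun (θ * y)).aestronglyMeasurable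
  · intro θ
    exact Filter.Eventually.of_forall fun y => by rw [norm_mul, norm_efun, mul_one]
  · exact Filter.Eventually.of_forall fun y => by fun_prop

theorem continuous_bumpSum (L : ℝ) (p : ℤ) : Continuous (bumpSum L p) := by
  unfold bumpSum; fun_prop

theorem bilSum_sub_eq {L : ℝ} (s ξ η : ℝ) (p q : ℤ) :
    bilSum L s ξ η p q - L ^ 2 * bilInt s ξ η p q =
      ∑ m ∈ win L p, (bump ((m : ℝ) / L - p) : ℂ) * efun (ξ * ((m : ℝ) / L)) *
          (bumpSum L q (η + s * ((m : ℝ) / L)) - L * bumpInt q (η + s * ((m : ℝ) / L))) +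
      L * ∫ y : ℝ, (bump (y - q) : ℂ) * efun (η * y) *
        (bumpSum L p (ξ + s * y) - L * bumpInt p (ξ + s * y)) := by
  have hi : ∀ g : ℝ → ℂ, Continuous g →
      Integrable fun y : ℝ => (bump (y - q) : ℂ) * efun (η * y) * g (ξ + s * y) := by
    intro g hg
    have hc : Continuous fun y : ℝ => efun (η * y) * g (ξ + s * y) := by fun_prop
    refine Continuous.integrable_of_hasCompactSupport (by fun_prop) ?_
    have : HasCompactSupport fun y : ℝ => (bump (y - q) : ℂ) := by
      have h1 : HasCompactSupport fun y : ℝ => bump (y - q) := by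
        have := hasCompactSupport_bump.comp_homeomorph (Homeomorph.addRight (-(q : ℝ)))
        simpa [Function.comp_def, sub_eq_add_neg] using this
      exact h1.comp_left (g := fun t : ℝ => (t : ℂ)) (by simp)
    have h2 := this.mul_right (f' := fun y : ℝ => efun (η * y) * g (ξ + s * y))
    simp only [mul_assoc]
    exact h2
  have e1 : ∫ y : ℝ, (bump (y - q) : ℂ) * efun (η * y) *
        (bumpSum L p (ξ + s * y) - L * bumpInt p (ξ + s * y)) =
      ∑ m ∈ win L p, (bump ((m : ℝ) / L - p) : ℂ) * efun (ξ * ((m : ℝ) / L)) *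
          bumpInt q (η + s * ((m : ℝ) / L)) - L * bilInt s ξ η p q := by
    simp_rw [mul_sub]
    have h2 : Integrable fun y : ℝ => (bump (y - q) : ℂ) * efun (η * y) *
        (L * bumpInt p (ξ + s * y)) :=
      hi (fun t => L * bumpInt p t) (continuous_const.mul (continuous_bumpInt p))
    rw [integral_sub (hi _ (continuous_bumpSum L p)) h2]
    congr 1
    · have : ∀ y : ℝ, (bump (y - q) : ℂ) * efun (η * y) * bumpSum L p (ξ + s * y) =
          ∑ m ∈ win L p, (bump ((m : ℝ) / L - p) : ℂ) * efun (ξ * ((m : ℝ) / L)) *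
            ((bump (y - q) : ℂ) * efun ((η + s * ((m : ℝ) / L)) * y)) := by
        intro y
        rw [bumpSum, Finset.mul_sum]
        refine Finset.sum_congr rfl fun m _ => ?_
        rw [add_mul, add_mul, efun_add, efun_add,
          show s * y * ((m : ℝ) / L) = s * ((m : ℝ) / L) * y by ring]
        ring
      simp_rw [this]
      rw [integral_finsetSum]
      · refine Finset.sum_congr rfl fun m _ => ?_
        rw [integral_const_mul, bumpInt]
      · intro m _
        refine Integrable.const_mul ?_ _
        refine (integrable_bump_sub q).mono ?_ (Filter.Eventually.of_forall fun y => by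
          rw [norm_mul, norm_efun, mul_one])
        exact (by fun_prop : Continuous fun y : ℝ =>
          (bump (y - q) : ℂ) * efun ((η + s * ((m : ℝ) / L)) * y)).aestronglyMeasurable
    · rw [bilInt_eq_swap, ← integral_const_mul]
      congr 1; ext y; ring
  rw [e1, bilSum, mul_sub, Finset.mul_sum]
  simp_rw [mul_sub]
  rw [Finset.sum_sub_distrib]
  have e2 : ∑ x ∈ win L p, (bump ((x : ℝ) / L - p) : ℂ) * efun (ξ * ((x : ℝ) / L)) *
        (L * bumpInt q (η + s * ((x : ℝ) / L))) =
      ∑ i ∈ win L p, (L : ℂ) * ((bump ((i : ℝ) / L - p) : ℂ) * efun (ξ * ((i : ℝ) / L)) *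
        bumpInt q (η + s * ((i : ℝ) / L))) :=
    Finset.sum_congr rfl fun m _ => by ring
  rw [e2]; ring

theorem enorm_bilSum_sub_le {L : ℝ} (hL : 0 < L) (s ξ η : ℝ) (p q : ℤ) :
    ‖bilSum L s ξ η p q - L ^ 2 * bilInt s ξ η p q‖ₑ ≤ offMaj L s ξ η p q := by
  rw [bilSum_sub_eq, offMaj, mul_add]
  refine (enorm_add_le _ _).trans (add_le_add ?_ ?_)
  · refine (enorm_sum_le _ _).trans ?_
    rw [Finset.mul_sum]
    refine Finset.sum_le_sum fun m _ => ?_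
    rw [enorm_mul, enorm_mul, enorm_efun, mul_one]
    refine (mul_le_mul' ?_ (enorm_bumpSum_sub_le hL q _)).trans (one_mul _).le
    rw [← ofReal_norm]
    exact ENNReal.ofReal_le_one.2 (norm_bump_le_one _)
  · rw [enorm_mul, mul_left_comm]
    have : ‖(L : ℂ)‖ₑ = ENNReal.ofReal L := by
      rw [← ofReal_norm, Complex.norm_real, Real.norm_of_nonneg hL.le]
    rw [this]
    refine mul_le_mul' le_rfl ?_
    refine (enorm_integral_le_lintegral_enorm _).trans ?_
    rw [← lintegral_const_mul _ (by fun_prop),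
      ← lintegral_indicator measurableSet_Icc]
    refine lintegral_mono fun y => ?_
    simp only
    rw [enorm_mul, enorm_mul, enorm_efun, mul_one]
    refine (mul_le_mul' (enorm_bump_le_indicator q y) (enorm_bumpSum_sub_le hL p _)).trans ?_
    by_cases hy : y ∈ Set.Icc ((q : ℝ) - 1) (q + 1)
    · rw [Set.indicator_of_mem hy, Set.indicator_of_mem hy, one_mul]
    · rw [Set.indicator_of_notMem hy, zero_mul]; exact zero_le

theorem card_win_le {L : ℝ} (hL : 1 ≤ L) (p : ℤ) : ((win L p).card : ℝ) ≤ 3 * L := by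
  rw [win, Int.card_Icc]
  have h1 := Int.le_ceil (L * (p - 1))
  have h2 := Int.floor_le (L * (p + 1))
  have h3 : ((⌊L * ((p : ℝ) + 1)⌋ + 1 - ⌈L * ((p : ℝ) - 1)⌉ : ℤ) : ℝ) ≤ 3 * L := by
    push_cast; nlinarith
  rcases le_or_gt 0 (⌊L * ((p : ℝ) + 1)⌋ + 1 - ⌈L * ((p : ℝ) - 1)⌉) with h | h
  · have : (((⌊L * ((p : ℝ) + 1)⌋ + 1 - ⌈L * ((p : ℝ) - 1)⌉).toNat : ℤ) : ℝ) ≤ 3 * L := by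
      rw [Int.toNat_of_nonneg h]; exact h3
    exact_mod_cast this
  · rw [Int.toNat_of_nonpos h.le]; simp; linarith

theorem lintegral_lor_mul_offMaj {L : ℝ} (hL : 1 ≤ L) (ξ η : ℝ) (p q : ℤ) :
    ∫⁻ s, lor s * offMaj L s ξ η p q ≤
      ENNReal.ofReal (5 * bumpC * offC * (1 + |ξ| + |η|) * L) := by
  have hb := one_le_bumpC
  have ho := offC_pos
  have hL0 : 0 < L := by linarith
  have hm := measurable_offSum L
  unfold offMaj
  have e : ∀ s, lor s * (ENNReal.ofReal (L * bumpC) *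
      (∑ m ∈ win L p, offSum L (η + s * ((m : ℝ) / L)) +
        ENNReal.ofReal L * ∫⁻ y in Set.Icc ((q : ℝ) - 1) (q + 1), offSum L (ξ + s * y))) =
      ENNReal.ofReal (L * bumpC) * (∑ m ∈ win L p, lor s * offSum L (η + s * ((m : ℝ) / L)) +
        ENNReal.ofReal L *
          ∫⁻ y in Set.Icc ((q : ℝ) - 1) (q + 1), lor s * offSum L (ξ + s * y)) := by
    intro s
    rw [lintegral_const_mul _ (by fun_prop), ← Finset.mul_sum]
    ring
  simp_rw [e]
  have m1 : Measurable fun s : ℝ => ∑ m ∈ win L p, lor s * offSum L (η + s * ((m : ℝ) / L)) :=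
    Finset.measurable_fun_sum _ fun m _ => measurable_lor.mul (hm.comp (by fun_prop))
  have m2 : Measurable fun z : ℝ × ℝ => lor z.1 * offSum L (ξ + z.1 * z.2) :=
    (measurable_lor.comp measurable_fst).mul (hm.comp (by fun_prop))
  have m3 : Measurable fun s : ℝ =>
      ∫⁻ y in Set.Icc ((q : ℝ) - 1) (q + 1), lor s * offSum L (ξ + s * y) :=
    Measurable.lintegral_prod_right' m2
  have m4 := m3.const_mul (ENNReal.ofReal L)
  rw [lintegral_const_mul _ (by fun_prop), lintegral_add_left m1,
    lintegral_finsetSum _ fun m _ => by fun_prop,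
    lintegral_const_mul _ m3]
  have b1 : ∑ m ∈ win L p, ∫⁻ s, lor s * offSum L (η + s * ((m : ℝ) / L)) ≤
      ENNReal.ofReal (3 * offC * (1 + |η|)) := by
    refine (Finset.sum_le_sum fun m _ => lintegral_lor_mul_offSum hL _ η).trans ?_
    rw [Finset.sum_const, nsmul_eq_mul, ← ENNReal.ofReal_natCast,
      ← ENNReal.ofReal_mul (Nat.cast_nonneg _)]
    apply ENNReal.ofReal_le_ofReal
    calc _ ≤ 3 * L * (offC * (1 + |η|) / L) := by gcongr; exact card_win_le hL p
      _ = _ := by field_simp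
  have b2 : ∫⁻ s, ∫⁻ y in Set.Icc ((q : ℝ) - 1) (q + 1), lor s * offSum L (ξ + s * y) ≤
      ENNReal.ofReal (2 * (offC * (1 + |ξ|) / L)) := by
    rw [lintegral_lintegral_swap m2.aemeasurable]
    refine (lintegral_mono fun y => lintegral_lor_mul_offSum hL y ξ).trans ?_
    rw [setLIntegral_const, Real.volume_Icc, ← ENNReal.ofReal_mul (by positivity)]
    apply ENNReal.ofReal_le_ofReal
    apply le_of_eq; ring
  refine (mul_le_mul' le_rfl (add_le_add b1 (mul_le_mul' le_rfl b2))).trans ?_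
  rw [← ENNReal.ofReal_mul hL0.le, ← ENNReal.ofReal_add (by positivity) (by positivity),
    ← ENNReal.ofReal_mul (by positivity)]
  apply ENNReal.ofReal_le_ofReal
  have e3 : L * bumpC * (3 * offC * (1 + |η|) + L * (2 * (offC * (1 + |ξ|) / L))) =
      L * bumpC * offC * (3 * (1 + |η|) + 2 * (1 + |ξ|)) := by field_simp
  rw [e3]
  have : 3 * (1 + |η|) + 2 * (1 + |ξ|) ≤ 5 * (1 + |ξ| + |η|) := by
    linarith [abs_nonneg η, abs_nonneg ξ]
  calc _ ≤ L * bumpC * offC * (5 * (1 + |ξ| + |η|)) := by gcongr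
    _ = _ := by ring

/-! ### Products over coordinates -/

theorem enorm_finset_prod {ι : Type*} (s : Finset ι) (f : ι → ℂ) :
    ‖∏ i ∈ s, f i‖ₑ = ∏ i ∈ s, ‖f i‖ₑ := by
  simp only [enorm, nnnorm_prod, ENNReal.ofNNReal_finsetProd]

theorem enorm_prod_sub_prod_le {ι : Type*} [DecidableEq ι] (s : Finset ι) (a b : ι → ℂ)
    (f : ι → ℝ≥0∞) (ha : ∀ i, ‖a i‖ₑ ≤ f i) (hb : ∀ i, ‖b i‖ₑ ≤ f i) :
    ‖∏ i ∈ s, a i - ∏ i ∈ s, b i‖ₑ ≤ ∑ i ∈ s, ‖a i - b i‖ₑ * ∏ k ∈ s.erase i, f k := by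
  induction s using Finset.induction_on with
  | empty => simp
  | insert j s hj ih =>
    rw [Finset.prod_insert hj, Finset.prod_insert hj, Finset.sum_insert hj,
      Finset.erase_insert hj]
    have e : a j * ∏ i ∈ s, a i - b j * ∏ i ∈ s, b i =
        (a j - b j) * ∏ i ∈ s, a i + b j * (∏ i ∈ s, a i - ∏ i ∈ s, b i) := by ring
    rw [e]
    refine (enorm_add_le _ _).trans (add_le_add ?_ ?_)
    · rw [enorm_mul]
      refine mul_le_mul' le_rfl ?_
      rw [enorm_finset_prod]
      exact Finset.prod_le_prod' fun i _ => ha i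
    · rw [enorm_mul]
      refine (mul_le_mul' (hb j) ih).trans ?_
      rw [Finset.mul_sum]
      refine Finset.sum_le_sum fun i hi => ?_
      have hij : j ≠ i := fun h => hj (h ▸ hi)
      rw [Finset.erase_insert_of_ne hij, Finset.prod_insert (fun h => hj (Finset.mem_of_mem_erase h))]
      exact (mul_left_comm _ _ _).le

/-- The common constant in the pointwise bounds. -/
def locC : ℝ := 3 * bilC + 6 * bumpC

theorem one_le_locC : 1 ≤ locC := by
  have := bilC_pos; have := one_le_bumpC; unfold locC; linarith

/-- Majorant of products of bilinear sums in the intermediate range. -/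
def weylR (d : ℕ) (L T s : ℝ) : ℝ≥0∞ :=
  (Set.Icc (-(T * L ^ 2)) (T * L ^ 2)).indicator
    (fun s => ENNReal.ofReal ((1 / L + T) ^ (d - 2) * ((1 + weylV L T (s / L ^ 2)) / L ^ 2))) s

/-- Indicator of `|s| > T L²`. -/
def farI (L T s : ℝ) : ℝ≥0∞ := {s : ℝ | T * L ^ 2 < |s|}.indicator (fun _ => 1) s

@[fun_prop]
theorem measurable_weylV (L T : ℝ) : Measurable (weylV L T) := by
  unfold weylV; fun_prop

@[fun_prop]
theorem measurable_weylR (d : ℕ) (L T : ℝ) : Measurable (weylR d L T) := by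
  unfold weylR
  exact Measurable.indicator (by fun_prop) measurableSet_Icc

@[fun_prop]
theorem measurable_farI (L T : ℝ) : Measurable (farI L T) := by
  unfold farI
  exact Measurable.indicator measurable_const (measurableSet_lt measurable_const (by fun_prop))

/-- Majorant of the products of normalised sums and of integrals. -/
def prodMaj (d : ℕ) (L T s : ℝ) : ℝ≥0∞ :=
  ENNReal.ofReal (locC ^ d) * (lor s + weylR d L T s + farI L T s)

/-- Majorant of the difference of the products. -/
def diffMaj (d : ℕ) (L T : ℝ) (ξ η : Fin d → ℝ) (p q : Fin d → ℤ) (s : ℝ) : ℝ≥0∞ :=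
  ENNReal.ofReal (locC ^ d) * (∑ i, ENNReal.ofReal (1 / L ^ 2) *
    (lor s * offMaj L s (ξ i) (η i) (p i) (q i)) + ENNReal.ofReal (2 / L) * lor s +
    weylR d L T s + 2 * farI L T s)

section products

variable {d : ℕ} {L T s : ℝ} (ξ η : Fin d → ℝ) (p q : Fin d → ℤ)

theorem inv_pow_le_lor (hd : 2 ≤ d) (s : ℝ) : ENNReal.ofReal ((1 / (1 + |s|)) ^ d) ≤ lor s := by
  have h0 := abs_nonneg s
  apply ENNReal.ofReal_le_ofReal
  rw [one_div_pow]
  apply one_div_le_one_div_of_le (by positivity)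
  calc 1 + s ^ 2 ≤ (1 + |s|) ^ 2 := by nlinarith [sq_abs s]
    _ ≤ (1 + |s|) ^ d := pow_le_pow_right₀ (by linarith) hd

theorem enorm_prod_bilInt_le :
    ‖∏ i, bilInt s (ξ i) (η i) (p i) (q i)‖ₑ ≤ ENNReal.ofReal (locC ^ d * (1 / (1 + |s|)) ^ d) := by
  rw [← ofReal_norm, norm_prod, ← mul_pow]
  apply ENNReal.ofReal_le_ofReal
  have h0 := abs_nonneg s
  have := bilC_pos
  calc _ ≤ ∏ _i : Fin d, (locC * (1 / (1 + |s|))) := by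
        refine Finset.prod_le_prod (fun _ _ => norm_nonneg _) fun i _ => ?_
        refine (norm_bilInt_le s _ _ _ _).trans ?_
        rw [mul_one_div]
        gcongr
        unfold locC; linarith
    _ = _ := by simp

theorem norm_normalised_le_of_small (hL : 1 ≤ L) (hs : |s| ≤ L / 2) (i : Fin d) :
    ‖bilSum L s (ξ i) (η i) (p i) (q i) / L ^ 2‖ ≤ locC * (1 / (1 + |s|)) := by
  have h0 := abs_nonneg s
  have hL0 : 0 < L := by linarith
  have hb := one_le_bumpC
  rw [norm_div, norm_pow, Complex.norm_real, Real.norm_of_nonneg hL0.le, div_le_iff₀ (by positivity)]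
  refine (norm_bilSum_le_small hL hs _ _ _ _).trans ?_
  have : 3 * bilC ≤ locC := by unfold locC; linarith
  calc 3 * bilC * L ^ 2 / (1 + |s|) ≤ locC * L ^ 2 / (1 + |s|) := by gcongr
    _ = _ := by ring

theorem enorm_prod_bilSum_le_of_weyl (hd : 2 ≤ d) (hL : 1 ≤ L) (hT : 0 ≤ T) (hs : L / 2 < |s|)
    (hs' : |s| ≤ T * L ^ 2) :
    ‖∏ i, bilSum L s (ξ i) (η i) (p i) (q i) / L ^ 2‖ₑ ≤
      ENNReal.ofReal (locC ^ d) * weylR d L T s := by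
  have hL0 : 0 < L := by linarith
  have hV := weylV_nonneg L T (s / L ^ 2)
  have hbl := bilC_pos
  have hb := one_le_bumpC
  have hC : 2 * bilC ≤ locC := by unfold locC; linarith
  rw [weylR, Set.indicator_of_mem (by rwa [Set.mem_Icc, ← abs_le]),
    ← ENNReal.ofReal_mul (pow_nonneg (by linarith [one_le_locC]) _), ← ofReal_norm]
  apply ENNReal.ofReal_le_ofReal
  obtain ⟨k, rfl⟩ := Nat.exists_eq_add_of_le' hd
  have h1 : ∀ i, ‖bilSum L s (ξ i) (η i) (p i) (q i) / L ^ 2‖ ≤ locC * (1 / L + T) := by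
    intro i
    rw [norm_div, norm_pow, Complex.norm_real, Real.norm_of_nonneg hL0.le,
      div_le_iff₀ (by positivity)]
    refine (norm_bilSum_le_weyl hL hs hs' _ _ _ _).1.trans ?_
    calc 2 * bilC * L ^ 2 * (1 / L + T) ≤ locC * L ^ 2 * (1 / L + T) := by gcongr
      _ = _ := by ring
  set X := Real.sqrt ((1 + weylV L T (s / L ^ 2)) / L ^ 2) with hX
  have hX2 : X * X = (1 + weylV L T (s / L ^ 2)) / L ^ 2 := Real.mul_self_sqrt (by positivity)
  have h2 : ∀ i, ‖bilSum L s (ξ i) (η i) (p i) (q i) / L ^ 2‖ ≤ locC * X := by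
    intro i
    refine abs_le_of_sq_le_sq' ?_ (by have := one_le_locC; positivity) |>.2
    rw [norm_div, norm_pow, Complex.norm_real, Real.norm_of_nonneg hL0.le, div_pow,
      div_le_iff₀ (by positivity)]
    refine (norm_bilSum_le_weyl hL hs hs' _ _ _ _).2.trans ?_
    rw [mul_pow, pow_two X, hX2]
    calc 2 * bilC ^ 2 * L ^ 2 * (1 + weylV L T (s / L ^ 2)) ≤
        locC ^ 2 * L ^ 2 * (1 + weylV L T (s / L ^ 2)) := by
          gcongr
          nlinarith
      _ = _ := by field_simp
  rw [norm_prod, Fin.prod_univ_succ, Fin.prod_univ_succ]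
  calc _ ≤ (locC * X) * ((locC * X) * ∏ _i : Fin k, (locC * (1 / L + T))) := by
        have := one_le_locC
        gcongr
        · exact h2 _
        · exact h2 _
        · exact h1 _
    _ = locC ^ (k + 2) * ((1 / L + T) ^ k * (X * X)) := by
        simp only [Finset.prod_const, Finset.card_univ, Fintype.card_fin, mul_pow]; ring
    _ = _ := by rw [hX2, Nat.add_sub_cancel]

theorem enorm_prod_bilSum_le_trivial (hL : 1 ≤ L) :
    ‖∏ i, bilSum L s (ξ i) (η i) (p i) (q i) / L ^ 2‖ₑ ≤ ENNReal.ofReal (locC ^ d) := by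
  have hL0 : 0 < L := by linarith
  have hb := one_le_bumpC
  have hbl := bilC_pos
  rw [← ofReal_norm, norm_prod]
  apply ENNReal.ofReal_le_ofReal
  calc _ ≤ ∏ _i : Fin d, locC := by
        refine Finset.prod_le_prod (fun _ _ => norm_nonneg _) fun i _ => ?_
        rw [norm_div, norm_pow, Complex.norm_real, Real.norm_of_nonneg hL0.le,
          div_le_iff₀ (by positivity)]
        refine (norm_bilSum_le_trivial hL s _ _ _ _).trans ?_
        gcongr
        unfold locC; linarith
    _ = _ := by simp

theorem enorm_prod_bilInt_le_trivial :
    ‖∏ i, bilInt s (ξ i) (η i) (p i) (q i)‖ₑ ≤ ENNReal.ofReal (locC ^ d) := by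
  refine (enorm_prod_bilInt_le ξ η p q).trans (ENNReal.ofReal_le_ofReal ?_)
  have h0 := abs_nonneg s
  refine mul_le_of_le_one_right (pow_nonneg (by linarith [one_le_locC]) _) ?_
  exact pow_le_one₀ (by positivity) ((div_le_one (by positivity)).2 (by linarith))

theorem enorm_prod_bilInt_le_prodMaj (hd : 2 ≤ d) :
    ‖∏ i, bilInt s (ξ i) (η i) (p i) (q i)‖ₑ ≤ prodMaj d L T s := by
  refine (enorm_prod_bilInt_le ξ η p q).trans ?_
  rw [ENNReal.ofReal_mul (pow_nonneg (by linarith [one_le_locC]) _), prodMaj]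
  refine mul_le_mul' le_rfl ((inv_pow_le_lor hd s).trans ?_)
  rw [add_assoc]
  exact le_self_add

theorem enorm_prod_bilSum_le_prodMaj (hd : 2 ≤ d) (hL : 1 ≤ L) (hT : 0 ≤ T) :
    ‖∏ i, bilSum L s (ξ i) (η i) (p i) (q i) / L ^ 2‖ₑ ≤ prodMaj d L T s := by
  rw [prodMaj]
  rcases le_or_gt |s| (L / 2) with h | h
  · refine le_trans ?_ (mul_le_mul' le_rfl (le_self_add.trans le_self_add))
    refine le_trans ?_ (mul_le_mul' le_rfl (inv_pow_le_lor hd s))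
    rw [← ENNReal.ofReal_mul (pow_nonneg (by linarith [one_le_locC]) _), ← ofReal_norm, norm_prod,
      ← mul_pow]
    apply ENNReal.ofReal_le_ofReal
    calc _ ≤ ∏ _i : Fin d, (locC * (1 / (1 + |s|))) :=
          Finset.prod_le_prod (fun _ _ => norm_nonneg _)
            fun i _ => norm_normalised_le_of_small ξ η p q hL h i
      _ = _ := by simp
  rcases le_or_gt |s| (T * L ^ 2) with h' | h'
  · refine (enorm_prod_bilSum_le_of_weyl ξ η p q hd hL hT h h').trans (mul_le_mul' le_rfl ?_)
    exact le_add_self.trans le_self_add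
  · refine (enorm_prod_bilSum_le_trivial ξ η p q hL).trans ?_
    have : farI L T s = 1 := Set.indicator_of_mem (s := {s : ℝ | T * L ^ 2 < |s|}) h' _
    rw [this]
    exact le_mul_of_one_le_right zero_le le_add_self

theorem enorm_prod_sub_le_diffMaj (hd : 3 ≤ d) (hL : 1 ≤ L) (hT : 0 ≤ T) :
    ‖∏ i, bilSum L s (ξ i) (η i) (p i) (q i) / L ^ 2 - ∏ i, bilInt s (ξ i) (η i) (p i) (q i)‖ₑ ≤
      diffMaj d L T ξ η p q s := by
  have hL0 : 0 < L := by linarith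
  have h0 := abs_nonneg s
  have hC := one_le_locC
  rw [diffMaj]
  rcases le_or_gt |s| (L / 2) with h | h
  · refine le_trans ?_ (mul_le_mul' le_rfl (le_self_add.trans (le_self_add.trans le_self_add)))
    refine (enorm_prod_sub_prod_le Finset.univ _ _
      (fun _ => ENNReal.ofReal (locC * (1 / (1 + |s|)))) (fun i => ?_) (fun i => ?_)).trans ?_
    · rw [← ofReal_norm]
      exact ENNReal.ofReal_le_ofReal (norm_normalised_le_of_small ξ η p q hL h i)
    · rw [← ofReal_norm]
      apply ENNReal.ofReal_le_ofReal
      refine (norm_bilInt_le s _ _ _ _).trans ?_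
      rw [mul_one_div]
      have := bilC_pos
      gcongr
      unfold locC; linarith
    · rw [Finset.mul_sum]
      refine Finset.sum_le_sum fun i _ => ?_
      have e : bilSum L s (ξ i) (η i) (p i) (q i) / L ^ 2 - bilInt s (ξ i) (η i) (p i) (q i) =
          ((1 / L ^ 2 : ℝ) : ℂ) * (bilSum L s (ξ i) (η i) (p i) (q i) -
            L ^ 2 * bilInt s (ξ i) (η i) (p i) (q i)) := by
        have : (L : ℂ) ≠ 0 := by exact_mod_cast hL0.ne'
        push_cast; field_simp
      have e2 : ‖((1 / L ^ 2 : ℝ) : ℂ)‖ₑ = ENNReal.ofReal (1 / L ^ 2) := by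
        rw [← ofReal_norm, Complex.norm_real, Real.norm_of_nonneg (by positivity)]
      rw [e, enorm_mul, e2, Finset.prod_const, Finset.card_erase_of_mem (Finset.mem_univ _),
        Finset.card_univ, Fintype.card_fin, ← ENNReal.ofReal_pow (by positivity), mul_pow,
        ENNReal.ofReal_mul (by positivity)]
      have h1 : ENNReal.ofReal (locC ^ (d - 1)) ≤ ENNReal.ofReal (locC ^ d) :=
        ENNReal.ofReal_le_ofReal (pow_le_pow_right₀ hC (by omega))
      have h2 := inv_pow_le_lor (d := d - 1) (by omega) s
      have h3 := enorm_bilSum_sub_le hL0 s (ξ i) (η i) (p i) (q i)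
      calc _ ≤ ENNReal.ofReal (1 / L ^ 2) * offMaj L s (ξ i) (η i) (p i) (q i) *
            (ENNReal.ofReal (locC ^ d) * lor s) := by gcongr
        _ = _ := by ring
  rcases le_or_gt |s| (T * L ^ 2) with h' | h'
  · refine (enorm_sub_le).trans ?_
    have b1 := enorm_prod_bilSum_le_of_weyl ξ η p q (by omega) hL hT h h'
    have b2 : ‖∏ i, bilInt s (ξ i) (η i) (p i) (q i)‖ₑ ≤
        ENNReal.ofReal (locC ^ d) * (ENNReal.ofReal (2 / L) * lor s) := by
      refine (enorm_prod_bilInt_le ξ η p q).trans ?_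
      rw [ENNReal.ofReal_mul (by positivity)]
      refine mul_le_mul' le_rfl ?_
      refine le_trans ?_ (mul_le_mul' le_rfl (inv_pow_le_lor (d := d - 1) (by omega) s))
      rw [← ENNReal.ofReal_mul (by positivity)]
      apply ENNReal.ofReal_le_ofReal
      obtain ⟨k, rfl⟩ := Nat.exists_eq_add_of_le' (by omega : 1 ≤ d)
      rw [Nat.add_sub_cancel, pow_succ, mul_comm]
      gcongr ?_ * _
      rw [div_le_div_iff₀ (by positivity) hL0]
      linarith
    refine (add_le_add b1 b2).trans ?_
    rw [← mul_add, add_comm]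
    refine mul_le_mul' le_rfl (le_trans ?_ le_self_add)
    exact add_le_add le_add_self le_rfl
  · refine (enorm_sub_le).trans ?_
    refine (add_le_add (enorm_prod_bilSum_le_trivial ξ η p q hL)
      (enorm_prod_bilInt_le_trivial ξ η p q)).trans ?_
    have : farI L T s = 1 := Set.indicator_of_mem (s := {s : ℝ | T * L ^ 2 < |s|}) h' _
    rw [this, ← two_mul, mul_comm, mul_one]
    exact mul_le_mul' le_rfl le_add_self

end products

/-! ### Integrals of the majorants -/

theorem weylV_lintegral_term (L c : ℝ) (hL : 0 < L) (r : ℝ) (hr : 0 ≤ r) :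
    ∫⁻ s : ℝ, ENNReal.ofReal (r / (1 + L ^ 4 * (|s / L ^ 2| - c) ^ 2)) ≤
      ENNReal.ofReal (2 * Real.pi * r) := by
  have hpt : ∀ s : ℝ, ENNReal.ofReal (r / (1 + L ^ 4 * (|s / L ^ 2| - c) ^ 2)) ≤
      ENNReal.ofReal r * (lor (s - L ^ 2 * c) + lor (s + L ^ 2 * c)) := by
    intro s
    rw [div_eq_mul_one_div, ENNReal.ofReal_mul hr]
    refine mul_le_mul' le_rfl ?_
    have e : L ^ 4 * (|s / L ^ 2| - c) ^ 2 = (|s| - L ^ 2 * c) ^ 2 := by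
      rw [abs_div, abs_of_pos (by positivity : 0 < L ^ 2)]; field_simp
    rw [e]
    rcases abs_choice s with h | h <;> rw [h]
    · exact le_self_add
    · rw [show (-s - L ^ 2 * c) ^ 2 = (s + L ^ 2 * c) ^ 2 by ring]
      exact le_add_self
  refine (lintegral_mono hpt).trans ?_
  rw [lintegral_const_mul _ (by fun_prop), lintegral_add_left (by fun_prop),
    lintegral_sub_right_eq_self, lintegral_add_right_eq_self, lintegral_lor,
    ← ENNReal.ofReal_add Real.pi_pos.le Real.pi_pos.le, ← ENNReal.ofReal_mul hr]
  apply le_of_eq; congr 1; ring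

theorem sum_inv_floor_le {L : ℝ} (hL : 1 ≤ L) :
    ∑ q ∈ Finset.Icc 1 ⌊L⌋₊, (1 : ℝ) / q ≤ 1 + Real.log L := by
  have h := harmonic_floor_le_one_add_log L hL
  rw [harmonic_eq_sum_Icc] at h
  push_cast at h
  simpa only [one_div] using h

theorem lintegral_weylV {L T : ℝ} (hL : 1 ≤ L) (hT : 0 ≤ T) :
    ∫⁻ s : ℝ, ENNReal.ofReal (weylV L T (s / L ^ 2)) ≤
      ENNReal.ofReal (4 * Real.pi * T * L ^ 2 * (1 + Real.log L)) := by
  have hL0 : 0 < L := by linarith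
  unfold weylV
  have hnn : ∀ (s : ℝ) (q a : ℕ),
      0 ≤ (L / q) ^ 2 / (1 + L ^ 4 * (|s / L ^ 2| - a / q) ^ 2) := fun s q a => by positivity
  have e : ∀ s : ℝ, ENNReal.ofReal (∑ q ∈ Finset.Icc 1 ⌊L⌋₊,
      ∑ a ∈ Finset.Icc 1 ⌊2 * (q : ℝ) * T⌋₊,
        (L / q) ^ 2 / (1 + L ^ 4 * (|s / L ^ 2| - a / q) ^ 2)) =
      ∑ q ∈ Finset.Icc 1 ⌊L⌋₊, ∑ a ∈ Finset.Icc 1 ⌊2 * (q : ℝ) * T⌋₊,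
        ENNReal.ofReal ((L / q) ^ 2 / (1 + L ^ 4 * (|s / L ^ 2| - a / q) ^ 2)) := by
    intro s
    rw [ENNReal.ofReal_sum_of_nonneg fun q _ => Finset.sum_nonneg fun a _ => hnn s q a]
    exact Finset.sum_congr rfl fun q _ => ENNReal.ofReal_sum_of_nonneg fun a _ => hnn s q a
  simp_rw [e]
  rw [lintegral_finsetSum _ fun q _ => Finset.measurable_fun_sum _ fun a _ => by fun_prop]
  have hq : ∀ q ∈ Finset.Icc 1 ⌊L⌋₊, ∫⁻ s : ℝ, ∑ a ∈ Finset.Icc 1 ⌊2 * (q : ℝ) * T⌋₊,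
        ENNReal.ofReal ((L / q) ^ 2 / (1 + L ^ 4 * (|s / L ^ 2| - a / q) ^ 2)) ≤
      ENNReal.ofReal (4 * Real.pi * T * L ^ 2 * (1 / q)) := by
    intro q hq
    have hq1 : (1 : ℝ) ≤ q := by exact_mod_cast (Finset.mem_Icc.1 hq).1
    rw [lintegral_finsetSum _ fun a _ => by fun_prop]
    refine (Finset.sum_le_sum fun (a : ℕ) _ =>
      weylV_lintegral_term L ((a : ℝ) / q) hL0 ((L / q) ^ 2) (by positivity)).trans ?_
    rw [Finset.sum_const, nsmul_eq_mul, Nat.card_Icc, Nat.add_sub_cancel, ← ENNReal.ofReal_natCast,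
      ← ENNReal.ofReal_mul (Nat.cast_nonneg _)]
    apply ENNReal.ofReal_le_ofReal
    have hf : (⌊2 * (q : ℝ) * T⌋₊ : ℝ) ≤ 2 * q * T := Nat.floor_le (by positivity)
    have := Real.pi_pos
    calc _ ≤ 2 * q * T * (2 * Real.pi * (L / q) ^ 2) := by gcongr
      _ = _ := by field_simp; ring
  refine (Finset.sum_le_sum hq).trans ?_
  have := Real.pi_pos
  rw [← ENNReal.ofReal_sum_of_nonneg fun q _ => by positivity, ← Finset.mul_sum]
  apply ENNReal.ofReal_le_ofReal
  gcongr
  exact sum_inv_floor_le hL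

theorem lintegral_weylR {d : ℕ} (hd : 2 ≤ d) {L T : ℝ} (hL : 1 ≤ L) (hT : 0 ≤ T) :
    ∫⁻ s, weylR d L T s ≤ ENNReal.ofReal (20 * (1 + Real.log L) * (1 / L + T) ^ (d - 1)) := by
  have hL0 : 0 < L := by linarith
  have hlog := Real.log_nonneg hL
  have hpt : ∀ s, weylR d L T s ≤ ENNReal.ofReal ((1 / L + T) ^ (d - 2) / L ^ 2) *
      ((Set.Icc (-(T * L ^ 2)) (T * L ^ 2)).indicator (fun _ => 1) s +
        ENNReal.ofReal (weylV L T (s / L ^ 2))) := by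
    intro s
    unfold weylR
    by_cases hs : s ∈ Set.Icc (-(T * L ^ 2)) (T * L ^ 2)
    · rw [Set.indicator_of_mem hs, Set.indicator_of_mem hs, ← ENNReal.ofReal_one,
        ← ENNReal.ofReal_add zero_le_one (weylV_nonneg _ _ _),
        ← ENNReal.ofReal_mul (by positivity)]
      apply le_of_eq; congr 1; ring
    · rw [Set.indicator_of_notMem hs]; exact zero_le
  refine (lintegral_mono hpt).trans ?_
  have hm : Measurable fun s : ℝ => (Set.Icc (-(T * L ^ 2)) (T * L ^ 2)).indicator
    (fun _ => (1 : ℝ≥0∞)) s := Measurable.indicator measurable_const measurableSet_Icc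
  rw [lintegral_const_mul _ (by fun_prop), lintegral_add_left hm,
    lintegral_indicator measurableSet_Icc, setLIntegral_const, Real.volume_Icc, one_mul]
  refine (mul_le_mul' le_rfl (add_le_add le_rfl (lintegral_weylV hL hT))).trans ?_
  have hpi := Real.pi_pos
  rw [← ENNReal.ofReal_add (by nlinarith [mul_nonneg hT (sq_nonneg L)]) (by positivity),
    ← ENNReal.ofReal_mul (by positivity)]
  apply ENNReal.ofReal_le_ofReal
  obtain ⟨k, rfl⟩ := Nat.exists_eq_add_of_le' hd
  rw [show k + 2 - 2 = k by omega, show k + 2 - 1 = k + 1 by omega]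
  have e : (1 / L + T) ^ k / L ^ 2 * (T * L ^ 2 - -(T * L ^ 2) +
      4 * Real.pi * T * L ^ 2 * (1 + Real.log L)) =
      (1 / L + T) ^ k * (T * (2 + 4 * Real.pi * (1 + Real.log L))) := by field_simp; ring
  rw [e]
  have h1 : 2 + 4 * Real.pi * (1 + Real.log L) ≤ 20 * (1 + Real.log L) := by
    nlinarith [Real.pi_lt_d2, mul_nonneg (by linarith [Real.pi_lt_d2] : 0 ≤ 4 - Real.pi) hlog]
  have h2 : T ≤ 1 / L + T := by have : 0 < 1 / L := by positivity
                                linarith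
  calc _ ≤ (1 / L + T) ^ k * ((1 / L + T) * (20 * (1 + Real.log L))) := by gcongr
    _ = _ := by rw [pow_succ]; ring

/-- One-variable factor of the majorant of the Fourier transform of the weight. -/
def vMaj (L M τ : ℝ) : ℝ≥0∞ :=
  (Set.Icc (-M) M).indicator (fun _ => 1) τ + ENNReal.ofReal (1 / L ^ 4) * lor τ

@[fun_prop]
theorem measurable_vMaj (L M : ℝ) : Measurable (vMaj L M) := by
  unfold vMaj
  exact (Measurable.indicator measurable_const measurableSet_Icc).add (by fun_prop)

theorem vMaj_le_two {L : ℝ} (hL : 1 ≤ L) (M τ : ℝ) : vMaj L M τ ≤ 2 := by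
  unfold vMaj
  rw [← one_add_one_eq_two]
  refine add_le_add (Set.indicator_le_self' (fun _ _ => zero_le) _) ?_
  refine (mul_le_mul' ?_ (lor_le_one τ)).trans (one_mul _).le
  exact ENNReal.ofReal_le_one.2 ((div_le_one (by positivity)).2 (one_le_pow₀ hL))

theorem lintegral_vMaj_mul_scaled {L M c : ℝ} (hL : 1 ≤ L) (hc : 0 < c) {g : ℝ → ℝ≥0∞}
    (hg : Measurable g) :
    ∫⁻ τ, vMaj L M τ * g (c * τ) ≤ 2 * (ENNReal.ofReal c⁻¹ * ∫⁻ s, g s) := by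
  refine (lintegral_mono fun τ => mul_le_mul' (vMaj_le_two hL M τ) le_rfl).trans ?_
  rw [lintegral_const_mul _ (by fun_prop), lintegral_comp_mul_left hg hc.ne',
    abs_of_pos (by positivity)]

theorem lintegral_vMaj_mul_farI {L M T c : ℝ} (hL : 1 ≤ L) (hc : 0 < c) (hT : T = c * M / L ^ 2) :
    ∫⁻ τ, vMaj L M τ * farI L T (c * τ) ≤ ENNReal.ofReal (Real.pi / L ^ 4) := by
  have hL0 : 0 < L := by linarith
  have hpt : ∀ τ, vMaj L M τ * farI L T (c * τ) ≤ ENNReal.ofReal (1 / L ^ 4) * lor τ := by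
    intro τ
    unfold farI
    by_cases h : T * L ^ 2 < |c * τ|
    · rw [Set.indicator_of_mem (s := {s : ℝ | T * L ^ 2 < |s|}) h, mul_one, vMaj,
        Set.indicator_of_notMem, zero_add]
      rw [hT, abs_mul, abs_of_pos hc, div_mul_cancel₀ _ (by positivity)] at h
      have := lt_of_mul_lt_mul_left h hc.le
      rw [Set.mem_Icc, ← abs_le]
      exact not_le.2 this
    · rw [Set.indicator_of_notMem (s := {s : ℝ | T * L ^ 2 < |s|}) h, mul_zero]
      exact zero_le
  refine (lintegral_mono hpt).trans ?_
  rw [lintegral_const_mul _ (by fun_prop), lintegral_lor, ← ENNReal.ofReal_mul (by positivity)]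
  apply le_of_eq; congr 1; ring

@[fun_prop]
theorem measurable_prodMaj (d : ℕ) (L T : ℝ) : Measurable (prodMaj d L T) := by
  unfold prodMaj; fun_prop

@[fun_prop]
theorem measurable_diffMaj (d : ℕ) (L T : ℝ) (ξ η : Fin d → ℝ) (p q : Fin d → ℤ) :
    Measurable (diffMaj d L T ξ η p q) := by
  unfold diffMaj
  have h : ∀ i, Measurable fun s => offMaj L s (ξ i) (η i) (p i) (q i) :=
    fun i => measurable_offMaj L _ _ _ _
  fun_prop

section integrals

variable {d : ℕ} {L M T c R : ℝ}

theorem inv_four_le (hL : 1 ≤ L) (hc : 0 < c) (hcL : c ≤ L ^ 2) :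
    Real.pi / L ^ 4 ≤ c⁻¹ * (4 / L) := by
  have hL0 : 0 < L := by linarith
  rw [inv_mul_eq_div, div_div, div_le_div_iff₀ (by positivity) (by positivity)]
  have h1 : L * c ≤ L ^ 4 := by
    calc L * c ≤ L * L ^ 2 := by gcongr
      _ = L ^ 3 := by ring
      _ ≤ L ^ 4 := pow_le_pow_right₀ hL (by norm_num)
  have := Real.pi_le_four
  have := Real.pi_pos
  nlinarith [mul_pos hL0 hc]

theorem lintegral_vMaj_mul_prodMaj (hL : 1 ≤ L) (hc : 0 < c)
    (hcL : c ≤ L ^ 2) (hT : T = c * M / L ^ 2)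
    (hR1 : R ≤ 1) (hR : ∫⁻ s, weylR d L T s ≤ ENNReal.ofReal R) :
    ∫⁻ τ, vMaj L M τ * prodMaj d L T (c * τ) ≤ ENNReal.ofReal (locC ^ d * 20 * c⁻¹) := by
  have hC := one_le_locC
  have e : ∀ τ, vMaj L M τ * prodMaj d L T (c * τ) = ENNReal.ofReal (locC ^ d) *
      (vMaj L M τ * lor (c * τ) + vMaj L M τ * weylR d L T (c * τ) +
        vMaj L M τ * farI L T (c * τ)) := by
    intro τ; unfold prodMaj; ring
  simp_rw [e]
  rw [lintegral_const_mul _ (by fun_prop), lintegral_add_left (by fun_prop),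
    lintegral_add_left (by fun_prop)]
  have b1 := lintegral_vMaj_mul_scaled (M := M) hL hc measurable_lor
  have b2 := (lintegral_vMaj_mul_scaled (M := M) hL hc (measurable_weylR d L T)).trans
    (mul_le_mul' le_rfl (mul_le_mul' le_rfl (hR.trans (ENNReal.ofReal_le_ofReal hR1))))
  have b3 := (lintegral_vMaj_mul_farI hL hc hT).trans
    (ENNReal.ofReal_le_ofReal (inv_four_le hL hc hcL))
  rw [lintegral_lor] at b1
  refine (mul_le_mul' le_rfl (add_le_add (add_le_add b1 b2) b3)).trans ?_
  have hpi := Real.pi_pos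
  have hc' : 0 < c⁻¹ := by positivity
  have hL' : 4 / L ≤ 4 := (div_le_iff₀ (by linarith)).2 (by linarith)
  have hL'' : 0 ≤ 4 / L := by positivity
  rw [show (2 : ℝ≥0∞) = ENNReal.ofReal 2 by simp, ← ENNReal.ofReal_mul (by positivity),
    ← ENNReal.ofReal_mul (by positivity), ← ENNReal.ofReal_mul (by positivity),
    ← ENNReal.ofReal_mul (by positivity), ← ENNReal.ofReal_add (by positivity) (by positivity),
    ← ENNReal.ofReal_add (by positivity) (by positivity), ← ENNReal.ofReal_mul (by positivity)]
  apply ENNReal.ofReal_le_ofReal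
  rw [mul_assoc]
  gcongr
  have := Real.pi_le_four
  nlinarith

/-- The constant of `lintegral_vMaj_mul_diffMaj`. -/
def diffC (d : ℕ) : ℝ := locC ^ d * (10 * bumpC * offC + 24)

theorem lintegral_vMaj_mul_diffMaj (hd : 1 ≤ d) (hL : 1 ≤ L) (hc : 0 < c)
    (hcL : c ≤ L ^ 2) (hT : T = c * M / L ^ 2) (hR0 : 0 ≤ R)
    (hR : ∫⁻ s, weylR d L T s ≤ ENNReal.ofReal R) (ξ η : Fin d → ℝ) (p q : Fin d → ℤ) :
    ∫⁻ τ, vMaj L M τ * diffMaj d L T ξ η p q (c * τ) ≤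
      ENNReal.ofReal (diffC d * c⁻¹ * (R + (∑ i, (1 + |ξ i| + |η i|)) / L)) := by
  have hC := one_le_locC
  have hL0 : 0 < L := by linarith
  have hb := one_le_bumpC
  have ho := offC_pos
  have e : ∀ τ, vMaj L M τ * diffMaj d L T ξ η p q (c * τ) = ENNReal.ofReal (locC ^ d) *
      (∑ i, ENNReal.ofReal (1 / L ^ 2) * (vMaj L M τ *
          (lor (c * τ) * offMaj L (c * τ) (ξ i) (η i) (p i) (q i))) +
        ENNReal.ofReal (2 / L) * (vMaj L M τ * lor (c * τ)) + vMaj L M τ * weylR d L T (c * τ) +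
        2 * (vMaj L M τ * farI L T (c * τ))) := by
    intro τ
    unfold diffMaj
    simp only [mul_add, Finset.mul_sum]
    congr 1
    · congr 1
      · congr 1
        · exact Finset.sum_congr rfl fun i _ => by ring
        · ring
      · ring
    · ring
  have h : ∀ i, Measurable fun s => offMaj L s (ξ i) (η i) (p i) (q i) :=
    fun i => measurable_offMaj L _ _ _ _
  have h' : ∀ i, Measurable fun s => lor s * offMaj L s (ξ i) (η i) (p i) (q i) :=
    fun i => measurable_lor.mul (h i)
  have h2 : ∀ i, Measurable fun τ =>
      vMaj L M τ * (lor (c * τ) * offMaj L (c * τ) (ξ i) (η i) (p i) (q i)) :=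
    fun i => (measurable_vMaj L M).mul ((h' i).comp (measurable_const_mul c))
  simp_rw [e]
  rw [lintegral_const_mul _ (by fun_prop), lintegral_add_left (by fun_prop),
    lintegral_add_left (by fun_prop), lintegral_add_left (by fun_prop),
    lintegral_finsetSum _ fun i _ => by fun_prop, lintegral_const_mul _ (by fun_prop),
    lintegral_const_mul _ (by fun_prop)]
  have b0 : ∀ i ∈ Finset.univ, ∫⁻ τ, ENNReal.ofReal (1 / L ^ 2) * (vMaj L M τ *
          (lor (c * τ) * offMaj L (c * τ) (ξ i) (η i) (p i) (q i))) ≤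
      ENNReal.ofReal (c⁻¹ * (10 * bumpC * offC) / L * (1 + |ξ i| + |η i|)) := by
    intro i _
    rw [lintegral_const_mul _ (h2 i)]
    refine (mul_le_mul' le_rfl ((lintegral_vMaj_mul_scaled (M := M) hL hc (h' i)).trans
      (mul_le_mul' le_rfl (mul_le_mul' le_rfl (lintegral_lor_mul_offMaj hL _ _ _ _))))).trans ?_
    rw [show (2 : ℝ≥0∞) = ENNReal.ofReal 2 by simp, ← ENNReal.ofReal_mul (by positivity),
      ← ENNReal.ofReal_mul (by positivity), ← ENNReal.ofReal_mul (by positivity)]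
    apply ENNReal.ofReal_le_ofReal
    apply le_of_eq
    field_simp
    ring
  have b1 := lintegral_vMaj_mul_scaled (M := M) hL hc measurable_lor
  have b2 := (lintegral_vMaj_mul_scaled (M := M) hL hc (measurable_weylR d L T)).trans
    (mul_le_mul' le_rfl (mul_le_mul' le_rfl hR))
  have b3 := (lintegral_vMaj_mul_farI hL hc hT).trans
    (ENNReal.ofReal_le_ofReal (inv_four_le hL hc hcL))
  rw [lintegral_lor] at b1
  refine (mul_le_mul' le_rfl (add_le_add (add_le_add (add_le_add (Finset.sum_le_sum b0)
    (mul_le_mul' le_rfl b1)) b2) (mul_le_mul' le_rfl b3))).trans ?_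
  have hpi := Real.pi_pos
  have hc' : 0 < c⁻¹ := by positivity
  set S := ∑ i, (1 + |ξ i| + |η i|) with hS
  have hS1 : 1 ≤ S := by
    calc (1 : ℝ) ≤ d := by exact_mod_cast hd
      _ = ∑ _i : Fin d, (1 : ℝ) := by simp
      _ ≤ S := Finset.sum_le_sum fun i _ => by
        have := abs_nonneg (ξ i); have := abs_nonneg (η i); linarith
  have b4 : ∑ i, ENNReal.ofReal (c⁻¹ * (10 * bumpC * offC) / L * (1 + |ξ i| + |η i|)) =
      ENNReal.ofReal (c⁻¹ * (10 * bumpC * offC) / L * S) := by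
    rw [hS, Finset.mul_sum, ENNReal.ofReal_sum_of_nonneg fun i _ => by positivity]
  rw [b4,
    show (2 : ℝ≥0∞) = ENNReal.ofReal 2 by simp, ← ENNReal.ofReal_mul (by positivity),
    ← ENNReal.ofReal_mul (by positivity), ← ENNReal.ofReal_mul (by positivity),
    ← ENNReal.ofReal_mul (by positivity), ← ENNReal.ofReal_mul (by positivity),
    ← ENNReal.ofReal_mul (by positivity),
    ← ENNReal.ofReal_add (by positivity) (by positivity),
    ← ENNReal.ofReal_add (by positivity) (by positivity),
    ← ENNReal.ofReal_add (by positivity) (by positivity), ← ENNReal.ofReal_mul (by positivity)]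
  apply ENNReal.ofReal_le_ofReal
  rw [diffC, mul_assoc (locC ^ d), mul_assoc (locC ^ d)]
  refine mul_le_mul_of_nonneg_left ?_ (by positivity)
  have e5 : c⁻¹ * (10 * bumpC * offC) / L * S + 2 / L * (2 * (c⁻¹ * Real.pi)) +
      2 * (c⁻¹ * R) + 2 * (c⁻¹ * (4 / L)) =
      c⁻¹ * ((10 * bumpC * offC * S + 4 * Real.pi + 8) / L + 2 * R) := by ring
  rw [e5]
  rw [show (10 * bumpC * offC + 24) * c⁻¹ * (R + S / L) =
    c⁻¹ * (((10 * bumpC * offC + 24) * S) / L + (10 * bumpC * offC + 24) * R) by ring]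
  have h5 : 0 ≤ 10 * bumpC * offC := by positivity
  have := Real.pi_le_four
  have h6 : 10 * bumpC * offC * S + 4 * Real.pi + 8 ≤ (10 * bumpC * offC + 24) * S := by nlinarith
  have h7 : 2 * R ≤ (10 * bumpC * offC + 24) * R := by gcongr; linarith
  have h8 := div_le_div_of_nonneg_right h6 hL0.le
  exact mul_le_mul_of_nonneg_left (add_le_add h8 h7) hc'.le

end integrals

/-- The space of pairs of `n`-tuples of points of `ℝ^d`. -/
abbrev PairSp (d n : ℕ) : Type :=
  (Fin n → EuclideanSpace ℝ (Fin d)) × (Fin n → EuclideanSpace ℝ (Fin d))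

/-- Regrouping coordinates `(x_{ji}, y_{ji})` as a pair of tuples of vectors. -/
def unflat (d n : ℕ) : (Fin n → Fin d → ℝ × ℝ) ≃ᵐ PairSp d n where
  toFun w := (fun j => WithLp.toLp 2 fun i => (w j i).1, fun j => WithLp.toLp 2 fun i => (w j i).2)
  invFun z := fun j i => (z.1 j i, z.2 j i)
  left_inv w := rfl
  right_inv z := rfl
  measurable_toFun := by
    simp only [Equiv.coe_fn_mk]
    fun_prop
  measurable_invFun := by
    simp only [Equiv.coe_fn_symm_mk]
    fun_prop

theorem measurePreserving_unflat (d n : ℕ) : MeasurePreserving (unflat d n) := by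
  have h1 : MeasurePreserving (fun (w : Fin d → ℝ × ℝ) =>
      ((WithLp.toLp 2 fun i => (w i).1, WithLp.toLp 2 fun i => (w i).2) :
        EuclideanSpace ℝ (Fin d) × EuclideanSpace ℝ (Fin d))) :=
    ((PiLp.volume_preserving_toLp (Fin d)).prod (PiLp.volume_preserving_toLp (Fin d))).comp
      (volume_measurePreserving_arrowProdEquivProdArrow ℝ ℝ (Fin d))
  exact (volume_measurePreserving_arrowProdEquivProdArrow (EuclideanSpace ℝ (Fin d))
    (EuclideanSpace ℝ (Fin d)) (Fin n)).comp (volume_preserving_pi fun _ : Fin n => h1)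

theorem integral_prod_pairs {d n : ℕ} (k : Fin n → Fin d → ℝ × ℝ → ℂ) :
    ∫ z : PairSp d n, ∏ j, ∏ i, k j i (z.1 j i, z.2 j i) = ∏ j, ∏ i, ∫ w, k j i w := by
  rw [← (measurePreserving_unflat d n).integral_comp' (f := unflat d n)]
  have : ∀ w, ∏ j, ∏ i, k j i (((unflat d n) w).1 j i, ((unflat d n) w).2 j i) =
      ∏ j, ∏ i, k j i (w j i) := fun w => rfl
  simp_rw [this]
  rw [integral_fintype_prod_volume_eq_prod (fun j (v : Fin d → ℝ × ℝ) => ∏ i, k j i (v i))]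
  exact Finset.prod_congr rfl fun j _ => integral_fintype_prod_volume_eq_prod _

theorem integrable_prod_pairs {d n : ℕ} {k : Fin n → Fin d → ℝ × ℝ → ℂ}
    (hk : ∀ j i, Integrable (k j i)) :
    Integrable fun z : PairSp d n => ∏ j, ∏ i, k j i (z.1 j i, z.2 j i) := by
  rw [← (measurePreserving_unflat d n).integrable_comp_emb (unflat d n).measurableEmbedding]
  exact Integrable.fintype_prod (f := fun j (v : Fin d → ℝ × ℝ) => ∏ i, k j i (v i))
    fun j => Integrable.fintype_prod (hk j)

theorem lintegral_fin_prod : ∀ {n : ℕ} {f : Fin n → ℝ → ℝ≥0∞}, (∀ j, Measurable (f j)) →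
    ∫⁻ τ : Fin n → ℝ, ∏ j, f j (τ j) = ∏ j, ∫⁻ t, f j t
  | 0, f, _ => by simp [volume_pi]
  | n + 1, f, hf => by
    have h := (volume_preserving_piFinSuccAbove (fun _ : Fin (n + 1) => ℝ) 0).symm
    rw [← h.lintegral_comp_emb (MeasurableEquiv.measurableEmbedding _), Measure.volume_eq_prod]
    have h2 : ∀ a : ℝ × (Fin n → ℝ),
        ∏ j, f j ((MeasurableEquiv.piFinSuccAbove (fun _ : Fin (n + 1) => ℝ) 0).symm a j) =
        f 0 a.1 * ∏ j : Fin n, f j.succ (a.2 j) := by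
      intro a
      rw [Fin.prod_univ_succ]
      rfl
    simp_rw [h2]
    rw [lintegral_prod_mul (f := f 0) (g := fun v : Fin n → ℝ => ∏ j : Fin n, f j.succ (v j))
      (hf 0).aemeasurable (Finset.measurable_prod _ fun j _ =>
        (hf j.succ).comp (measurable_pi_apply j)).aemeasurable,
      lintegral_fin_prod fun j => hf j.succ, Fin.prod_univ_succ]

theorem locC_pow_le_diffC (d : ℕ) : locC ^ d * 20 ≤ diffC d := by
  have h1 := one_le_locC
  have h2 := one_le_bumpC
  have h3 := offC_pos
  unfold diffC
  have : 0 ≤ 10 * bumpC * offC := by positivity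
  have : 0 < locC ^ d := by positivity
  nlinarith

theorem diffC_pos (d : ℕ) : 0 < diffC d := by
  have h1 := one_le_locC
  have h2 := locC_pow_le_diffC d
  have : 0 < locC ^ d := by positivity
  linarith

section box

variable {d n : ℕ} {L M T c R : ℝ}

theorem lintegral_vMaj_mul_mixed (hd : 3 ≤ d) (hL : 1 ≤ L) (hc : 0 < c) (hcL : c ≤ L ^ 2)
    (hT : T = c * M / L ^ 2) (hR0 : 0 ≤ R) (hR1 : R ≤ 1)
    (hR : ∫⁻ s, weylR d L T s ≤ ENNReal.ofReal R)
    (ξ η : Fin n → Fin d → ℝ) (B : Fin n → Fin d → ℤ × ℤ) (j : Fin n) :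
    ∫⁻ τ : Fin n → ℝ, (∏ k, vMaj L M (τ k)) *
      (diffMaj d L T (ξ j) (η j) (fun i => (B j i).1) (fun i => (B j i).2) (c * τ j) *
        ∏ k ∈ Finset.univ.erase j, prodMaj d L T (c * τ k)) ≤
      ENNReal.ofReal ((diffC d * c⁻¹) ^ n * (R + (∑ i, (1 + |ξ j i| + |η j i|)) / L)) := by
  set f : Fin n → ℝ → ℝ≥0∞ := fun k t => vMaj L M t * (if k = j then
    diffMaj d L T (ξ j) (η j) (fun i => (B j i).1) (fun i => (B j i).2) (c * t)
    else prodMaj d L T (c * t)) with hf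
  have hfm : ∀ k, Measurable (f k) := by
    intro k
    simp only [hf]
    split_ifs <;> fun_prop
  have hpt : ∀ τ : Fin n → ℝ, (∏ k, vMaj L M (τ k)) *
      (diffMaj d L T (ξ j) (η j) (fun i => (B j i).1) (fun i => (B j i).2) (c * τ j) *
        ∏ k ∈ Finset.univ.erase j, prodMaj d L T (c * τ k)) = ∏ k, f k (τ k) := by
    intro τ
    simp only [hf]
    rw [Finset.prod_mul_distrib, ← Finset.mul_prod_erase Finset.univ (fun k => if k = j then
      diffMaj d L T (ξ j) (η j) (fun i => (B j i).1) (fun i => (B j i).2) (c * τ k)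
      else prodMaj d L T (c * τ k)) (Finset.mem_univ j), if_pos rfl]
    congr 2
    refine Finset.prod_congr rfl fun k hk => ?_
    rw [if_neg (Finset.ne_of_mem_erase hk)]
  simp_rw [hpt]
  rw [lintegral_fin_prod hfm, ← Finset.mul_prod_erase Finset.univ _ (Finset.mem_univ j)]
  have hc' : 0 < c⁻¹ := inv_pos.2 hc
  have hD := diffC_pos d
  have hDl := locC_pow_le_diffC d
  have e1 : ∫⁻ t, f j t ≤
      ENNReal.ofReal (diffC d * c⁻¹ * (R + (∑ i, (1 + |ξ j i| + |η j i|)) / L)) := by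
    simp only [hf, if_true]
    exact lintegral_vMaj_mul_diffMaj (by omega) hL hc hcL hT hR0 hR _ _ _ _
  have e2 : ∀ k ∈ Finset.univ.erase j, ∫⁻ t, f k t ≤ ENNReal.ofReal (diffC d * c⁻¹) := by
    intro k hk
    simp only [hf, if_neg (Finset.ne_of_mem_erase hk)]
    refine (lintegral_vMaj_mul_prodMaj hL hc hcL hT hR1 hR).trans (ENNReal.ofReal_le_ofReal ?_)
    gcongr
  refine (mul_le_mul' e1 (Finset.prod_le_prod' e2)).trans (le_of_eq ?_)
  have hn : 0 < n := j.pos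
  rw [Finset.prod_const, Finset.card_erase_of_mem (Finset.mem_univ j), Finset.card_univ,
    Fintype.card_fin, ← ENNReal.ofReal_pow (by positivity),
    ← ENNReal.ofReal_mul (by positivity)]
  congr 1
  calc _ = (diffC d * c⁻¹) ^ (n - 1) * (diffC d * c⁻¹) *
        (R + (∑ i, (1 + |ξ j i| + |η j i|)) / L) := by ring
    _ = _ := by rw [← pow_succ, Nat.sub_add_cancel hn]

theorem enorm_box_diff_le (hd : 3 ≤ d) (hL : 1 ≤ L) (hc : 0 < c) (hcL : c ≤ L ^ 2)
    (hT : T = c * M / L ^ 2) (hT0 : 0 ≤ T) (hR0 : 0 ≤ R) (hR1 : R ≤ 1)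
    (hR : ∫⁻ s, weylR d L T s ≤ ENNReal.ofReal R)
    {b : ℝ} (hb : 0 ≤ b) {Ph : (Fin n → ℝ) → ℂ}
    (hP : ∀ τ, ‖Ph τ‖ₑ ≤ ENNReal.ofReal b * ∏ j, vMaj L M (τ j))
    (ξ η : Fin n → Fin d → ℝ) (B : Fin n → Fin d → ℤ × ℤ) :
    ‖∫ τ, Ph τ *
      ((∏ j, ∏ i, bilSum L (c * τ j) (ξ j i) (η j i) (B j i).1 (B j i).2 / L ^ 2) -
        ∏ j, ∏ i, bilInt (c * τ j) (ξ j i) (η j i) (B j i).1 (B j i).2)‖ₑ ≤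
    ENNReal.ofReal (b * (diffC d * c⁻¹) ^ n) *
      (ENNReal.ofReal (n * R + n * d / L) + ENNReal.ofReal (1 / L) *
        ∑ j, ∑ i, (ENNReal.ofReal |ξ j i| + ENNReal.ofReal |η j i|)) := by
  have hc' : 0 < c⁻¹ := inv_pos.2 hc
  have hD := diffC_pos d
  refine (enorm_integral_le_lintegral_enorm _).trans ?_
  calc _ ≤ ∫⁻ τ : Fin n → ℝ, ENNReal.ofReal b * ∑ j, (∏ k, vMaj L M (τ k)) *
      (diffMaj d L T (ξ j) (η j) (fun i => (B j i).1) (fun i => (B j i).2) (c * τ j) *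
        ∏ k ∈ Finset.univ.erase j, prodMaj d L T (c * τ k)) := by
        refine lintegral_mono fun τ => ?_
        rw [enorm_mul]
        refine (mul_le_mul' (hP τ) (enorm_prod_sub_prod_le Finset.univ _ _
          (fun j => prodMaj d L T (c * τ j))
          (fun j => enorm_prod_bilSum_le_prodMaj _ _ _ _ (by omega) hL hT0)
          (fun j => enorm_prod_bilInt_le_prodMaj _ _ _ _ (by omega)))).trans ?_
        rw [mul_assoc, ← Finset.mul_sum]
        gcongr with j
        exact enorm_prod_sub_le_diffMaj _ _ _ _ hd hL hT0
    _ ≤ ENNReal.ofReal b * ∑ j, ENNReal.ofReal ((diffC d * c⁻¹) ^ n *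
          (R + (∑ i, (1 + |ξ j i| + |η j i|)) / L)) := by
        rw [lintegral_const_mul _ (by fun_prop), lintegral_finsetSum _ fun i _ => by fun_prop]
        gcongr with j
        exact lintegral_vMaj_mul_mixed hd hL hc hcL hT hR0 hR1 hR ξ η B j
    _ = _ := by
        simp_rw [← ENNReal.ofReal_add (abs_nonneg _) (abs_nonneg _)]
        have hs : ∀ j ∈ Finset.univ, 0 ≤ ∑ i, (|ξ j i| + |η j i|) := fun j _ => by positivity
        rw [← ENNReal.ofReal_sum_of_nonneg fun j _ => by positivity]
        have hj : ∀ j, ∑ i, ENNReal.ofReal (|ξ j i| + |η j i|) =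
            ENNReal.ofReal (∑ i, (|ξ j i| + |η j i|)) := fun j =>
          (ENNReal.ofReal_sum_of_nonneg fun i _ => by positivity).symm
        simp_rw [hj]
        rw [← ENNReal.ofReal_sum_of_nonneg hs, ← ENNReal.ofReal_mul hb,
          ← ENNReal.ofReal_mul (by positivity),
          ← ENNReal.ofReal_add (by positivity) (mul_nonneg (by positivity) (Finset.sum_nonneg hs)),
          ← ENNReal.ofReal_mul (by positivity)]
        congr 1
        simp_rw [add_assoc (1 : ℝ)]
        simp_rw [Finset.sum_add_distrib, ← Finset.mul_sum, Finset.sum_add_distrib,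
          ← Finset.sum_div, Finset.sum_add_distrib, Finset.sum_const, Finset.card_univ,
          Fintype.card_fin, nsmul_eq_mul]
        ring

theorem enorm_box_total_le (hd : 3 ≤ d) (hL : 1 ≤ L) (hc : 0 < c) (hcL : c ≤ L ^ 2)
    (hT : T = c * M / L ^ 2) (hT0 : 0 ≤ T) (hR0 : 0 ≤ R) (hR1 : R ≤ 1)
    (hR : ∫⁻ s, weylR d L T s ≤ ENNReal.ofReal R)
    {a b : ℝ} (ha : 0 ≤ a) (hb : 0 ≤ b) {Ph : (Fin n → ℝ) → ℂ}
    (hP : ∀ τ, ‖Ph τ‖ₑ ≤ ENNReal.ofReal b * ∏ j, vMaj L M (τ j))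
    {Wh : PairSp d n → ℂ} (hWm : Measurable Wh) (hW : ∫⁻ ζ, ‖Wh ζ‖ₑ ≤ ENNReal.ofReal a)
    (hW1 : ∀ j i, ∫⁻ ζ, ‖Wh ζ‖ₑ * ENNReal.ofReal |ζ.1 j i| ≤ ENNReal.ofReal a)
    (hW2 : ∀ j i, ∫⁻ ζ, ‖Wh ζ‖ₑ * ENNReal.ofReal |ζ.2 j i| ≤ ENNReal.ofReal a)
    (B : Fin n → Fin d → ℤ × ℤ) :
    ‖∫ ζ, Wh ζ * ∫ τ, Ph τ *
      ((∏ j, ∏ i, bilSum L (c * τ j) (ζ.1 j i) (ζ.2 j i) (B j i).1 (B j i).2 / L ^ 2) -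
        ∏ j, ∏ i, bilInt (c * τ j) (ζ.1 j i) (ζ.2 j i) (B j i).1 (B j i).2)‖ₑ ≤
    ENNReal.ofReal (a * b * (diffC d * c⁻¹) ^ n * (n * (R + 3 * d / L))) := by
  have hc' : 0 < c⁻¹ := inv_pos.2 hc
  have hD := diffC_pos d
  refine (enorm_integral_le_lintegral_enorm _).trans ?_
  calc _ ≤ ∫⁻ ζ : PairSp d n, ENNReal.ofReal (b * (diffC d * c⁻¹) ^ n) *
      (ENNReal.ofReal (n * R + n * d / L) * ‖Wh ζ‖ₑ + ENNReal.ofReal (1 / L) *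
        ∑ j, ∑ i, (‖Wh ζ‖ₑ * ENNReal.ofReal |ζ.1 j i| +
          ‖Wh ζ‖ₑ * ENNReal.ofReal |ζ.2 j i|)) := by
        refine lintegral_mono fun ζ => ?_
        rw [enorm_mul]
        refine (mul_le_mul' le_rfl (enorm_box_diff_le hd hL hc hcL hT hT0 hR0 hR1 hR hb hP
          (fun j i => ζ.1 j i) (fun j i => ζ.2 j i) B)).trans (le_of_eq ?_)
        simp_rw [← mul_add, ← Finset.mul_sum]
        ring
    _ ≤ ENNReal.ofReal (b * (diffC d * c⁻¹) ^ n) *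
      (ENNReal.ofReal (n * R + n * d / L) * ENNReal.ofReal a + ENNReal.ofReal (1 / L) *
        ∑ _j : Fin n, ∑ _i : Fin d, (ENNReal.ofReal a + ENNReal.ofReal a)) := by
        rw [lintegral_const_mul _ (by fun_prop), lintegral_add_left (by fun_prop),
          lintegral_const_mul _ (by fun_prop), lintegral_const_mul _ (by fun_prop),
          lintegral_finsetSum _ fun i _ => by fun_prop]
        gcongr with j _
        rw [lintegral_finsetSum _ fun i _ => by fun_prop]
        gcongr with i _
        rw [lintegral_add_left (by fun_prop)]
        exact add_le_add (hW1 j i) (hW2 j i)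
    _ = _ := by
        simp_rw [Finset.sum_const, Finset.card_univ, Fintype.card_fin, nsmul_eq_mul,
          ← ENNReal.ofReal_add ha ha, ← ENNReal.ofReal_natCast]
        rw [← ENNReal.ofReal_mul (by positivity), ← ENNReal.ofReal_mul (by positivity),
          ← ENNReal.ofReal_mul (by positivity), ← ENNReal.ofReal_mul (by positivity),
          ← ENNReal.ofReal_add (by positivity) (by positivity),
          ← ENNReal.ofReal_mul (by positivity)]
        congr 1
        ring

end box

theorem integral_prod_volume {X Y : Type*} [MeasureSpace X] [MeasureSpace Y]
    [SFinite (volume : Measure X)] [SFinite (volume : Measure Y)] (f : X × Y → ℂ)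
    (hf : Integrable f) : ∫ p, f p = ∫ x, ∫ y, f (x, y) :=
  integral_prod f hf

theorem integral_swap_volume {X Y : Type*} [MeasureSpace X] [MeasureSpace Y]
    [SFinite (volume : Measure X)] [SFinite (volume : Measure Y)] (f : X × Y → ℂ)
    (hf : Integrable f) : ∫ x, ∫ y, f (x, y) = ∫ y, ∫ x, f (x, y) :=
  integral_integral_swap (f := fun x y => f (x, y)) hf

section bridge

variable {d n : ℕ} {L c : ℝ}

/-- The product cutoff localising to the unit box centred at the integer point `B`. -/
def boxBump (B : Fin n → Fin d → ℤ × ℤ) (z : PairSp d n) : ℝ :=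
  ∏ j, ∏ i, bump (z.1 j i - (B j i).1) * bump (z.2 j i - (B j i).2)

/-- The localised character of all the variables. -/
def boxKer (c : ℝ) (B : Fin n → Fin d → ℤ × ℤ) (ζ : PairSp d n) (τ : Fin n → ℝ)
    (z : PairSp d n) : ℂ :=
  ∏ j, ∏ i, bilKer (c * τ j) (ζ.1 j i) (ζ.2 j i) (B j i).1 (B j i).2 (z.1 j i, z.2 j i)

theorem pairingV_eq_sum (z ζ : PairSp d n) :
    pairingV d n z ζ = ∑ j, ∑ i, (ζ.1 j i * z.1 j i + ζ.2 j i * z.2 j i) := by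
  simp [pairingV, PiLp.inner_apply, Finset.sum_add_distrib]

theorem boxKer_eq (c : ℝ) (B : Fin n → Fin d → ℤ × ℤ) (ζ : PairSp d n) (τ : Fin n → ℝ)
    (z : PairSp d n) :
    boxKer c B ζ τ z = (boxBump B z : ℂ) * efun (pairingV d n z ζ) *
      efun (∑ j, τ j * (c * ⟪z.1 j, z.2 j⟫)) := by
  rw [mul_assoc, ← efun_add, pairingV_eq_sum, ← Finset.sum_add_distrib]
  have : ∀ j, ∑ i, (ζ.1 j i * z.1 j i + ζ.2 j i * z.2 j i) + τ j * (c * ⟪z.1 j, z.2 j⟫) =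
      ∑ i, (ζ.1 j i * z.1 j i + ζ.2 j i * z.2 j i + c * τ j * (z.1 j i * z.2 j i)) := by
    intro j
    rw [Finset.sum_add_distrib (g := fun i => c * τ j * (z.1 j i * z.2 j i)), PiLp.inner_apply,
      Finset.mul_sum, Finset.mul_sum]
    congr 1
    refine Finset.sum_congr rfl fun i _ => ?_
    simp
    ring
  simp_rw [this, efun_sum, boxKer, boxBump, bilKer]
  push_cast
  rw [← Finset.prod_mul_distrib]
  refine Finset.prod_congr rfl fun j _ => ?_
  rw [← Finset.prod_mul_distrib]

theorem continuous_pairingV :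
    Continuous fun p : PairSp d n × PairSp d n => pairingV d n p.1 p.2 := by
  simp_rw [pairingV_eq_sum]
  fun_prop

theorem boxBump_nonneg (B : Fin n → Fin d → ℤ × ℤ) (z : PairSp d n) : 0 ≤ boxBump B z :=
  Finset.prod_nonneg fun _ _ => Finset.prod_nonneg fun _ _ =>
    mul_nonneg (bump_nonneg _) (bump_nonneg _)

theorem integral_boxKer (c : ℝ) (B : Fin n → Fin d → ℤ × ℤ) (ζ : PairSp d n) (τ : Fin n → ℝ) :
    ∫ z, boxKer c B ζ τ z =
      ∏ j, ∏ i, bilInt (c * τ j) (ζ.1 j i) (ζ.2 j i) (B j i).1 (B j i).2 := by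
  simp_rw [bilInt_eq_integral_bilKer]
  exact integral_prod_pairs fun j i =>
    bilKer (c * τ j) (ζ.1 j i) (ζ.2 j i) (B j i).1 (B j i).2

theorem integrable_boxBump (B : Fin n → Fin d → ℤ × ℤ) : Integrable (boxBump B) := by
  have h := integrable_prod_pairs (d := d) (n := n) (k := fun j i w =>
    ((bump (w.1 - (B j i).1) : ℝ) : ℂ) * ((bump (w.2 - (B j i).2) : ℝ) : ℂ)) (fun j i =>
      Integrable.mul_prod (f := fun x : ℝ => ((bump (x - (B j i).1) : ℝ) : ℂ))
        (g := fun x : ℝ => ((bump (x - (B j i).2) : ℝ) : ℂ))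
        (integrable_bump_sub _) (integrable_bump_sub _))
  refine h.re.congr (Filter.Eventually.of_forall fun z => ?_)
  simp only [boxBump, ← Complex.ofReal_mul, ← Complex.ofReal_prod]
  exact Complex.ofReal_re _

/-- The lattice point with integer code `m`. -/
def latPt (L : ℝ) (m : Fin n → Fin d → ℤ × ℤ) : PairSp d n :=
  unflat d n fun j i => (((m j i).1 : ℝ) / L, ((m j i).2 : ℝ) / L)

/-- The integer codes of the lattice points in the unit box centred at `B`. -/
def boxCodes (L : ℝ) (B : Fin n → Fin d → ℤ × ℤ) : Finset (Fin n → Fin d → ℤ × ℤ) :=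
  Fintype.piFinset fun j => Fintype.piFinset fun i => win L (B j i).1 ×ˢ win L (B j i).2

theorem sum_boxKer (B : Fin n → Fin d → ℤ × ℤ) (ζ : PairSp d n) (τ : Fin n → ℝ) :
    ∑ m ∈ boxCodes L B, boxKer c B ζ τ (latPt L m) =
      ∏ j, ∏ i, bilSum L (c * τ j) (ζ.1 j i) (ζ.2 j i) (B j i).1 (B j i).2 := by
  have h : ∀ j i, bilSum L (c * τ j) (ζ.1 j i) (ζ.2 j i) (B j i).1 (B j i).2 =
      ∑ m ∈ win L (B j i).1 ×ˢ win L (B j i).2,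
        bilKer (c * τ j) (ζ.1 j i) (ζ.2 j i) (B j i).1 (B j i).2
          ((m.1 : ℝ) / L, (m.2 : ℝ) / L) := by
    intro j i
    rw [Finset.sum_product, bilSum]
    refine Finset.sum_congr rfl fun m _ => ?_
    rw [bumpSum, Finset.mul_sum]
    refine Finset.sum_congr rfl fun m' _ => ?_
    simp only [bilKer]
    rw [show ∀ a b e f : ℂ, a * e * (b * f) = a * b * (e * f) by intros; ring, ← efun_add]
    congr 2
    ring
  simp_rw [h, Finset.prod_univ_sum]
  rfl

theorem norm_boxKer (c : ℝ) (B : Fin n → Fin d → ℤ × ℤ) (ζ : PairSp d n) (τ : Fin n → ℝ)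
    (z : PairSp d n) : ‖boxKer c B ζ τ z‖ = boxBump B z := by
  rw [boxKer_eq, norm_mul, norm_mul, norm_efun, norm_efun, Complex.norm_real, Real.norm_eq_abs,
    abs_of_nonneg (boxBump_nonneg B z), mul_one, mul_one]

theorem continuous_boxKer (c : ℝ) (B : Fin n → Fin d → ℤ × ℤ) :
    Continuous fun p : PairSp d n × (PairSp d n × (Fin n → ℝ)) => boxKer c B p.2.1 p.2.2 p.1 := by
  unfold boxKer bilKer
  fun_prop

variable {Wh : PairSp d n → ℂ} {Ph : (Fin n → ℝ) → ℂ} {W : PairSp d n → ℂ} {Ψ : (Fin n → ℝ) → ℂ}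

theorem localised_eq_integral (hW : ∀ z, W z = ∫ ζ, Wh ζ * efun (pairingV d n z ζ))
    (hΨ : ∀ Ω, Ψ Ω = ∫ τ, Ph τ * efun (∑ j, τ j * Ω j)) (B : Fin n → Fin d → ℤ × ℤ)
    (z : PairSp d n) :
    (boxBump B z : ℂ) * (W z * Ψ fun j => c * ⟪z.1 j, z.2 j⟫) =
      ∫ ζ, Wh ζ * ∫ τ, Ph τ * boxKer c B ζ τ z := by
  have h : ∀ ζ, ∫ τ, Ph τ * boxKer c B ζ τ z = (boxBump B z : ℂ) * efun (pairingV d n z ζ) *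
      Ψ fun j => c * ⟪z.1 j, z.2 j⟫ := by
    intro ζ
    rw [hΨ, ← integral_const_mul]
    refine integral_congr_ae (Filter.Eventually.of_forall fun τ => ?_)
    simp only [boxKer_eq]
    ring
  simp_rw [h]
  rw [hW, ← integral_mul_const, ← integral_const_mul]
  refine integral_congr_ae (Filter.Eventually.of_forall fun ζ => ?_)
  simp only
  ring

theorem integrable_bridge (hWi : Integrable Wh) (hPi : Integrable Ph)
    (B : Fin n → Fin d → ℤ × ℤ) :
    Integrable (fun p : PairSp d n × (PairSp d n × (Fin n → ℝ)) =>
      Wh p.2.1 * (Ph p.2.2 * boxKer c B p.2.1 p.2.2 p.1)) := by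
  have h1 := Integrable.mul_prod (integrable_boxBump B).ofReal (Integrable.mul_prod hWi hPi)
  refine h1.mono ?_ (Filter.Eventually.of_forall fun p => ?_)
  · exact hWi.1.comp_fst.comp_snd.mul
      (hPi.1.comp_snd.comp_snd.mul (continuous_boxKer c B).aestronglyMeasurable)
  · simp only [norm_mul, norm_boxKer, RCLike.norm_ofReal, abs_of_nonneg (boxBump_nonneg B _)]
    apply le_of_eq
    ring

theorem integrable_bridge_left (hWi : Integrable Wh) (hPi : Integrable Ph)
    (B : Fin n → Fin d → ℤ × ℤ) (z : PairSp d n) :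
    Integrable (fun p : PairSp d n × (Fin n → ℝ) =>
      Wh p.1 * (Ph p.2 * boxKer c B p.1 p.2 z)) := by
  refine ((Integrable.mul_prod hWi hPi).const_mul (boxBump B z : ℂ)).mono ?_
    (Filter.Eventually.of_forall fun p => ?_)
  · have hc : Continuous fun p : PairSp d n × (Fin n → ℝ) => boxKer c B p.1 p.2 z :=
      by
      unfold boxKer bilKer
      fun_prop
    exact hWi.1.comp_fst.mul (hPi.1.comp_snd.mul hc.aestronglyMeasurable)
  · simp only [norm_mul, norm_boxKer, Complex.norm_real, Real.norm_eq_abs,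
      abs_of_nonneg (boxBump_nonneg B _)]
    apply le_of_eq
    ring

theorem localised_eq_integral_prod (hWi : Integrable Wh) (hPi : Integrable Ph)
    (hW : ∀ z, W z = ∫ ζ, Wh ζ * efun (pairingV d n z ζ))
    (hΨ : ∀ Ω, Ψ Ω = ∫ τ, Ph τ * efun (∑ j, τ j * Ω j)) (B : Fin n → Fin d → ℤ × ℤ)
    (z : PairSp d n) :
    (boxBump B z : ℂ) * (W z * Ψ fun j => c * ⟪z.1 j, z.2 j⟫) =
      ∫ p : PairSp d n × (Fin n → ℝ), Wh p.1 * (Ph p.2 * boxKer c B p.1 p.2 z) := by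
  rw [localised_eq_integral hW hΨ, integral_prod_volume _ (integrable_bridge_left hWi hPi B z)]
  simp_rw [integral_const_mul]

theorem integral_localised (hWi : Integrable Wh) (hPi : Integrable Ph)
    (hW : ∀ z, W z = ∫ ζ, Wh ζ * efun (pairingV d n z ζ))
    (hΨ : ∀ Ω, Ψ Ω = ∫ τ, Ph τ * efun (∑ j, τ j * Ω j)) (B : Fin n → Fin d → ℤ × ℤ) :
    ∫ z, (boxBump B z : ℂ) * (W z * Ψ fun j => c * ⟪z.1 j, z.2 j⟫) =
      ∫ p : PairSp d n × (Fin n → ℝ), Wh p.1 * (Ph p.2 *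
        ∏ j, ∏ i, bilInt (c * p.2 j) (p.1.1 j i) (p.1.2 j i) (B j i).1 (B j i).2) := by
  simp_rw [localised_eq_integral_prod hWi hPi hW hΨ]
  rw [integral_swap_volume _ (integrable_bridge hWi hPi B)]
  simp_rw [integral_const_mul, integral_boxKer]

theorem sum_localised (hWi : Integrable Wh) (hPi : Integrable Ph)
    (hW : ∀ z, W z = ∫ ζ, Wh ζ * efun (pairingV d n z ζ))
    (hΨ : ∀ Ω, Ψ Ω = ∫ τ, Ph τ * efun (∑ j, τ j * Ω j)) (B : Fin n → Fin d → ℤ × ℤ) :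
    ∑ m ∈ boxCodes L B, (boxBump B (latPt L m) : ℂ) *
        (W (latPt L m) * Ψ fun j => c * ⟪(latPt L m).1 j, (latPt L m).2 j⟫) =
      ∫ p : PairSp d n × (Fin n → ℝ), Wh p.1 * (Ph p.2 *
        ∏ j, ∏ i, bilSum L (c * p.2 j) (p.1.1 j i) (p.1.2 j i) (B j i).1 (B j i).2) := by
  simp_rw [localised_eq_integral_prod hWi hPi hW hΨ]
  rw [← integral_finsetSum _ fun m _ => integrable_bridge_left hWi hPi B _]
  simp_rw [← Finset.mul_sum, sum_boxKer]

theorem integrable_localised (hWi : Integrable Wh) (hPi : Integrable Ph)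
    (hW : ∀ z, W z = ∫ ζ, Wh ζ * efun (pairingV d n z ζ))
    (hΨ : ∀ Ω, Ψ Ω = ∫ τ, Ph τ * efun (∑ j, τ j * Ω j)) (B : Fin n → Fin d → ℤ × ℤ) :
    Integrable fun z => (boxBump B z : ℂ) * (W z * Ψ fun j => c * ⟪z.1 j, z.2 j⟫) := by
  refine (integrable_bridge (c := c) hWi hPi B).integral_prod_left.congr
    (Filter.Eventually.of_forall fun z => ?_)
  exact (localised_eq_integral_prod hWi hPi hW hΨ B z).symm

end bridge

section boxError

variable {d n : ℕ} {L M T c R : ℝ}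
variable {Wh : PairSp d n → ℂ} {Ph : (Fin n → ℝ) → ℂ} {W : PairSp d n → ℂ} {Ψ : (Fin n → ℝ) → ℂ}

theorem integrable_prod_bilInt (hWi : Integrable Wh) (hPi : Integrable Ph)
    (B : Fin n → Fin d → ℤ × ℤ) :
    Integrable fun p : PairSp d n × (Fin n → ℝ) => Wh p.1 * (Ph p.2 *
      ∏ j, ∏ i, bilInt (c * p.2 j) (p.1.1 j i) (p.1.2 j i) (B j i).1 (B j i).2) := by
  refine (integrable_bridge (c := c) hWi hPi B).integral_prod_right.congr
    (Filter.Eventually.of_forall fun p => ?_)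
  simp only
  rw [integral_const_mul, integral_const_mul, integral_boxKer]

theorem integrable_prod_bilSum (hWi : Integrable Wh) (hPi : Integrable Ph)
    (B : Fin n → Fin d → ℤ × ℤ) :
    Integrable fun p : PairSp d n × (Fin n → ℝ) => Wh p.1 * (Ph p.2 *
      ∏ j, ∏ i, bilSum L (c * p.2 j) (p.1.1 j i) (p.1.2 j i) (B j i).1 (B j i).2 / L ^ 2) := by
  have h := (integrable_finsetSum (boxCodes L B) fun m _ =>
    integrable_bridge_left (c := c) hWi hPi B (latPt L m)).const_mul ((((L : ℂ) ^ 2) ^ (d * n))⁻¹)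
  refine h.congr (Filter.Eventually.of_forall fun p => ?_)
  simp only [Finset.prod_div_distrib, Finset.prod_const, Finset.card_univ, Fintype.card_fin]
  rw [← Finset.mul_sum, ← Finset.mul_sum, sum_boxKer, ← pow_mul]
  ring

theorem norm_box_error_le (hd : 3 ≤ d) (hL : 1 ≤ L) (hc : 0 < c) (hcL : c ≤ L ^ 2)
    (hT : T = c * M / L ^ 2) (hT0 : 0 ≤ T) (hR0 : 0 ≤ R) (hR1 : R ≤ 1)
    (hR : ∫⁻ s, weylR d L T s ≤ ENNReal.ofReal R)
    {a b : ℝ} (ha : 0 ≤ a) (hb : 0 ≤ b) (hPi : Integrable Ph)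
    (hP : ∀ τ, ‖Ph τ‖ₑ ≤ ENNReal.ofReal b * ∏ j, vMaj L M (τ j))
    (hWm : Measurable Wh) (hWa : ∫⁻ ζ, ‖Wh ζ‖ₑ ≤ ENNReal.ofReal a)
    (hW1 : ∀ j i, ∫⁻ ζ, ‖Wh ζ‖ₑ * ENNReal.ofReal |ζ.1 j i| ≤ ENNReal.ofReal a)
    (hW2 : ∀ j i, ∫⁻ ζ, ‖Wh ζ‖ₑ * ENNReal.ofReal |ζ.2 j i| ≤ ENNReal.ofReal a)
    (hW : ∀ z, W z = ∫ ζ, Wh ζ * efun (pairingV d n z ζ))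
    (hΨ : ∀ Ω, Ψ Ω = ∫ τ, Ph τ * efun (∑ j, τ j * Ω j)) (B : Fin n → Fin d → ℤ × ℤ) :
    ‖(∑ m ∈ boxCodes L B, (boxBump B (latPt L m) : ℂ) *
        (W (latPt L m) * Ψ fun j => c * ⟪(latPt L m).1 j, (latPt L m).2 j⟫)) -
      (((L ^ 2) ^ (d * n) : ℝ) : ℂ) *
        ∫ z, (boxBump B z : ℂ) * (W z * Ψ fun j => c * ⟪z.1 j, z.2 j⟫)‖ ≤
    (L ^ 2) ^ (d * n) * (a * b * (diffC d * c⁻¹) ^ n * (n * (R + 3 * d / L))) := by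
  have hL0 : L ≠ 0 := by positivity
  have hWi : Integrable Wh := ⟨hWm.aestronglyMeasurable, hWa.trans_lt ENNReal.ofReal_lt_top⟩
  have hD := diffC_pos d
  have hc' : 0 < c⁻¹ := inv_pos.2 hc
  rw [sum_localised hWi hPi hW hΨ, integral_localised hWi hPi hW hΨ]
  have h1 : (∫ p : PairSp d n × (Fin n → ℝ), Wh p.1 * (Ph p.2 *
      ∏ j, ∏ i, bilSum L (c * p.2 j) (p.1.1 j i) (p.1.2 j i) (B j i).1 (B j i).2)) =
      (((L ^ 2) ^ (d * n) : ℝ) : ℂ) * ∫ p : PairSp d n × (Fin n → ℝ), Wh p.1 * (Ph p.2 *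
      ∏ j, ∏ i, bilSum L (c * p.2 j) (p.1.1 j i) (p.1.2 j i) (B j i).1 (B j i).2 / L ^ 2) := by
    rw [← integral_const_mul]
    refine integral_congr_ae (Filter.Eventually.of_forall fun p => ?_)
    have : (L : ℂ) ≠ 0 := by exact_mod_cast hL0
    simp only [Finset.prod_div_distrib, Finset.prod_const, Finset.card_univ, Fintype.card_fin]
    rw [← pow_mul (_ ^ 2) d n]
    push_cast
    field_simp
  rw [h1, ← mul_sub, ← integral_sub (integrable_prod_bilSum hWi hPi B)
    (integrable_prod_bilInt hWi hPi B), norm_mul, Complex.norm_real, Real.norm_eq_abs,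
    abs_of_nonneg (by positivity)]
  gcongr
  refine (congrArg norm (integral_prod_volume _ ((integrable_prod_bilSum (c := c) (L := L)
    hWi hPi B).sub (integrable_prod_bilInt hWi hPi B)))).trans_le ?_
  simp_rw [Pi.sub_apply, ← mul_sub, integral_const_mul]
  have h2 := enorm_box_total_le hd hL hc hcL hT hT0 hR0 hR1 hR ha hb hP hWm hWa hW1 hW2 B
  rw [← ofReal_norm] at h2
  exact (ENNReal.ofReal_le_ofReal_iff (by positivity)).1 h2

end boxError

theorem pi_inversion {ι : Type*} [Fintype ι] {f : (ι → ℝ) → ℂ} (hc : Continuous f)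
    (hi : Integrable f)
    (hF : Integrable fun τ : ι → ℝ => ∫ x : ι → ℝ, f x * efun (-∑ k, τ k * x k)) (x : ι → ℝ) :
    f x = ∫ τ : ι → ℝ, (∫ y : ι → ℝ, f y * efun (-∑ k, τ k * y k)) * efun (∑ k, τ k * x k) := by
  have hmp := PiLp.volume_preserving_ofLp ι
  set e : EuclideanSpace ℝ ι ≃ᵐ (ι → ℝ) := (MeasurableEquiv.toLp 2 (ι → ℝ)).symm with he
  have hmp' : MeasurePreserving e := hmp
  set g : EuclideanSpace ℝ ι → ℂ := fun v => f (e v) with hg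
  have hgc : Continuous g := hc.comp (PiLp.continuous_ofLp 2 _)
  have hgi : Integrable g := (hmp'.integrable_comp_emb e.measurableEmbedding).2 hi
  have hft : ∀ w, FourierTransform.fourier g w =
      (fun τ : ι → ℝ => ∫ x : ι → ℝ, f x * efun (-∑ k, τ k * x k)) (e w) := by
    intro w
    rw [Real.fourier_eq]
    simp only
    rw [← hmp'.integral_comp' (f := e)]
    refine integral_congr_ae (Filter.Eventually.of_forall fun v => ?_)
    simp only [PiLp.inner_apply, Circle.smul_def, smul_eq_mul, efun_eq_fourierChar, hg]
    rw [mul_comm]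
    congr 4
  have hgF : Integrable (FourierTransform.fourier g) := by
    rw [show FourierTransform.fourier g = (fun τ : ι → ℝ => ∫ x : ι → ℝ,
      f x * efun (-∑ k, τ k * x k)) ∘ e from funext hft]
    exact (hmp'.integrable_comp_emb e.measurableEmbedding).2 hF
  have h := congrFun (hgc.fourierInv_fourier_eq hgi hgF) (e.symm x)
  rw [Real.fourierInv_eq] at h
  simp only [hg, MeasurableEquiv.apply_symm_apply] at h
  rw [← h, ← hmp'.integral_comp' (f := e)]
  refine integral_congr_ae (Filter.Eventually.of_forall fun v => ?_)
  have := hft v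
  simp only [hg] at this
  simp only
  rw [this, Circle.smul_def, smul_eq_mul, mul_comm, efun_eq_fourierChar]
  congr 3
  rw [PiLp.inner_apply]
  exact congrArg _ (funext fun k => mul_comm _ _)

theorem measurePreserving_curry (ι κ X : Type*) [Fintype ι] [Fintype κ] [MeasureSpace X]
    [SigmaFinite (volume : Measure X)] :
    MeasurePreserving (MeasurableEquiv.curry ι κ X) := by
  have h : MeasurePreserving (MeasurableEquiv.curry ι κ X).symm := by
    refine ⟨(MeasurableEquiv.curry ι κ X).symm.measurable, ?_⟩
    symm
    refine Measure.pi_eq fun s hs => ?_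
    rw [MeasurableEquiv.map_apply]
    have : (MeasurableEquiv.curry ι κ X).symm ⁻¹' (Set.univ.pi s) =
        Set.univ.pi fun i => Set.univ.pi fun k => s (i, k) := by
      ext v
      simp [MeasurableEquiv.curry, Set.mem_pi]
    rw [this, volume_pi_pi]
    simp_rw [volume_pi_pi]
    rw [Fintype.prod_prod_type]
  exact h.symm

/-- All the coordinates of a pair of tuples of vectors, as a single tuple. -/
def flatten (d n : ℕ) : ((Fin n × Fin d × Fin 2) → ℝ) ≃ᵐ PairSp d n :=
  ((MeasurableEquiv.curry (Fin n) (Fin d × Fin 2) ℝ).trans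
    (MeasurableEquiv.piCongrRight fun _ =>
      (MeasurableEquiv.curry (Fin d) (Fin 2) ℝ).trans
        (MeasurableEquiv.piCongrRight fun _ => MeasurableEquiv.finTwoArrow))).trans (unflat d n)

theorem measurePreserving_flatten (d n : ℕ) : MeasurePreserving (flatten d n) := by
  have h2 : MeasurePreserving ((MeasurableEquiv.curry (Fin d) (Fin 2) ℝ).trans
        (MeasurableEquiv.piCongrRight fun _ => MeasurableEquiv.finTwoArrow)) :=
    (volume_preserving_pi fun _ : Fin d => volume_preserving_finTwoArrow ℝ).comp
      (measurePreserving_curry _ _ _)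
  exact (measurePreserving_unflat d n).comp
    ((volume_preserving_pi fun _ : Fin n => h2).comp (measurePreserving_curry _ _ _))

theorem continuous_flatten (d n : ℕ) : Continuous (flatten d n) := by
  have : (flatten d n : (Fin n × Fin d × Fin 2 → ℝ) → PairSp d n) = fun v =>
      (fun j => WithLp.toLp 2 fun i => v (j, i, 0), fun j => WithLp.toLp 2 fun i => v (j, i, 1)) :=
    rfl
  rw [this]
  fun_prop

theorem pairingV_flatten (d n : ℕ) (v w : Fin n × Fin d × Fin 2 → ℝ) :
    pairingV d n (flatten d n v) (flatten d n w) = ∑ k, w k * v k := by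
  rw [pairingV_eq_sum, Fintype.sum_prod_type]
  refine Finset.sum_congr rfl fun j _ => ?_
  rw [Fintype.sum_prod_type]
  refine Finset.sum_congr rfl fun i _ => ?_
  rw [Fin.sum_univ_two]
  rfl

theorem pairSp_inversion {d n : ℕ} {W : PairSp d n → ℂ} (hc : Continuous W) (hi : Integrable W)
    (hF : Integrable (ftV d n W)) (z : PairSp d n) :
    W z = ∫ ζ, ftV d n W ζ * efun (pairingV d n z ζ) := by
  have hmp := measurePreserving_flatten d n
  have hft : ∀ τ, ftV d n W (flatten d n τ) =
      ∫ x, (W ∘ flatten d n) x * efun (-∑ k, τ k * x k) := by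
    intro τ
    rw [ftV, ← hmp.integral_comp' (f := flatten d n)]
    simp_rw [pairingV_flatten]
    rfl
  have h := pi_inversion (f := W ∘ flatten d n) (hc.comp (continuous_flatten d n))
    ((hmp.integrable_comp_emb (flatten d n).measurableEmbedding).2 hi) (by
      simp_rw [← hft]
      exact (hmp.integrable_comp_emb (flatten d n).measurableEmbedding).2 hF)
      ((flatten d n).symm z)
  simp_rw [← hft] at h
  simp only [Function.comp_apply, MeasurableEquiv.apply_symm_apply] at h
  rw [h, ← hmp.integral_comp' (f := flatten d n)]
  refine integral_congr_ae (Filter.Eventually.of_forall fun v => ?_)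
  simp only
  rw [← pairingV_flatten, MeasurableEquiv.apply_symm_apply]

theorem continuous_ftV {d n : ℕ} {W : PairSp d n → ℂ} (hi : Integrable W) :
    Continuous (ftV d n W) := by
  unfold ftV
  refine continuous_of_dominated (bound := fun z => ‖W z‖) ?_ ?_ hi.norm ?_
  · intro ζ
    refine hi.aestronglyMeasurable.mul (Continuous.aestronglyMeasurable ?_)
    exact continuous_efun.comp (continuous_pairingV.comp (by fun_prop : Continuous
      fun z : PairSp d n => (z, ζ))).neg
  · intro ζ
    refine Filter.Eventually.of_forall fun z => ?_
    rw [norm_mul, norm_efun, mul_one]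
  · refine Filter.Eventually.of_forall fun z => ?_
    refine continuous_const.mul (continuous_efun.comp (continuous_pairingV.comp (by fun_prop :
      Continuous fun ζ : PairSp d n => (z, ζ))).neg)

theorem hasDerivAt_efun (t : ℝ) : HasDerivAt efun (2 * Real.pi * Complex.I * efun t) t := by
  have h : HasDerivAt (fun t : ℝ => 2 * (Real.pi : ℂ) * Complex.I * (t : ℂ))
      (2 * Real.pi * Complex.I) t := by
    simpa using (Complex.ofRealCLM.hasDerivAt (x := t)).const_mul (2 * (Real.pi : ℂ) * Complex.I)
  have := h.cexp
  rwa [mul_comm (Complex.exp _)] at this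

theorem integral_fderiv_mul_efun {E : Type*} [NormedAddCommGroup E] [NormedSpace ℝ E]
    [FiniteDimensional ℝ E] [MeasurableSpace E] [BorelSpace E] {μ : Measure E} [μ.IsAddHaarMeasure]
    {f : E → ℂ} (v : E) (ℓ : E →L[ℝ] ℝ) (hf : Differentiable ℝ f) (hi : Integrable f μ)
    (hi' : Integrable (fun x => fderiv ℝ f x v) μ) :
    ∫ x, fderiv ℝ f x v * efun (-ℓ x) ∂μ =
      (2 * Real.pi * Complex.I * ℓ v) * ∫ x, f x * efun (-ℓ x) ∂μ := by
  have hg : ∀ x, HasFDerivAt (fun x => efun (-ℓ x))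
      (ContinuousLinearMap.smulRight (-ℓ) (2 * Real.pi * Complex.I * efun (-ℓ x))) x := by
    intro x
    have := (hasDerivAt_efun (-ℓ x)).hasFDerivAt.comp x (-ℓ).hasFDerivAt
    refine HasFDerivAt.congr_fderiv this (ContinuousLinearMap.ext fun y => ?_)
    simp
  have hg' : ∀ x, fderiv ℝ (fun x => efun (-ℓ x)) x v =
      -(2 * Real.pi * Complex.I * ℓ v) * efun (-ℓ x) := by
    intro x
    rw [(hg x).fderiv]
    simp
    ring
  have hgc : Continuous fun x => efun (-ℓ x) := by fun_prop
  have key : ∀ F : E → ℂ, Integrable F μ → Integrable (fun x => F x * efun (-ℓ x)) μ :=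
    fun F hF => hF.mul_bdd (c := 1) hgc.aestronglyMeasurable
      (Filter.Eventually.of_forall fun x => (norm_efun _).le)
  have h := integral_mul_fderiv_eq_neg_fderiv_mul_of_integrable (μ := μ) (f := f)
    (g := fun x => efun (-ℓ x)) (v := v) (key _ hi') (by
      simp_rw [hg']
      refine ((key f hi).const_mul (-(2 * Real.pi * Complex.I * ℓ v))).congr
        (Filter.Eventually.of_forall fun x => ?_)
      simp only
      ring) (key _ hi) (fun x _ => hf x) (fun x _ => (hg x).differentiableAt)
  rw [← neg_eq_iff_eq_neg.2 h, ← integral_neg, ← integral_const_mul]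
  refine integral_congr_ae (Filter.Eventually.of_forall fun x => ?_)
  simp only
  rw [hg']
  ring

/-- The pairing as a continuous linear functional. -/
def pairingCLM {d n : ℕ} (ζ : PairSp d n) : PairSp d n →L[ℝ] ℝ :=
  LinearMap.toContinuousLinearMap
    { toFun := fun z => pairingV d n z ζ
      map_add' := fun z w => by
        simp only [pairingV, Prod.fst_add, Prod.snd_add, Pi.add_apply, inner_add_left,
          Finset.sum_add_distrib]
        ring
      map_smul' := fun c z => by
        simp only [pairingV, Prod.smul_fst, Prod.smul_snd, Pi.smul_apply, real_inner_smul_left,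
          ← Finset.mul_sum, RingHom.id_apply, smul_eq_mul]
        ring }

theorem isAddHaarMeasure_pairSp (d n : ℕ) :
    (volume : Measure (PairSp d n)).IsAddHaarMeasure :=
  Measure.prod.instIsAddHaarMeasure (volume : Measure (Fin n → EuclideanSpace ℝ (Fin d)))
    (volume : Measure (Fin n → EuclideanSpace ℝ (Fin d)))

theorem ftV_fderiv {d n : ℕ} {W : PairSp d n → ℂ} (hW : ContDiff ℝ 1 W)
    (hs : HasCompactSupport W) (v ζ : PairSp d n) :
    ftV d n (fun z => fderiv ℝ W z v) ζ =
      (2 * Real.pi * Complex.I * pairingV d n v ζ) * ftV d n W ζ := by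
  have hc : Continuous fun z => fderiv ℝ W z v :=
    (hW.continuous_fderiv one_ne_zero).clm_apply continuous_const
  have := isAddHaarMeasure_pairSp d n
  exact integral_fderiv_mul_efun (μ := volume) v (pairingCLM ζ) (hW.differentiable one_ne_zero)
    (hW.continuous.integrable_of_hasCompactSupport hs)
    (hc.integrable_of_hasCompactSupport (hs.fderiv_apply ℝ v))

theorem lintegral_ftV_mul_coord {d n : ℕ} {W : PairSp d n → ℂ} (hW : ContDiff ℝ 1 W)
    (hs : HasCompactSupport W) (v : PairSp d n) (r : PairSp d n → ℝ)
    (hr : ∀ ζ, pairingV d n v ζ = r ζ) {a : ℝ}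
    (h : ∫⁻ ζ, (‖ftV d n (fun z => fderiv ℝ W z v) ζ‖₊ : ℝ≥0∞) ≤ ENNReal.ofReal a) :
    ∫⁻ ζ, ‖ftV d n W ζ‖ₑ * ENNReal.ofReal |r ζ| ≤ ENNReal.ofReal a := by
  refine (lintegral_mono fun ζ => ?_).trans h
  rw [ftV_fderiv hW hs, hr]
  change _ ≤ ‖(2 * Real.pi * Complex.I * r ζ) * ftV d n W ζ‖ₑ
  rw [enorm_mul, mul_comm, enorm_mul]
  gcongr
  rw [show ENNReal.ofReal |r ζ| = 1 * ENNReal.ofReal |r ζ| by rw [one_mul]]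
  refine mul_le_mul' ?_ ?_
  · rw [← ofReal_norm, ← ENNReal.ofReal_one]
    refine ENNReal.ofReal_le_ofReal ?_
    simp [abs_of_pos Real.pi_pos]
    linarith [Real.pi_gt_three]
  · rw [← ofReal_norm, Complex.norm_real, Real.norm_eq_abs]

theorem pairingV_single_fst {d n : ℕ} (j : Fin n) (i : Fin d) (ζ : PairSp d n) :
    pairingV d n (Pi.single j (EuclideanSpace.single i (1 : ℝ)), 0) ζ = ζ.1 j i := by
  rw [pairingV, Finset.sum_eq_single j (fun k _ hk => by simp [hk]) (by simp)]
  simp [EuclideanSpace.inner_single_left]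

theorem pairingV_single_snd {d n : ℕ} (j : Fin n) (i : Fin d) (ζ : PairSp d n) :
    pairingV d n (0, Pi.single j (EuclideanSpace.single i (1 : ℝ))) ζ = ζ.2 j i := by
  rw [pairingV, add_comm, Finset.sum_eq_single j (fun k _ hk => by simp [hk]) (by simp)]
  simp [EuclideanSpace.inner_single_left]

/-- The kernel expressing `(1 - e(σu))/u` as a superposition of the characters `e(τu)`. -/
def primKer (τ σ : ℝ) : ℂ :=
  if 0 < τ ∧ τ ≤ σ then -(2 * Real.pi * Complex.I)
  else if σ < τ ∧ τ ≤ 0 then 2 * Real.pi * Complex.I else 0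

theorem measurable_primKer : Measurable fun p : ℝ × ℝ => primKer p.1 p.2 := by
  unfold primKer
  refine Measurable.ite ?_ measurable_const (Measurable.ite ?_ measurable_const measurable_const)
  · exact (measurableSet_lt measurable_const measurable_fst).inter
      (measurableSet_le measurable_fst measurable_snd)
  · exact (measurableSet_lt measurable_snd measurable_fst).inter
      (measurableSet_le measurable_fst measurable_const)

theorem norm_primKer_le (τ σ : ℝ) : ‖primKer τ σ‖ ≤ 2 * Real.pi := by
  have := Real.pi_pos
  unfold primKer
  split_ifs <;> simp [abs_of_pos Real.pi_pos, this.le]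

theorem primKer_eq_zero {τ σ : ℝ} (h : |σ| < |τ|) : primKer τ σ = 0 := by
  unfold primKer
  rw [if_neg, if_neg]
  · rintro ⟨h1, h2⟩
    rw [abs_of_nonpos h2, abs_of_nonpos (h1.le.trans h2)] at h
    linarith
  · rintro ⟨h1, h2⟩
    rw [abs_of_pos h1, abs_of_pos (h1.trans_le h2)] at h
    linarith

theorem integral_primKer_mul (σ : ℝ) {u : ℝ} (hu : u ≠ 0) :
    ∫ τ, primKer τ σ * efun (τ * u) = (1 - efun (σ * u)) / u := by
  have hc : (2 * Real.pi * Complex.I * u : ℂ) ≠ 0 := by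
    simp [Real.pi_ne_zero, hu]
  have h1 : ∫ τ in (0 : ℝ)..σ, efun (τ * u) =
      (efun (σ * u) - 1) / (2 * Real.pi * Complex.I * u) := by
    have := integral_exp_mul_complex (a := 0) (b := σ) hc
    rw [show efun (σ * u) = Complex.exp (2 * Real.pi * Complex.I * u * σ) by
      unfold efun; congr 1; push_cast; ring]
    simp only [Complex.ofReal_zero, mul_zero, Complex.exp_zero] at this
    rw [← this]
    refine intervalIntegral.integral_congr fun τ _ => ?_
    simp only [efun]
    congr 1
    push_cast
    ring
  have h2 : ∫ τ, primKer τ σ * efun (τ * u) =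
      -(2 * Real.pi * Complex.I) * ∫ τ in (0 : ℝ)..σ, efun (τ * u) := by
    rcases le_total 0 σ with h | h
    · rw [intervalIntegral.integral_of_le h, ← integral_const_mul,
        ← integral_indicator measurableSet_Ioc]
      refine integral_congr_ae (Filter.Eventually.of_forall fun τ => ?_)
      simp only [primKer, Set.indicator, Set.mem_Ioc]
      by_cases h3 : 0 < τ ∧ τ ≤ σ
      · rw [if_pos h3, if_pos h3]
      · rw [if_neg h3, if_neg h3, if_neg (fun h4 => by linarith [h4.1, h4.2]), zero_mul]
    · rw [intervalIntegral.integral_of_ge h, mul_neg, ← neg_mul, neg_neg, ← integral_const_mul,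
        ← integral_indicator measurableSet_Ioc]
      refine integral_congr_ae (Filter.Eventually.of_forall fun τ => ?_)
      simp only [primKer, Set.indicator, Set.mem_Ioc]
      rw [if_neg (fun h4 : 0 < τ ∧ τ ≤ σ => by linarith [h4.1, h4.2])]
      by_cases h3 : σ < τ ∧ τ ≤ 0
      · rw [if_pos h3, if_pos h3]
      · rw [if_neg h3, if_neg h3, zero_mul]
  rw [h2, h1]
  have : (u : ℂ) ≠ 0 := by exact_mod_cast hu
  have hp : (Real.pi : ℂ) ≠ 0 := by exact_mod_cast Real.pi_ne_zero
  field_simp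
  ring

section recip

variable {φ : ℝ → ℂ}

/-- The Fourier density of `(φ̌(0) - φ̌(u))/u`. -/
def recipDensity (φ : ℝ → ℂ) (τ : ℝ) : ℂ := ∫ σ, φ σ * primKer τ σ

theorem norm_mul_primKer_le {k : ℕ} {C : ℝ} (hC : ∀ θ, ‖φ θ‖ ≤ C / (1 + |θ|) ^ (k + 2))
    (hC0 : 0 ≤ C) (τ σ : ℝ) :
    ‖φ σ * primKer τ σ‖ ≤ 2 * Real.pi * C / (1 + |τ|) ^ k * (1 + σ ^ 2)⁻¹ := by
  have hpi := Real.pi_pos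
  have hτ : 0 < 1 + |τ| := by positivity
  have hσ : 0 < 1 + |σ| := by positivity
  rcases lt_or_ge |σ| |τ| with h | h
  · rw [primKer_eq_zero h, mul_zero, norm_zero]
    positivity
  · rw [norm_mul]
    calc ‖φ σ‖ * ‖primKer τ σ‖ ≤ C / (1 + |σ|) ^ (k + 2) * (2 * Real.pi) := by
          gcongr
          exacts [hC σ, norm_primKer_le τ σ]
      _ = 2 * Real.pi * C / (1 + |σ|) ^ k * ((1 + |σ|) ^ 2)⁻¹ := by
          rw [pow_add]
          field_simp
      _ ≤ 2 * Real.pi * C / (1 + |τ|) ^ k * (1 + σ ^ 2)⁻¹ := by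
          gcongr
          nlinarith [abs_nonneg σ, sq_abs σ]

theorem measurable_recipDensity (hφ : Continuous φ) : Measurable (recipDensity φ) := by
  have h : Measurable fun p : ℝ × ℝ => φ p.2 * primKer p.1 p.2 :=
    (hφ.measurable.comp measurable_snd).mul measurable_primKer
  exact (h.stronglyMeasurable.integral_prod_right (ν := volume)).measurable

theorem norm_recipDensity_le {k : ℕ} {C : ℝ} (hC : ∀ θ, ‖φ θ‖ ≤ C / (1 + |θ|) ^ (k + 2))
    (hC0 : 0 ≤ C) (τ : ℝ) :
    ‖recipDensity φ τ‖ ≤ 2 * Real.pi ^ 2 * C / (1 + |τ|) ^ k := by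
  refine (norm_integral_le_of_norm_le (integrable_inv_one_add_sq.const_mul _)
    (Filter.Eventually.of_forall fun σ => norm_mul_primKer_le hC hC0 τ σ)).trans_eq ?_
  rw [integral_const_mul, integral_univ_inv_one_add_sq]
  ring

theorem integrable_recip_aux (hφ : Continuous φ) {C : ℝ}
    (hC : ∀ θ, ‖φ θ‖ ≤ C / (1 + |θ|) ^ (2 + 2)) (hC0 : 0 ≤ C) :
    Integrable fun p : ℝ × ℝ => φ p.2 * primKer p.1 p.2 := by
  have h1 : Integrable fun p : ℝ × ℝ => (1 + p.1 ^ 2)⁻¹ * (1 + p.2 ^ 2)⁻¹ :=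
    integrable_inv_one_add_sq.mul_prod integrable_inv_one_add_sq
  refine (h1.const_mul (2 * Real.pi * C)).mono'
    ((hφ.measurable.comp measurable_snd).mul measurable_primKer).aestronglyMeasurable
    (Filter.Eventually.of_forall fun p => ?_)
  refine (norm_mul_primKer_le hC hC0 p.1 p.2).trans ?_
  rw [← mul_assoc, div_eq_mul_inv]
  have := Real.pi_pos
  gcongr
  nlinarith [abs_nonneg p.1, sq_abs p.1]

theorem integrable_recipDensity (hφ : Continuous φ) {C : ℝ}
    (hC : ∀ θ, ‖φ θ‖ ≤ C / (1 + |θ|) ^ (2 + 2)) (hC0 : 0 ≤ C) :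
    Integrable (recipDensity φ) :=
  (integrable_recip_aux hφ hC hC0).integral_prod_left

theorem integral_recipDensity_mul (hφ : Continuous φ) {C : ℝ}
    (hC : ∀ θ, ‖φ θ‖ ≤ C / (1 + |θ|) ^ (2 + 2)) (hC0 : 0 ≤ C) {u : ℝ} (hu : u ≠ 0) :
    ∫ τ, recipDensity φ τ * efun (τ * u) = ((∫ σ, φ σ) - ∫ σ, φ σ * efun (σ * u)) / u := by
  have hi := integrable_recip_aux hφ hC hC0
  have hi2 : Integrable fun p : ℝ × ℝ => φ p.2 * primKer p.1 p.2 * efun (p.1 * u) :=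
    hi.mul_bdd (c := 1) (by fun_prop) (Filter.Eventually.of_forall fun p => (norm_efun _).le)
  have hφi : Integrable φ := by
    refine (integrable_inv_one_add_sq.const_mul C).mono' hφ.aestronglyMeasurable
      (Filter.Eventually.of_forall fun σ => (hC σ).trans ?_)
    rw [div_eq_mul_inv]
    gcongr
    have h1 : 1 + σ ^ 2 ≤ (1 + |σ|) ^ 2 := by nlinarith [abs_nonneg σ, sq_abs σ]
    exact h1.trans (pow_le_pow_right₀ (by linarith [abs_nonneg σ]) (by norm_num))
  have hφe : Integrable fun σ => φ σ * efun (σ * u) :=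
    hφi.mul_bdd (c := 1) (by fun_prop) (Filter.Eventually.of_forall fun p => (norm_efun _).le)
  simp_rw [recipDensity, ← integral_mul_const]
  rw [integral_swap_volume (fun p : ℝ × ℝ => φ p.2 * primKer p.1 p.2 * efun (p.1 * u)) hi2,
    ← integral_sub hφi hφe, ← integral_div]
  refine integral_congr_ae (Filter.Eventually.of_forall fun σ => ?_)
  simp only
  simp_rw [mul_assoc]
  rw [integral_const_mul, integral_primKer_mul σ hu]
  ring

end recip

theorem exists_recip_density {χ₀ : ℝ → ℝ} (hχs : ContDiff ℝ (⊤ : ℕ∞) χ₀)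
    (hχ1 : ∀ z : ℝ, |z| ≤ 1 / 2 → χ₀ z = 1) (hχ0 : ∀ z : ℝ, 1 ≤ |z| → χ₀ z = 0) :
    ∃ g : ℝ → ℂ, Measurable g ∧ Integrable g ∧
      (∀ k : ℕ, ∃ C : ℝ, 1 ≤ C ∧ ∀ τ, ‖g τ‖ ≤ C / (1 + |τ|) ^ k) ∧
      ∀ u, (((1 - χ₀ u) / u : ℝ) : ℂ) = ∫ τ, g τ * efun (τ * u) := by
  have hcs : HasCompactSupport fun u => ((χ₀ u : ℝ) : ℂ) := by
    refine HasCompactSupport.intro (isCompact_Icc (a := (-1 : ℝ)) (b := 1)) fun x hx => ?_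
    rw [hχ0 x, Complex.ofReal_zero]
    by_contra! h
    exact hx (abs_le.1 h.le)
  have hsm : ContDiff ℝ (⊤ : ℕ∞) fun u => ((χ₀ u : ℝ) : ℂ) :=
    Complex.ofRealCLM.contDiff.comp hχs
  let F : SchwartzMap ℝ ℂ := hcs.toSchwartzMap hsm
  have hF : ∀ u, F u = ((χ₀ u : ℝ) : ℂ) := fun u => rfl
  set φ : ℝ → ℂ := FourierTransform.fourier (F : ℝ → ℂ) with hφ
  have hφS : φ = (FourierTransform.fourier F : SchwartzMap ℝ ℂ) := (SchwartzMap.fourier_coe F).symm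
  have hφc : Continuous φ := by rw [hφS]; exact SchwartzMap.continuous _
  have hφi : Integrable φ := by rw [hφS]; exact SchwartzMap.integrable _
  have hinv : ∀ u, ((χ₀ u : ℝ) : ℂ) = ∫ σ, φ σ * efun (σ * u) := by
    intro u
    have := congrFun (F.continuous.fourierInv_fourier_eq F.integrable hφi) u
    rw [← hF, ← this, Real.fourierInv_eq]
    refine integral_congr_ae (Filter.Eventually.of_forall fun σ => ?_)
    simp [Circle.smul_def, efun_eq_fourierChar, mul_comm, hφ]
  have hdec : ∀ k : ℕ, ∃ C ≥ (1 : ℝ), ∀ θ, ‖φ θ‖ ≤ C / (1 + |θ|) ^ k :=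
    fun k => schwartz_fourier_decay F k
  obtain ⟨C4, hC4, hC4'⟩ := hdec 4
  have hgi := integrable_recipDensity hφc hC4' (by linarith)
  refine ⟨recipDensity φ, measurable_recipDensity hφc, hgi, ?_, ?_⟩
  · intro k
    obtain ⟨C, hC, hC'⟩ := hdec (k + 2)
    refine ⟨2 * Real.pi ^ 2 * C, ?_, fun τ => norm_recipDensity_le hC' (by linarith) τ⟩
    nlinarith [Real.pi_gt_three]
  · have hne : ∀ u, u ≠ 0 → (((1 - χ₀ u) / u : ℝ) : ℂ) = ∫ τ, recipDensity φ τ * efun (τ * u) := by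
      intro u hu
      rw [integral_recipDensity_mul hφc hC4' (by linarith) hu, ← hinv u]
      have h0 := hinv 0
      simp only [mul_zero, efun_zero, mul_one] at h0
      rw [← h0, hχ1 0 (by simp)]
      push_cast
      ring
    intro u
    rcases eq_or_ne u 0 with rfl | hu
    · simp only [div_zero, Complex.ofReal_zero]
      have hcont : Continuous fun u : ℝ => ∫ τ, recipDensity φ τ * efun (τ * u) := by
        refine continuous_of_dominated (bound := fun τ => ‖recipDensity φ τ‖) ?_ ?_ hgi.norm ?_
        · exact fun u => hgi.aestronglyMeasurable.mul (by fun_prop)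
        · exact fun u => Filter.Eventually.of_forall fun τ => by rw [norm_mul, norm_efun, mul_one]
        · exact Filter.Eventually.of_forall fun τ => by fun_prop
      have h1 : Filter.Tendsto (fun u : ℝ => ∫ τ, recipDensity φ τ * efun (τ * u))
          (nhdsWithin 0 {0}ᶜ) (nhds 0) := by
        refine tendsto_const_nhds.congr' ?_
        have : {u : ℝ | |u| < 1 / 2} ∈ nhds (0 : ℝ) :=
          (isOpen_lt continuous_abs continuous_const).mem_nhds (by simp)
        filter_upwards [mem_nhdsWithin_of_mem_nhds this, self_mem_nhdsWithin] with v hv hv0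
        rw [← hne v hv0, hχ1 v (le_of_lt hv)]
        simp
      exact tendsto_nhds_unique h1 ((hcont.tendsto 0).mono_left nhdsWithin_le_nhds)
    · exact hne u hu

section piFourier

variable {ι : Type*} [Fintype ι] {f : (ι → ℝ) → ℂ}

/-- The Fourier transform on `ℝ^ι`. -/
def piFt (f : (ι → ℝ) → ℂ) (τ : ι → ℝ) : ℂ := ∫ x : ι → ℝ, f x * efun (-∑ k, τ k * x k)

/-- The standard pairing with a fixed vector, as a continuous linear functional. -/
def piPair (τ : ι → ℝ) : (ι → ℝ) →L[ℝ] ℝ := ∑ k, τ k • ContinuousLinearMap.proj k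

theorem piPair_apply (τ x : ι → ℝ) : piPair τ x = ∑ k, τ k * x k := by
  simp [piPair]

theorem continuous_piFt (hi : Integrable f) : Continuous (piFt f) := by
  unfold piFt
  refine continuous_of_dominated (bound := fun z => ‖f z‖) ?_ ?_ hi.norm ?_
  · exact fun τ => hi.aestronglyMeasurable.mul
      (Continuous.aestronglyMeasurable (by fun_prop))
  · exact fun τ => Filter.Eventually.of_forall fun z => by rw [norm_mul, norm_efun, mul_one]
  · exact Filter.Eventually.of_forall fun z => by fun_prop

theorem norm_piFt_le (f : (ι → ℝ) → ℂ) {b : ℝ} (hb : 0 ≤ b)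
    (h : ∫⁻ x, (‖f x‖₊ : ℝ≥0∞) ≤ ENNReal.ofReal b) (τ : ι → ℝ) : ‖piFt f τ‖ ≤ b := by
  rw [← ENNReal.ofReal_le_ofReal_iff hb, ofReal_norm]
  refine (enorm_integral_le_lintegral_enorm _).trans (le_trans (le_of_eq ?_) h)
  refine lintegral_congr fun x => ?_
  rw [enorm_mul, enorm_efun, mul_one]
  rfl

theorem pderivList_replicate_succ (m : ℕ) (v : ι → ℝ) (f : (ι → ℝ) → ℂ) :
    pderivList (List.replicate (m + 1) v) f =
      fun x => fderiv ℝ (pderivList (List.replicate m v) f) x v := rfl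

theorem contDiff_pderivList (m : ℕ) (v : ι → ℝ) (hf : ContDiff ℝ (⊤ : ℕ∞) f) :
    ContDiff ℝ (⊤ : ℕ∞) (pderivList (List.replicate m v) f) := by
  induction m with
  | zero => exact hf
  | succ m ih =>
    rw [pderivList_replicate_succ]
    exact (ih.fderiv_right (m := (⊤ : ℕ∞)) (by simp)).clm_apply contDiff_const

theorem piFt_pderivList [DecidableEq ι] (hf : ContDiff ℝ (⊤ : ℕ∞) f) (j : ι)
    (hi : ∀ m, Integrable (pderivList (List.replicate m (Pi.single j (1 : ℝ))) f)) (m : ℕ)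
    (τ : ι → ℝ) :
    piFt (pderivList (List.replicate m (Pi.single j (1 : ℝ))) f) τ =
      (2 * Real.pi * Complex.I * τ j) ^ m * piFt f τ := by
  induction m with
  | zero => simp [pderivList]
  | succ m ih =>
    have h := integral_fderiv_mul_efun (μ := (volume : Measure (ι → ℝ)))
      (Pi.single j (1 : ℝ)) (piPair τ)
      ((contDiff_pderivList m (Pi.single j (1 : ℝ)) hf).differentiable (by simp)) (hi m)
      (hi (m + 1))
    simp_rw [piPair_apply] at h
    rw [piFt, pderivList_replicate_succ, h]
    change _ * piFt _ τ = _
    rw [ih, Finset.sum_eq_single j (fun k _ hk => by simp [hk]) (by simp)]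
    simp
    ring

theorem norm_piFt_mul_pow_le [DecidableEq ι] (hf : ContDiff ℝ (⊤ : ℕ∞) f) {b : ℝ} (hb : 0 ≤ b)
    (h : ∀ l : List ι, (∫⁻ ω : ι → ℝ,
        (‖pderivList (l.map fun j => Pi.single j (1 : ℝ)) f ω‖₊ : ℝ≥0∞)) ≤
          ENNReal.ofReal (b * (Nat.factorial (4 * l.length) : ℝ))) (j : ι) (m : ℕ) (τ : ι → ℝ) :
    |τ j| ^ m * ‖piFt f τ‖ ≤ b * (Nat.factorial (4 * m) : ℝ) := by
  have h' : ∀ m, (∫⁻ ω : ι → ℝ,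
      (‖pderivList (List.replicate m (Pi.single j (1 : ℝ))) f ω‖₊ : ℝ≥0∞)) ≤
        ENNReal.ofReal (b * (Nat.factorial (4 * m) : ℝ)) := by
    intro m
    simpa using h (List.replicate m j)
  have hi : ∀ m, Integrable (pderivList (List.replicate m (Pi.single j (1 : ℝ))) f) := fun m =>
    ⟨(contDiff_pderivList m _ hf).continuous.aestronglyMeasurable,
      (h' m).trans_lt ENNReal.ofReal_lt_top⟩
  have h1 := norm_piFt_le _ (by positivity) (h' m) τ
  rw [piFt_pderivList hf j hi m τ, norm_mul, norm_pow] at h1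
  refine le_trans ?_ h1
  gcongr
  simp [abs_of_pos Real.pi_pos]
  nlinarith [Real.pi_gt_three, abs_nonneg (τ j)]

theorem ofReal_one_div_mul_lor (L t : ℝ) (hL : 0 < L) :
    ENNReal.ofReal (1 / L ^ 4) * lor t = ENNReal.ofReal (1 / (L ^ 4 * (1 + t ^ 2))) := by
  rw [lor, ← ENNReal.ofReal_mul (by positivity)]
  congr 1
  field_simp

theorem one_le_vMaj {L M τ : ℝ} (h : |τ| ≤ M) : 1 ≤ vMaj L M τ := by
  unfold vMaj
  rw [Set.indicator_of_mem (Set.mem_Icc.2 (abs_le.1 h))]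
  exact le_self_add

theorem le_vMaj {L : ℝ} (hL : 0 < L) (M τ : ℝ) :
    ENNReal.ofReal (1 / (L ^ 4 * (1 + τ ^ 2))) ≤ vMaj L M τ := by
  unfold vMaj
  rw [ofReal_one_div_mul_lor L τ hL]
  exact le_add_self

theorem enorm_piFt_le [DecidableEq ι] (hf : ContDiff ℝ (⊤ : ℕ∞) f) {b L M : ℝ} (hb : 0 ≤ b) (hL : 0 < L)
    (h : ∀ l : List ι, (∫⁻ ω : ι → ℝ,
        (‖pderivList (l.map fun j => Pi.single j (1 : ℝ)) f ω‖₊ : ℝ≥0∞)) ≤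
          ENNReal.ofReal (b * (Nat.factorial (4 * l.length) : ℝ))) {m : ℕ}
    (hm : ∀ t, M < t → (Nat.factorial (4 * m) : ℝ) ≤
      t ^ m * (1 / (L ^ 4 * (1 + t ^ 2))) ^ Fintype.card ι) (hM : 0 ≤ M) (τ : ι → ℝ) :
    ‖piFt f τ‖ₑ ≤ ENNReal.ofReal b * ∏ j, vMaj L M (τ j) := by
  by_cases hτ : ∀ j, |τ j| ≤ M
  · have h0 : ‖piFt f τ‖ ≤ b := norm_piFt_le f hb (by simpa [pderivList] using h []) τ
    rw [← ofReal_norm]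
    refine (ENNReal.ofReal_le_ofReal h0).trans ?_
    refine (mul_one (ENNReal.ofReal b)).symm.trans_le ?_
    gcongr
    exact Finset.one_le_prod' fun j _ => one_le_vMaj (hτ j)
  · push Not at hτ
    obtain ⟨j1, hj1⟩ := hτ
    obtain ⟨j0, -, hj0⟩ := Finset.exists_max_image Finset.univ (fun j => |τ j|) ⟨j1, by simp⟩
    have ht : M < |τ j0| := hj1.trans_le (hj0 j1 (by simp))
    have htpos : 0 < |τ j0| := hM.trans_lt ht
    have h1 := norm_piFt_mul_pow_le hf hb h j0 m τ
    have h2 : ‖piFt f τ‖ ≤ b * (1 / (L ^ 4 * (1 + |τ j0| ^ 2))) ^ Fintype.card ι := by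
      have h3 := h1.trans (mul_le_mul_of_nonneg_left (hm _ ht) hb)
      have h4 : 0 < |τ j0| ^ m := by positivity
      refine le_of_mul_le_mul_left (h3.trans_eq ?_) h4
      ring
    rw [← ofReal_norm]
    refine (ENNReal.ofReal_le_ofReal h2).trans ?_
    rw [ENNReal.ofReal_mul hb, ENNReal.ofReal_pow (by positivity), ← Finset.card_univ,
      ← Finset.prod_const]
    gcongr with j
    refine le_trans (ENNReal.ofReal_le_ofReal ?_) (le_vMaj hL M (τ j))
    have := hj0 j (by simp)
    rw [← sq_abs (τ j)]
    gcongr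

end piFourier

theorem factorial_tail {L M t : ℝ} (hL : 1 ≤ L) {K N : ℕ} (hK : 3 ≤ K)
    (hLM : L ^ 4 ≤ M ^ (K - 3)) (hM : 2 ≤ M) (hN : (8 * (K : ℝ) * N) ^ 8 ≤ M) (ht : M < t) :
    (Nat.factorial (4 * (2 * K * N)) : ℝ) ≤
      t ^ (2 * K * N) * (1 / (L ^ 4 * (1 + t ^ 2))) ^ N := by
  have ht2 : 2 < t := hM.trans_lt ht
  have h1 : (Nat.factorial (4 * (2 * K * N)) : ℝ) ≤ t ^ (K * N) := by
    calc (Nat.factorial (4 * (2 * K * N)) : ℝ)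
        ≤ ((4 * (2 * K * N) : ℕ) : ℝ) ^ (4 * (2 * K * N)) := by
          exact_mod_cast Nat.factorial_le_pow _
      _ = ((8 * (K : ℝ) * N) ^ 8) ^ (K * N) := by
          rw [← pow_mul]
          push_cast
          congr 1 <;> ring
      _ ≤ t ^ (K * N) := by
          gcongr
          linarith
  have h2 : L ^ 4 * (1 + t ^ 2) ≤ t ^ K := by
    calc L ^ 4 * (1 + t ^ 2) ≤ t ^ (K - 3) * t ^ 3 := by
          refine mul_le_mul (hLM.trans (by gcongr)) ?_ (by positivity) (by positivity)
          nlinarith [sq_nonneg t]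
      _ = t ^ K := by rw [← pow_add, Nat.sub_add_cancel hK]
  have h3 : (1 / t ^ K) ^ N ≤ (1 / (L ^ 4 * (1 + t ^ 2))) ^ N := by
    gcongr
  calc (Nat.factorial (4 * (2 * K * N)) : ℝ) ≤ t ^ (K * N) := h1
    _ = t ^ (2 * K * N) * (1 / t ^ K) ^ N := by
        rw [one_div, inv_pow, ← pow_mul, show 2 * K * N = K * N + K * N by ring, pow_add]
        field_simp
    _ ≤ _ := by gcongr

theorem enorm_le_vMaj_of_decay {g : ℝ → ℂ} {C L M : ℝ} {K : ℕ} (hK : 3 ≤ K) (hL : 1 ≤ L)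
    (hM : 0 ≤ M) (hC : 0 ≤ C) (hLM : L ^ 4 ≤ M ^ (K - 3))
    (hg : ∀ τ, ‖g τ‖ ≤ C / (1 + |τ|) ^ K) (τ : ℝ) :
    ‖g τ‖ₑ ≤ ENNReal.ofReal C * vMaj L M τ := by
  have h1 : 1 ≤ 1 + |τ| := by linarith [abs_nonneg τ]
  rw [← ofReal_norm]
  rcases le_or_gt |τ| M with h | h
  · refine (ENNReal.ofReal_le_ofReal ((hg τ).trans
      (div_le_self hC (one_le_pow₀ h1)))).trans ?_
    refine (mul_one (ENNReal.ofReal C)).symm.trans_le ?_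
    gcongr
    exact one_le_vMaj h
  · refine le_trans (ENNReal.ofReal_le_ofReal (hg τ)) ?_
    refine le_trans ?_ (mul_le_mul' le_rfl (le_vMaj (by linarith) M τ))
    rw [← ENNReal.ofReal_mul hC]
    refine ENNReal.ofReal_le_ofReal ?_
    rw [mul_one_div]
    gcongr
    calc L ^ 4 * (1 + τ ^ 2) ≤ (1 + |τ|) ^ (K - 3) * (1 + |τ|) ^ 3 := by
          refine mul_le_mul (hLM.trans ?_) ?_ (by positivity) (by positivity)
          · gcongr
            linarith
          · nlinarith [sq_abs τ, abs_nonneg τ, pow_nonneg (abs_nonneg τ) 3]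
      _ = (1 + |τ|) ^ K := by rw [← pow_add, Nat.sub_add_cancel hK]

theorem integrable_toReal_vMaj (L M : ℝ) : Integrable fun τ => (vMaj L M τ).toReal := by
  refine integrable_toReal_of_lintegral_ne_top (by fun_prop) ?_
  unfold vMaj
  rw [lintegral_add_right _ (by fun_prop), lintegral_const_mul _ (by fun_prop), lintegral_lor,
    lintegral_indicator measurableSet_Icc]
  simp [ENNReal.mul_eq_top]

theorem integrable_of_enorm_le_prod_vMaj {ι : Type*} [Fintype ι] {F : (ι → ℝ) → ℂ} {b L M : ℝ}
    (hL : 1 ≤ L) (hb : 0 ≤ b) (hF : AEStronglyMeasurable F)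
    (h : ∀ τ, ‖F τ‖ₑ ≤ ENNReal.ofReal b * ∏ j, vMaj L M (τ j)) : Integrable F := by
  have hfin : ∀ t, vMaj L M t ≠ ⊤ := fun t =>
    ((vMaj_le_two hL M t).trans_lt (by norm_num)).ne
  have h1 : Integrable fun τ : ι → ℝ => ∏ j, (vMaj L M (τ j)).toReal :=
    Integrable.fintype_prod (f := fun _ t => (vMaj L M t).toReal) fun _ =>
      integrable_toReal_vMaj L M
  refine (h1.const_mul b).mono' hF (Filter.Eventually.of_forall fun τ => ?_)
  have h2 := ENNReal.toReal_mono (ENNReal.mul_ne_top ENNReal.ofReal_ne_top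
    (ENNReal.prod_ne_top fun j _ => hfin (τ j))) (h τ)
  rwa [toReal_enorm, ENNReal.toReal_mul, ENNReal.toReal_ofReal hb, ENNReal.toReal_prod] at h2

section density

variable {n : ℕ} {g : ℝ → ℂ} {J : Finset (Fin n)} {Ψ₁ : ({j : Fin n // j ∉ J} → ℝ) → ℂ}

/-- The Fourier density of the weight. -/
def psiDensity (g : ℝ → ℂ) (J : Finset (Fin n)) (Ψ₁ : ({j : Fin n // j ∉ J} → ℝ) → ℂ)
    (τ : Fin n → ℝ) : ℂ :=
  (∏ j ∈ J, g (τ j)) * piFt Ψ₁ fun j => τ j.1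

theorem prod_mul_prod_notMem {M : Type*} [CommMonoid M] (J : Finset (Fin n)) (f : Fin n → M) :
    (∏ j ∈ J, f j) * ∏ j : {j : Fin n // j ∉ J}, f j.1 = ∏ j, f j := by
  rw [← Finset.prod_mul_prod_compl J f, Finset.prod_subtype Jᶜ (fun x => Finset.mem_compl) f]

theorem sum_add_sum_notMem (J : Finset (Fin n)) (f : Fin n → ℝ) :
    (∑ j ∈ J, f j) + ∑ j : {j : Fin n // j ∉ J}, f j.1 = ∑ j, f j := by
  rw [← Finset.sum_add_sum_compl J f, Finset.sum_subtype Jᶜ (fun x => Finset.mem_compl) f]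

theorem enorm_psiDensity_le {Cg b L M : ℝ} (hCg : 1 ≤ Cg) (hb : 0 ≤ b)
    (hg : ∀ t, ‖g t‖ₑ ≤ ENNReal.ofReal Cg * vMaj L M t)
    (hΨ : ∀ τ, ‖piFt Ψ₁ τ‖ₑ ≤ ENNReal.ofReal b * ∏ j, vMaj L M (τ j)) (τ : Fin n → ℝ) :
    ‖psiDensity g J Ψ₁ τ‖ₑ ≤ ENNReal.ofReal (b * Cg ^ n) * ∏ j, vMaj L M (τ j) := by
  rw [psiDensity, enorm_mul, enorm_finset_prod]
  calc (∏ j ∈ J, ‖g (τ j)‖ₑ) * ‖piFt Ψ₁ fun j => τ j.1‖ₑ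
      ≤ (∏ j ∈ J, (ENNReal.ofReal Cg * vMaj L M (τ j))) *
        (ENNReal.ofReal b * ∏ j : {j : Fin n // j ∉ J}, vMaj L M (τ j.1)) := by
        refine mul_le_mul' (Finset.prod_le_prod' fun j _ => hg _) (hΨ _)
    _ = ENNReal.ofReal b * ENNReal.ofReal Cg ^ J.card * ∏ j, vMaj L M (τ j) := by
        rw [Finset.prod_mul_distrib, Finset.prod_const,
          ← prod_mul_prod_notMem J fun j => vMaj L M (τ j)]
        ring
    _ ≤ _ := by
        rw [ENNReal.ofReal_mul hb, ENNReal.ofReal_pow (by linarith)]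
        gcongr
        · exact ENNReal.one_le_ofReal.2 hCg
        · exact (Finset.card_le_univ J).trans (by simp)

theorem aestronglyMeasurable_psiDensity (hg : Measurable g) (hΨ : Integrable Ψ₁) :
    AEStronglyMeasurable (psiDensity g J Ψ₁) := by
  unfold psiDensity
  refine (Measurable.mul ?_ ?_).aestronglyMeasurable
  · exact Finset.measurable_prod _ fun j _ => hg.comp (measurable_pi_apply j)
  · exact (continuous_piFt hΨ).measurable.comp (by fun_prop)

theorem PsiFun_eq_integral {χ₀ : ℝ → ℝ} (hΨc : Continuous Ψ₁) (hΨi : Integrable Ψ₁)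
    (hΨF : Integrable (piFt Ψ₁))
    (hgu : ∀ u, (((1 - χ₀ u) / u : ℝ) : ℂ) = ∫ τ, g τ * efun (τ * u)) (Ω : Fin n → ℝ) :
    PsiFun χ₀ J Ψ₁ Ω = ∫ τ : Fin n → ℝ, psiDensity g J Ψ₁ τ * efun (∑ j, τ j * Ω j) := by
  have hmp := volume_preserving_piEquivPiSubtypeProd (fun _ : Fin n => ℝ) (· ∉ J)
  set e := MeasurableEquiv.piEquivPiSubtypeProd (fun _ : Fin n => ℝ) (· ∉ J) with he
  let k := fun p : ({j // j ∉ J} → ℝ) × ({j // ¬ j ∉ J} → ℝ) =>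
    (piFt Ψ₁ p.1 * efun (∑ j, p.1 j * Ω j.1)) * ∏ j, (g (p.2 j) * efun (p.2 j * Ω j.1))
  have h1 : ∀ τ : Fin n → ℝ, psiDensity g J Ψ₁ τ * efun (∑ j, τ j * Ω j) = k (e τ) := by
    intro τ
    have h2 : ∏ j : {j // ¬ j ∉ J}, (g ((e τ).2 j) * efun ((e τ).2 j * Ω j.1)) =
        ∏ j ∈ J, (g (τ j) * efun (τ j * Ω j)) :=
      (Finset.prod_subtype J (fun x => not_not.symm) fun j => g (τ j) * efun (τ j * Ω j)).symm
    change _ = _ * ∏ j : {j // ¬ j ∉ J}, (g ((e τ).2 j) * efun ((e τ).2 j * Ω j.1))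
    rw [h2, ← sum_add_sum_notMem J, efun_add, efun_sum J, Finset.prod_mul_distrib, psiDensity]
    change _ = (piFt Ψ₁ (fun j => τ j.1) * efun (∑ j : {j : Fin n // j ∉ J}, τ j.1 * Ω j.1)) * _
    ring
  simp_rw [h1]
  rw [hmp.integral_comp' (f := e) k]
  change _ = ∫ p, k p ∂(volume.prod volume)
  rw [integral_prod_mul (fun q : {j // j ∉ J} → ℝ => piFt Ψ₁ q * efun (∑ j, q j * Ω j.1))
    (fun p : {j // ¬ j ∉ J} → ℝ => ∏ j, (g (p j) * efun (p j * Ω j.1))), PsiFun, mul_comm]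
  congr 1
  · exact pi_inversion hΨc hΨi hΨF _
  · rw [integral_fintype_prod_volume_eq_prod (fun (j : {j // ¬ j ∉ J}) t =>
      g t * efun (t * Ω j.1)), Complex.ofReal_prod, Finset.prod_subtype J (fun x => not_not.symm)]
    exact Finset.prod_congr rfl fun j _ => hgu (Ω j.1)

end density

section boxes

variable {d n : ℕ} {L : ℝ}

theorem lt_one_of_boxBump_ne_zero {B : Fin n → Fin d → ℤ × ℤ} {z : PairSp d n}
    (h : boxBump B z ≠ 0) (j : Fin n) (i : Fin d) :
    |z.1 j i - (B j i).1| < 1 ∧ |z.2 j i - (B j i).2| < 1 := by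
  rw [boxBump, Finset.prod_ne_zero_iff] at h
  have h1 := h j (Finset.mem_univ j)
  rw [Finset.prod_ne_zero_iff] at h1
  have h2 := mul_ne_zero_iff.1 (h1 i (Finset.mem_univ i))
  constructor <;> by_contra! h3
  · exact h2.1 (bump_eq_zero h3)
  · exact h2.2 (bump_eq_zero h3)

theorem mem_boxCodes_of_boxBump_ne_zero (hL : 0 < L) {B m : Fin n → Fin d → ℤ × ℤ}
    (h : boxBump B (latPt L m) ≠ 0) : m ∈ boxCodes L B := by
  simp only [boxCodes, Fintype.mem_piFinset, Finset.mem_product, mem_win hL]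
  exact fun j i => ⟨(lt_one_of_boxBump_ne_zero h j i).1.le, (lt_one_of_boxBump_ne_zero h j i).2.le⟩

theorem mem_Icc_floor_of_abs_lt_one {x : ℝ} {p : ℤ} (h : |x - p| < 1) :
    p ∈ Finset.Icc ⌊x⌋ (⌊x⌋ + 1) := by
  have h1 := abs_lt.1 h
  have h2 := Int.floor_le x
  have h3 := Int.lt_floor_add_one x
  rw [Finset.mem_Icc]
  constructor
  · have : (⌊x⌋ : ℝ) < p + 1 := by linarith
    exact Int.lt_add_one_iff.1 (by exact_mod_cast this)
  · have : (p : ℝ) < ⌊x⌋ + 1 + 1 := by linarith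
    exact Int.lt_add_one_iff.1 (by exact_mod_cast this)

theorem sum_boxBump_eq_one {S : Finset (Fin n → Fin d → ℤ × ℤ)} {z : PairSp d n}
    (hS : ∀ B : Fin n → Fin d → ℤ × ℤ,
      (∀ j i, |z.1 j i - (B j i).1| < 1 ∧ |z.2 j i - (B j i).2| < 1) → B ∈ S) :
    ∑ B ∈ S, boxBump B z = 1 := by
  classical
  let P : Finset (Fin n → Fin d → ℤ × ℤ) := Fintype.piFinset fun j => Fintype.piFinset fun i =>
    Finset.Icc ⌊z.1 j i⌋ (⌊z.1 j i⌋ + 1) ×ˢ Finset.Icc ⌊z.2 j i⌋ (⌊z.2 j i⌋ + 1)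
  have hP : ∀ B : Fin n → Fin d → ℤ × ℤ,
      (∀ j i, |z.1 j i - (B j i).1| < 1 ∧ |z.2 j i - (B j i).2| < 1) → B ∈ P := by
    intro B hB
    simp only [P, Fintype.mem_piFinset, Finset.mem_product]
    exact fun j i => ⟨mem_Icc_floor_of_abs_lt_one (hB j i).1,
      mem_Icc_floor_of_abs_lt_one (hB j i).2⟩
  have h1 : ∑ B ∈ S, boxBump B z = ∑ B ∈ P, boxBump B z := by
    rw [Finset.sum_subset Finset.subset_union_left (s₂ := S ∪ P),
      Finset.sum_subset Finset.subset_union_right (s₁ := P) (s₂ := S ∪ P)]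
    · intro B _ hB
      by_contra h
      exact hB (hP B (lt_one_of_boxBump_ne_zero h))
    · intro B _ hB
      by_contra h
      exact hB (hS B (lt_one_of_boxBump_ne_zero h))
  rw [h1]
  simp only [boxBump, P]
  rw [← Finset.prod_univ_sum (f := fun (j : Fin n) (b : Fin d → ℤ × ℤ) =>
    ∏ i, bump (z.1 j i - (b i).1) * bump (z.2 j i - (b i).2))]
  refine Finset.prod_eq_one fun j _ => ?_
  rw [← Finset.prod_univ_sum (f := fun (i : Fin d) (b : ℤ × ℤ) =>
    bump (z.1 j i - b.1) * bump (z.2 j i - b.2))]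
  refine Finset.prod_eq_one fun i _ => ?_
  rw [Finset.sum_product]
  simp_rw [← Finset.mul_sum]
  rw [sum_bump_eq_one _ _ fun p hp => mem_Icc_floor_of_abs_lt_one hp]
  simp_rw [mul_one]
  exact sum_bump_eq_one _ _ fun p hp => mem_Icc_floor_of_abs_lt_one hp

theorem eq_sum_boxBump_mul {S : Finset (Fin n → Fin d → ℤ × ℤ)} {F : PairSp d n → ℂ}
    (hS : ∀ (B : Fin n → Fin d → ℤ × ℤ) (z : PairSp d n), F z ≠ 0 →
      (∀ j i, |z.1 j i - (B j i).1| < 1 ∧ |z.2 j i - (B j i).2| < 1) → B ∈ S) (z : PairSp d n) :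
    F z = ∑ B ∈ S, (boxBump B z : ℂ) * F z := by
  by_cases h : F z = 0
  · simp [h]
  · rw [← Finset.sum_mul, ← Complex.ofReal_sum, sum_boxBump_eq_one fun B hB => hS B z h hB]
    simp

/-- The lattice points, enumerated by their integer codes. -/
def latEquiv (d n : ℕ) (hL : 0 < L) : (Fin n → Fin d → ℤ × ℤ) ≃
    {z : PairSp d n // (∀ j, z.1 j ∈ ZLat d L) ∧ ∀ j, z.2 j ∈ ZLat d L} :=
  Equiv.ofBijective (fun m => ⟨latPt L m, fun j i => ⟨(m j i).1, rfl⟩, fun j i => ⟨(m j i).2, rfl⟩⟩)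
    (by
      constructor
      · intro m m' h
        have h0 : latPt L m = latPt L m' := congrArg Subtype.val h
        funext j i
        have h1 : ((m j i).1 : ℝ) / L = (m' j i).1 / L :=
          congrArg (fun z : PairSp d n => z.1 j i) h0
        have h2 : ((m j i).2 : ℝ) / L = (m' j i).2 / L :=
          congrArg (fun z : PairSp d n => z.2 j i) h0
        rw [div_left_inj' hL.ne'] at h1 h2
        exact Prod.ext (by exact_mod_cast h1) (by exact_mod_cast h2)
      · rintro ⟨z, h1, h2⟩
        have k1 := h1
        have k2 := h2
        choose m1 hm1 using k1
        choose m2 hm2 using k2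
        refine ⟨fun j i => (m1 j i, m2 j i), Subtype.ext (Prod.ext ?_ ?_)⟩
        · funext j
          ext i
          exact (hm1 j i).symm
        · funext j
          ext i
          exact (hm2 j i).symm)

theorem tsum_lattice_eq (hL : 0 < L) {S : Finset (Fin n → Fin d → ℤ × ℤ)} {F : PairSp d n → ℂ}
    (hS : ∀ (B : Fin n → Fin d → ℤ × ℤ) (z : PairSp d n), F z ≠ 0 →
      (∀ j i, |z.1 j i - (B j i).1| < 1 ∧ |z.2 j i - (B j i).2| < 1) → B ∈ S) :
    ∑' z : {z : PairSp d n // (∀ j, z.1 j ∈ ZLat d L) ∧ ∀ j, z.2 j ∈ ZLat d L}, F z.1 =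
      ∑ B ∈ S, ∑ m ∈ boxCodes L B, (boxBump B (latPt L m) : ℂ) * F (latPt L m) := by
  rw [← (latEquiv d n hL).tsum_eq]
  change ∑' m, F (latPt L m) = _
  have h : HasSum (fun m => ∑ B ∈ S, (boxBump B (latPt L m) : ℂ) * F (latPt L m))
      (∑ B ∈ S, ∑ m ∈ boxCodes L B, (boxBump B (latPt L m) : ℂ) * F (latPt L m)) := by
    refine hasSum_sum fun B _ => hasSum_sum_of_ne_finset_zero fun m hm => ?_
    by_contra h0
    refine hm (mem_boxCodes_of_boxBump_ne_zero hL fun h1 => h0 ?_)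
    rw [h1]
    simp
  rw [← h.tsum_eq]
  exact tsum_congr fun m => eq_sum_boxBump_mul hS _

theorem norm_tsum_sub_integral_le (hL : 0 < L) {S : Finset (Fin n → Fin d → ℤ × ℤ)}
    {F : PairSp d n → ℂ} {E : ℝ} (N : ℂ)
    (hS : ∀ (B : Fin n → Fin d → ℤ × ℤ) (z : PairSp d n), F z ≠ 0 →
      (∀ j i, |z.1 j i - (B j i).1| < 1 ∧ |z.2 j i - (B j i).2| < 1) → B ∈ S)
    (hi : ∀ B, Integrable fun z => (boxBump B z : ℂ) * F z)
    (hE : ∀ B, ‖(∑ m ∈ boxCodes L B, (boxBump B (latPt L m) : ℂ) * F (latPt L m)) -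
      N * ∫ z, (boxBump B z : ℂ) * F z‖ ≤ E) :
    ‖(∑' z : {z : PairSp d n // (∀ j, z.1 j ∈ ZLat d L) ∧ ∀ j, z.2 j ∈ ZLat d L}, F z.1) -
      N * ∫ z, F z‖ ≤ S.card * E := by
  have h1 : ∫ z, F z = ∑ B ∈ S, ∫ z, (boxBump B z : ℂ) * F z := by
    rw [← integral_finsetSum S fun B _ => hi B]
    exact integral_congr_ae (Filter.Eventually.of_forall fun z => eq_sum_boxBump_mul hS z)
  rw [tsum_lattice_eq hL hS, h1, Finset.mul_sum, ← Finset.sum_sub_distrib, ← nsmul_eq_mul]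
  exact (norm_sum_le _ _).trans (Finset.sum_le_card_nsmul _ _ _ fun B _ => hE B)

end boxes

section counting

variable {d n : ℕ}

/-- A coordinate combination `r + s₁ x_k + s₂ y_k` with at most one of `s₁, s₂ ∈ {0, ±1}` nonzero,
which moreover vanish unless `k ≺ j`. -/
structure Corr (prec : Fin n → Fin n → Prop) (j k : Fin n) (s : ℤ × ℤ) : Prop where
  bound : |s.1| + |s.2| ≤ 1
  prec_of_ne : s ≠ 0 → prec k j

theorem exists_corr {prec : Fin n → Fin n → Prop} {j : Fin n}
    {v : PairSp d n → EuclideanSpace ℝ (Fin d)} {t : PairSp d n → EuclideanSpace ℝ (Fin d)}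
    (h : (∀ z, t z = v z) ∨
        ∃ j', prec j' j ∧
          ((∀ z, t z = v z + z.1 j') ∨ (∀ z, t z = v z - z.1 j') ∨
            (∀ z, t z = v z + z.2 j') ∨ (∀ z, t z = v z - z.2 j'))) :
    ∃ (k : Fin n) (s : ℤ × ℤ), Corr prec j k s ∧
      ∀ z i, t z i = v z i + s.1 * z.1 k i + s.2 * z.2 k i := by
  rcases h with h | ⟨k, hk, h | h | h | h⟩
  · exact ⟨j, 0, ⟨by simp, by simp⟩, fun z i => by rw [h z]; simp⟩
  · exact ⟨k, (1, 0), ⟨by simp, fun _ => hk⟩, fun z i => by rw [h z]; simp⟩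
  · exact ⟨k, (-1, 0), ⟨by simp, fun _ => hk⟩, fun z i => by rw [h z]; simp; ring⟩
  · exact ⟨k, (0, 1), ⟨by simp, fun _ => hk⟩, fun z i => by rw [h z]; simp⟩
  · exact ⟨k, (0, -1), ⟨by simp, fun _ => hk⟩, fun z i => by rw [h z]; simp; ring⟩

/-- The integer code of the sheared coordinates. -/
def shear (kx ky : Fin n → Fin n) (sx sy : Fin n → ℤ × ℤ) (B : Fin n → Fin d → ℤ × ℤ) :
    Fin n → Fin d → ℤ × ℤ := fun j i =>
  ((B j i).1 + (sx j).1 * (B (kx j) i).1 + (sx j).2 * (B (kx j) i).2,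
    (B j i).2 + (sy j).1 * (B (ky j) i).1 + (sy j).2 * (B (ky j) i).2)

theorem shear_injective {prec : Fin n → Fin n → Prop} (hirr : ∀ j, ¬prec j j)
    (htr : ∀ j₁ j₂ j₃, prec j₁ j₂ → prec j₂ j₃ → prec j₁ j₃) {kx ky : Fin n → Fin n}
    {sx sy : Fin n → ℤ × ℤ} (hx : ∀ j, Corr prec j (kx j) (sx j))
    (hy : ∀ j, Corr prec j (ky j) (sy j)) :
    Function.Injective (shear (d := d) kx ky sx sy) := by
  intro B B' h
  have hwf : WellFounded prec := by
    have : IsTrans (Fin n) prec := ⟨htr⟩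
    have : Std.Irrefl prec := ⟨hirr⟩
    exact Finite.wellFounded_of_trans_of_irrefl prec
  have key : ∀ (j k : Fin n) (s : ℤ × ℤ), Corr prec j k s → (∀ k, prec k j → B k = B' k) → ∀ i,
      s.1 * (B k i).1 + s.2 * (B k i).2 = s.1 * (B' k i).1 + s.2 * (B' k i).2 := by
    intro j k s hs ih i
    by_cases h0 : s = 0
    · simp [h0]
    · rw [ih k (hs.prec_of_ne h0)]
  funext j
  induction j using hwf.induction with
  | _ j ih =>
    funext i
    have h1 : shear kx ky sx sy B j i = shear kx ky sx sy B' j i := by rw [h]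
    simp only [shear, Prod.mk.injEq] at h1
    have h2 := key j _ _ (hx j) ih i
    have h3 := key j _ _ (hy j) ih i
    refine Prod.ext ?_ ?_
    · linarith [h1.1]
    · linarith [h1.2]

theorem corr_close {s : ℤ × ℤ} (hs : |s.1| + |s.2| ≤ 1) {x y z p q r : ℝ} (hx : |x - p| < 1)
    (hy : |y - q| < 1) (hz : |z - r| < 1) {a lam : ℝ}
    (h : |x + s.1 * y + s.2 * z - a| ≤ lam) :
    |p + s.1 * q + s.2 * r - a| ≤ lam + 2 := by
  have h1 : (|(s.1 : ℝ)| + |(s.2 : ℝ)|) ≤ 1 := by exact_mod_cast hs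
  have h2 : p + s.1 * q + s.2 * r - a =
      (x + s.1 * y + s.2 * z - a) - (x - p) - s.1 * (y - q) - s.2 * (z - r) := by ring
  rw [h2]
  have h3 : |(s.1 : ℝ) * (y - q)| ≤ |(s.1 : ℝ)| := by
    rw [abs_mul]
    exact mul_le_of_le_one_right (abs_nonneg _) hy.le
  have h4 : |(s.2 : ℝ) * (z - r)| ≤ |(s.2 : ℝ)| := by
    rw [abs_mul]
    exact mul_le_of_le_one_right (abs_nonneg _) hz.le
  have h5 := abs_sub (x + s.1 * y + s.2 * z - a - (x - p) - s.1 * (y - q)) (s.2 * (z - r))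
  have h6 := abs_sub (x + s.1 * y + s.2 * z - a - (x - p)) (s.1 * (y - q))
  have h7 := abs_sub (x + s.1 * y + s.2 * z - a) (x - p)
  linarith

theorem card_Icc_ceil_floor_le {a lam : ℝ} (hl : 1 ≤ lam) :
    ((Finset.Icc ⌈a - (lam + 2)⌉ ⌊a + (lam + 2)⌋).card : ℝ) ≤ 7 * lam := by
  have h1 := Int.le_ceil (a - (lam + 2))
  have h2 := Int.floor_le (a + (lam + 2))
  rw [Int.card_Icc]
  rcases le_total 0 (⌊a + (lam + 2)⌋ + 1 - ⌈a - (lam + 2)⌉) with h | h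
  · have : (((⌊a + (lam + 2)⌋ + 1 - ⌈a - (lam + 2)⌉).toNat : ℤ) : ℝ) =
        ⌊a + (lam + 2)⌋ + 1 - ⌈a - (lam + 2)⌉ := by
      rw [Int.toNat_of_nonneg h]
      push_cast
      ring
    rw [← Int.cast_natCast, this]
    linarith
  · rw [Int.toNat_of_nonpos h]
    simp
    linarith

theorem mem_Icc_ceil_floor {a lam : ℝ} {p : ℤ} (h : |(p : ℝ) - a| ≤ lam + 2) :
    p ∈ Finset.Icc ⌈a - (lam + 2)⌉ ⌊a + (lam + 2)⌋ := by
  have := abs_le.1 h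
  rw [Finset.mem_Icc, Int.ceil_le, Int.le_floor]
  constructor <;> linarith

theorem card_piFinset_prod (I I' : Fin n → Fin d → Finset ℤ) :
    ((Fintype.piFinset fun j => Fintype.piFinset fun i => I j i ×ˢ I' j i).card : ℝ) =
      ∏ j, ∏ i, ((I j i).card : ℝ) * ((I' j i).card : ℝ) := by
  rw [Fintype.card_piFinset, Nat.cast_prod]
  refine Finset.prod_congr rfl fun j _ => ?_
  rw [Fintype.card_piFinset, Nat.cast_prod]
  refine Finset.prod_congr rfl fun i _ => ?_
  rw [Finset.card_product, Nat.cast_mul]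

theorem abs_apply_le_of_norm_le {v a : EuclideanSpace ℝ (Fin d)} {lam : ℝ} (h : ‖v - a‖ ≤ lam)
    (i : Fin d) : |v i - a i| ≤ lam := by
  have := PiLp.norm_apply_le (v - a) i
  rw [Real.norm_eq_abs] at this
  exact this.trans h

theorem exists_boxes {prec : Fin n → Fin n → Prop} (hirr : ∀ j, ¬prec j j)
    (htr : ∀ j₁ j₂ j₃, prec j₁ j₂ → prec j₂ j₃ → prec j₁ j₃) {lamv : Fin n → ℝ}
    (hl : ∀ j, 1 ≤ lamv j) {av bv : Fin n → EuclideanSpace ℝ (Fin d)}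
    {xt yt : Fin n → PairSp d n → EuclideanSpace ℝ (Fin d)}
    (hxt : ∀ j, (∀ z, xt j z = z.1 j) ∨
        ∃ j', prec j' j ∧
          ((∀ z, xt j z = z.1 j + z.1 j') ∨ (∀ z, xt j z = z.1 j - z.1 j') ∨
            (∀ z, xt j z = z.1 j + z.2 j') ∨ (∀ z, xt j z = z.1 j - z.2 j')))
    (hyt : ∀ j, (∀ z, yt j z = z.2 j) ∨
        ∃ j'', prec j'' j ∧
          ((∀ z, yt j z = z.2 j + z.1 j'') ∨ (∀ z, yt j z = z.2 j - z.1 j'') ∨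
            (∀ z, yt j z = z.2 j + z.2 j'') ∨ (∀ z, yt j z = z.2 j - z.2 j''))) :
    ∃ S : Finset (Fin n → Fin d → ℤ × ℤ), (S.card : ℝ) ≤ ∏ j, (7 * lamv j) ^ (2 * d) ∧
      ∀ (B : Fin n → Fin d → ℤ × ℤ) (z : PairSp d n),
        (∀ j, ‖xt j z - av j‖ ≤ lamv j ∧ ‖yt j z - bv j‖ ≤ lamv j) →
        (∀ j i, |z.1 j i - (B j i).1| < 1 ∧ |z.2 j i - (B j i).2| < 1) → B ∈ S := by
  classical
  choose kx sx hx hx' using fun j => exists_corr (v := fun z : PairSp d n => z.1 j) (hxt j)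
  choose ky sy hy hy' using fun j => exists_corr (v := fun z : PairSp d n => z.2 j) (hyt j)
  have hinj := shear_injective (d := d) hirr htr hx hy
  let I : Fin n → Fin d → Finset ℤ := fun j i =>
    Finset.Icc ⌈av j i - (lamv j + 2)⌉ ⌊av j i + (lamv j + 2)⌋
  let I' : Fin n → Fin d → Finset ℤ := fun j i =>
    Finset.Icc ⌈bv j i - (lamv j + 2)⌉ ⌊bv j i + (lamv j + 2)⌋
  set R : Finset (Fin n → Fin d → ℤ × ℤ) :=
    Fintype.piFinset fun j => Fintype.piFinset fun i => I j i ×ˢ I' j i with hR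
  refine ⟨R.preimage (shear kx ky sx sy) hinj.injOn, ?_, ?_⟩
  · have h1 : (R.preimage (shear kx ky sx sy) hinj.injOn).card ≤ R.card :=
      Finset.card_le_card_of_injOn (shear kx ky sx sy)
        (fun B hB => Finset.mem_preimage.1 hB) hinj.injOn
    calc ((R.preimage (shear kx ky sx sy) hinj.injOn).card : ℝ) ≤ R.card := by exact_mod_cast h1
      _ ≤ ∏ j, (7 * lamv j) ^ (2 * d) := by
        rw [hR, card_piFinset_prod]
        refine Finset.prod_le_prod (fun j _ => Finset.prod_nonneg fun i _ =>
          mul_nonneg (Nat.cast_nonneg _) (Nat.cast_nonneg _)) fun j _ => ?_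
        have : (7 * lamv j) ^ (2 * d) = ∏ _i : Fin d, ((7 * lamv j) * (7 * lamv j)) := by
          rw [Finset.prod_const, Finset.card_univ, Fintype.card_fin, pow_mul, sq]
        rw [this]
        refine Finset.prod_le_prod (fun i _ =>
          mul_nonneg (Nat.cast_nonneg _) (Nat.cast_nonneg _)) fun i _ => ?_
        exact mul_le_mul (card_Icc_ceil_floor_le (hl j)) (card_Icc_ceil_floor_le (hl j))
          (Nat.cast_nonneg _) (by linarith [hl j])
  · intro B z hz hB
    rw [Finset.mem_preimage, hR]
    simp only [Fintype.mem_piFinset, Finset.mem_product]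
    intro j i
    have h1 := abs_apply_le_of_norm_le (hz j).1 i
    have h2 := abs_apply_le_of_norm_le (hz j).2 i
    rw [hx'] at h1
    rw [hy'] at h2
    constructor
    · refine mem_Icc_ceil_floor ?_
      have := corr_close (hx j).bound (hB j i).1 (hB (kx j) i).1 (hB (kx j) i).2 h1
      simpa [shear] using this
    · refine mem_Icc_ceil_floor ?_
      have := corr_close (hy j).bound (hB j i).2 (hB (ky j) i).1 (hB (ky j) i).2 h2
      simpa [shear] using this

theorem hasCompactSupport_of_boxes {W : PairSp d n → ℂ} {S : Finset (Fin n → Fin d → ℤ × ℤ)}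
    (hS : ∀ (B : Fin n → Fin d → ℤ × ℤ) (z : PairSp d n), W z ≠ 0 →
      (∀ j i, |z.1 j i - (B j i).1| < 1 ∧ |z.2 j i - (B j i).2| < 1) → B ∈ S) :
    HasCompactSupport W := by
  let K : Set (PairSp d n) := ⋃ B ∈ S, unflat d n '' (Set.univ.pi fun j => Set.univ.pi fun i =>
    Set.Icc ((B j i).1 - 1 : ℝ) ((B j i).1 + 1) ×ˢ Set.Icc ((B j i).2 - 1 : ℝ) ((B j i).2 + 1))
  have hu : Continuous (unflat d n) := by
    have : (unflat d n : (Fin n → Fin d → ℝ × ℝ) → PairSp d n) = fun w =>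
      (fun j => WithLp.toLp 2 fun i => (w j i).1, fun j => WithLp.toLp 2 fun i => (w j i).2) := rfl
    rw [this]
    fun_prop
  have hK : IsCompact K := S.isCompact_biUnion fun B _ => (isCompact_univ_pi fun j =>
    isCompact_univ_pi fun i => isCompact_Icc.prod isCompact_Icc).image hu
  refine HasCompactSupport.intro hK fun z hz => ?_
  by_contra h
  have hf : ∀ x : ℝ, |x - (⌊x⌋ : ℤ)| < 1 := by
    intro x
    rw [abs_lt]
    constructor <;> linarith [Int.floor_le x, Int.lt_floor_add_one x]
  have hfI : ∀ x : ℝ, x ∈ Set.Icc ((⌊x⌋ : ℝ) - 1) (⌊x⌋ + 1) := fun x =>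
    ⟨by linarith [Int.floor_le x], by linarith [Int.lt_floor_add_one x]⟩
  refine hz (Set.mem_biUnion (hS (fun j i => (⌊z.1 j i⌋, ⌊z.2 j i⌋)) z h
    fun j i => ⟨hf _, hf _⟩) ⟨(unflat d n).symm z, ?_, (unflat d n).apply_symm_apply z⟩)
  intro j _ i _
  exact ⟨hfI _, hfI _⟩

end counting

theorem eventually_mul_log_pow_le (a b : ℝ) (k : ℕ) {s : ℝ} (hs : 0 < s) :
    ∀ᶠ L : ℝ in Filter.atTop, a * (b + Real.log L) ^ k ≤ L ^ s := by
  have hl : ∀ j : ℕ, (fun L : ℝ => Real.log L ^ j) =o[Filter.atTop] fun L : ℝ => L ^ s := by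
    intro j
    simpa using isLittleO_log_rpow_rpow_atTop (j : ℝ) hs
  have h1 : (fun L : ℝ => a * (b + Real.log L) ^ k) =o[Filter.atTop] fun L : ℝ => L ^ s := by
    refine Asymptotics.IsLittleO.const_mul_left ?_ a
    have he : (fun L : ℝ => (b + Real.log L) ^ k) = fun L : ℝ =>
        ∑ j ∈ Finset.range (k + 1), (b ^ j * ((k.choose j : ℕ) : ℝ)) * Real.log L ^ (k - j) := by
      funext L
      rw [add_pow]
      exact Finset.sum_congr rfl fun j _ => by ring
    rw [he]
    exact Asymptotics.IsLittleO.fun_sum fun j _ => (hl _).const_mul_left _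
  filter_upwards [h1.bound one_pos, Filter.eventually_ge_atTop (0 : ℝ)] with L hL hL0
  have := (le_abs_self _).trans hL
  rwa [one_mul, Real.norm_of_nonneg (Real.rpow_nonneg hL0 _)] at this

/-- The error exponent. -/
abbrev errExp (d : ℕ) (γ : ℝ) : ℝ := min (2 * γ) (min 1 (2 * ((d : ℝ) - 1) * (1 - γ)))

theorem errExp_pos {d : ℕ} (hd : 3 ≤ d) {γ : ℝ} (hγ : 0 < γ) (hγ' : γ < 1) : 0 < errExp d γ := by
  have hd' : (3 : ℝ) ≤ d := by exact_mod_cast hd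
  refine lt_min (by linarith) (lt_min one_pos ?_)
  exact mul_pos (by linarith) (by linarith)

theorem weyl_remainder_le {d : ℕ} (hd : 3 ≤ d) {γ η L T : ℝ} (hη : 0 < η) (hL : 1 ≤ L)
    (hT0 : 0 ≤ T) (hT : T ≤ L ^ (2 * γ - 2 + η / (4 * d)))
    (hlog : 20 * 2 ^ (d - 1) * (1 + Real.log L) ^ 1 ≤ L ^ (η / 4)) :
    20 * (1 + Real.log L) * (1 / L + T) ^ (d - 1) ≤ L ^ (-errExp d γ + η / 2) := by
  have hd' : (3 : ℝ) ≤ d := by exact_mod_cast hd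
  have hL0 : 0 < L := by linarith
  set μ := max (-1 : ℝ) (2 * γ - 2 + η / (4 * d)) with hμ
  have h1 : 1 / L + T ≤ 2 * L ^ μ := by
    have e1 : 1 / L ≤ L ^ μ := by
      rw [one_div, ← Real.rpow_neg_one]
      exact Real.rpow_le_rpow_of_exponent_le hL (le_max_left _ _)
    have e2 : T ≤ L ^ μ := hT.trans (Real.rpow_le_rpow_of_exponent_le hL (le_max_right _ _))
    linarith
  have h2 : μ * ((d : ℝ) - 1) ≤ -errExp d γ + η / 4 := by
    have e3 : errExp d γ ≤ 1 := (min_le_right _ _).trans (min_le_left _ _)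
    have e4 : errExp d γ ≤ 2 * ((d : ℝ) - 1) * (1 - γ) :=
      (min_le_right _ _).trans (min_le_right _ _)
    rcases max_cases (-1 : ℝ) (2 * γ - 2 + η / (4 * d)) with h | h
    · rw [hμ, h.1]
      nlinarith
    · rw [hμ, h.1]
      have e5 : η / (4 * d) * ((d : ℝ) - 1) ≤ η / 4 := by
        rw [div_mul_eq_mul_div, div_le_div_iff₀ (by linarith) (by norm_num)]
        nlinarith
      nlinarith
  have h3 : (L ^ μ) ^ (d - 1) ≤ L ^ (-errExp d γ + η / 4) := by
    rw [← Real.rpow_natCast, ← Real.rpow_mul hL0.le, Nat.cast_sub (by omega), Nat.cast_one]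
    exact Real.rpow_le_rpow_of_exponent_le hL h2
  have hlg := Real.log_nonneg hL
  calc 20 * (1 + Real.log L) * (1 / L + T) ^ (d - 1)
      ≤ 20 * (1 + Real.log L) * (2 * L ^ μ) ^ (d - 1) := by
        have : 0 ≤ 1 / L + T := by positivity
        gcongr
    _ = (20 * 2 ^ (d - 1) * (1 + Real.log L) ^ 1) * (L ^ μ) ^ (d - 1) := by
        rw [mul_pow]
        ring
    _ ≤ L ^ (η / 4) * L ^ (-errExp d γ + η / 4) := by
        gcongr
    _ = L ^ (-errExp d γ + η / 2) := by
        rw [← Real.rpow_add hL0]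
        congr 1
        ring

theorem count_mul_error_le {d n : ℕ} {γ η L δ A B₀ G C' : ℝ} {lamv : Fin n → ℝ}
    (hl : ∀ j, 1 ≤ lamv j) (hη : 0 < η) (hL : 1 ≤ L) (hδ : 0 < δ)
    (hA : 1 ≤ A) (hB : 1 ≤ B₀) (hG : 1 ≤ G) (hnL : (n : ℝ) ≤ Real.log L ^ 3)
    (hlog : (1 + 3 * (d : ℝ)) * (0 + Real.log L) ^ 3 ≤ L ^ (η / 2))
    (hC' : 7 ^ (2 * d) * A * B₀ * G * diffC d ≤ C') {s : ℝ} (hs : s ≤ ∏ j, (7 * lamv j) ^ (2 * d)) :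
    s * ((L ^ 2) ^ (d * n) * (A ^ n * (B₀ ^ n * G ^ n) *
        (diffC d * (L ^ (2 * γ) * δ)⁻¹) ^ n *
        (n * (L ^ (-errExp d γ + η / 2) + 3 * d / L)))) ≤
      (∏ j, lamv j) ^ (2 * (d : ℝ)) * (C' * L ^ (2 * (d : ℝ) - 2 * γ) * δ⁻¹) ^ n *
        L ^ (-errExp d γ + η) := by
  have hL0 : 0 < L := by linarith
  have hD := diffC_pos d
  have hlp : 0 ≤ ∏ j, lamv j := Finset.prod_nonneg fun j _ => zero_le_one.trans (hl j)
  have h1 : ∏ j, (7 * lamv j) ^ (2 * d) = (7 ^ (2 * d)) ^ n * (∏ j, lamv j) ^ (2 * (d : ℝ)) := by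
    rw [Finset.prod_pow, Finset.prod_mul_distrib, Finset.prod_const, Finset.card_univ,
      Fintype.card_fin, mul_pow, ← pow_mul, ← pow_mul, mul_comm n]
    congr 1
    rw [← Real.rpow_natCast]
    push_cast
    rfl
  have h2 : n * (L ^ (-errExp d γ + η / 2) + 3 * d / L) ≤ L ^ (-errExp d γ + η) := by
    have e1 : 1 / L ≤ L ^ (-errExp d γ + η / 2) := by
      rw [one_div, ← Real.rpow_neg_one]
      refine Real.rpow_le_rpow_of_exponent_le hL ?_
      have : errExp d γ ≤ 1 := (min_le_right _ _).trans (min_le_left _ _)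
      linarith
    have e2 : L ^ (-errExp d γ + η / 2) + 3 * d / L ≤
        (1 + 3 * d) * L ^ (-errExp d γ + η / 2) := by
      have : 3 * (d : ℝ) / L = 3 * d * (1 / L) := by ring
      rw [this, add_mul, one_mul]
      gcongr
    calc n * (L ^ (-errExp d γ + η / 2) + 3 * d / L)
        ≤ Real.log L ^ 3 * ((1 + 3 * d) * L ^ (-errExp d γ + η / 2)) := by
          refine mul_le_mul hnL e2 (by positivity) ((Nat.cast_nonneg n).trans hnL)
      _ = ((1 + 3 * (d : ℝ)) * (0 + Real.log L) ^ 3) * L ^ (-errExp d γ + η / 2) := by ring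
      _ ≤ L ^ (η / 2) * L ^ (-errExp d γ + η / 2) := by gcongr
      _ = L ^ (-errExp d γ + η) := by
          rw [← Real.rpow_add hL0]
          congr 1
          ring
  have h3 : (L ^ 2) ^ (d * n) * (diffC d * (L ^ (2 * γ) * δ)⁻¹) ^ n =
      (diffC d * L ^ (2 * (d : ℝ) - 2 * γ) * δ⁻¹) ^ n := by
    rw [pow_mul, ← mul_pow, Real.rpow_sub hL0]
    congr 1
    have : L ^ (2 * (d : ℝ)) = (L ^ 2) ^ d := by
      rw [← pow_mul, ← Real.rpow_natCast]
      push_cast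
      rfl
    rw [this, mul_inv]
    ring
  have hnn : 0 ≤ (L ^ 2) ^ (d * n) * (A ^ n * (B₀ ^ n * G ^ n) *
        (diffC d * (L ^ (2 * γ) * δ)⁻¹) ^ n *
        (n * (L ^ (-errExp d γ + η / 2) + 3 * d / L))) := by positivity
  calc s * _ ≤ (∏ j, (7 * lamv j) ^ (2 * d)) * _ := mul_le_mul_of_nonneg_right hs hnn
    _ = (∏ j, lamv j) ^ (2 * (d : ℝ)) * ((7 ^ (2 * d)) ^ n * A ^ n * B₀ ^ n * G ^ n *
        ((L ^ 2) ^ (d * n) * (diffC d * (L ^ (2 * γ) * δ)⁻¹) ^ n)) *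
        (n * (L ^ (-errExp d γ + η / 2) + 3 * d / L)) := by
        rw [h1]
        ring
    _ = (∏ j, lamv j) ^ (2 * (d : ℝ)) * ((7 ^ (2 * d) * A * B₀ * G * diffC d) *
        L ^ (2 * (d : ℝ) - 2 * γ) * δ⁻¹) ^ n *
        (n * (L ^ (-errExp d γ + η / 2) + 3 * d / L)) := by
        rw [h3]
        simp only [mul_pow]
        ring
    _ ≤ _ := by
        have : 0 ≤ (∏ j, lamv j) ^ (2 * (d : ℝ)) := Real.rpow_nonneg hlp _
        have hC0 : 0 ≤ C' := le_trans (by positivity) hC'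
        gcongr

theorem psiDensity_spec {n : ℕ} {χ₀ : ℝ → ℝ} {g : ℝ → ℂ} {K : ℕ} {Cg L M b : ℝ}
    (hg : Measurable g) (hCg : 1 ≤ Cg) (hgK : ∀ τ, ‖g τ‖ ≤ Cg / (1 + |τ|) ^ K)
    (hgu : ∀ u, (((1 - χ₀ u) / u : ℝ) : ℂ) = ∫ τ, g τ * efun (τ * u))
    (hK : 3 ≤ K) (hL : 1 ≤ L) (hM : 2 ≤ M) (hLM : L ^ 4 ≤ M ^ (K - 3))
    (hn : (8 * (K : ℝ) * n) ^ 8 ≤ M) (hb : 0 ≤ b) {J : Finset (Fin n)}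
    {Ψ₁ : ({j : Fin n // j ∉ J} → ℝ) → ℂ} (hΨ : ContDiff ℝ (⊤ : ℕ∞) Ψ₁)
    (h : ∀ l : List {j : Fin n // j ∉ J}, (∫⁻ ω : {j : Fin n // j ∉ J} → ℝ,
            (‖pderivList (l.map fun j => Pi.single j (1 : ℝ)) Ψ₁ ω‖₊ : ℝ≥0∞))
          ≤ ENNReal.ofReal (b * (Nat.factorial (4 * l.length) : ℝ))) :
    Integrable (psiDensity g J Ψ₁) ∧
    (∀ τ, ‖psiDensity g J Ψ₁ τ‖ₑ ≤ ENNReal.ofReal (b * Cg ^ n) * ∏ j, vMaj L M (τ j)) ∧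
    ∀ Ω, PsiFun χ₀ J Ψ₁ Ω = ∫ τ, psiDensity g J Ψ₁ τ * efun (∑ j, τ j * Ω j) := by
  have hM0 : 0 ≤ M := by linarith
  have hL0 : 0 < L := by linarith
  have hΨi : Integrable Ψ₁ := by
    refine ⟨hΨ.continuous.aestronglyMeasurable, ?_⟩
    have h0 : ∫⁻ ω, ‖Ψ₁ ω‖ₑ ≤ ENNReal.ofReal (b * (Nat.factorial (4 * 0) : ℝ)) := h []
    exact h0.trans_lt ENNReal.ofReal_lt_top
  have hcard : Fintype.card {j : Fin n // j ∉ J} ≤ n := by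
    simp
  have hF : ∀ τ, ‖piFt Ψ₁ τ‖ₑ ≤ ENNReal.ofReal b * ∏ j, vMaj L M (τ j) := by
    refine enorm_piFt_le hΨ hb hL0 h
      (m := 2 * K * Fintype.card {j : Fin n // j ∉ J}) (fun t ht => ?_) hM0
    refine factorial_tail hL hK hLM hM (le_trans ?_ hn) ht
    gcongr
  have hgv := enorm_le_vMaj_of_decay hK hL hM0 (zero_le_one.trans hCg) hLM hgK
  have hbound := enorm_psiDensity_le (J := J) (Ψ₁ := Ψ₁) hCg hb hgv hF
  refine ⟨integrable_of_enorm_le_prod_vMaj hL (by positivity)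
    (aestronglyMeasurable_psiDensity hg hΨi) hbound, hbound, fun Ω => ?_⟩
  exact PsiFun_eq_integral hΨ.continuous hΨi
    (integrable_of_enorm_le_prod_vMaj hL hb (continuous_piFt hΨi).aestronglyMeasurable hF) hgu Ω

theorem lattice_sum_sub_integral_le {d n : ℕ} (hd : 3 ≤ d) {L M c R a b : ℝ} (hL : 1 ≤ L)
    (hM : 0 ≤ M) (hc : 0 < c) (hcL : c ≤ L ^ 2) (hR0 : 0 ≤ R) (hR1 : R ≤ 1)
    (hR : 20 * (1 + Real.log L) * (1 / L + c * M / L ^ 2) ^ (d - 1) ≤ R)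
    (ha : 0 ≤ a) (hb : 0 ≤ b) {W : PairSp d n → ℂ} (hW : ContDiff ℝ 1 W)
    {S : Finset (Fin n → Fin d → ℤ × ℤ)}
    (hS : ∀ (B : Fin n → Fin d → ℤ × ℤ) (z : PairSp d n), W z ≠ 0 →
      (∀ j i, |z.1 j i - (B j i).1| < 1 ∧ |z.2 j i - (B j i).2| < 1) → B ∈ S)
    (hWa : (∫⁻ ξ, (‖ftV d n W ξ‖₊ : ℝ≥0∞)) ≤ ENNReal.ofReal a)
    (hWd : ∀ v : PairSp d n,
        ((∃ (j : Fin n) (i : Fin d), v = (Pi.single j (EuclideanSpace.single i (1 : ℝ)), 0)) ∨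
          (∃ (j : Fin n) (i : Fin d), v = (0, Pi.single j (EuclideanSpace.single i (1 : ℝ))))) →
        (∫⁻ ξ, (‖ftV d n (fun z => fderiv ℝ W z v) ξ‖₊ : ℝ≥0∞)) ≤ ENNReal.ofReal a)
    {Ph Ψ : (Fin n → ℝ) → ℂ} (hPi : Integrable Ph)
    (hP : ∀ τ, ‖Ph τ‖ₑ ≤ ENNReal.ofReal b * ∏ j, vMaj L M (τ j))
    (hΨ : ∀ Ω, Ψ Ω = ∫ τ, Ph τ * efun (∑ j, τ j * Ω j)) :
    ‖(∑' z : {z : PairSp d n // (∀ j, z.1 j ∈ ZLat d L) ∧ ∀ j, z.2 j ∈ ZLat d L},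
          W z.1 * Ψ fun j => c * ⟪z.1.1 j, z.1.2 j⟫) -
        (((L ^ 2) ^ (d * n) : ℝ) : ℂ) * ∫ z : PairSp d n, W z * Ψ fun j => c * ⟪z.1 j, z.2 j⟫‖ ≤
      S.card * ((L ^ 2) ^ (d * n) * (a * b * (diffC d * c⁻¹) ^ n * (n * (R + 3 * d / L)))) := by
  have hL0 : 0 < L := by linarith
  have hs := hasCompactSupport_of_boxes hS
  have hWi : Integrable W := hW.continuous.integrable_of_hasCompactSupport hs
  have hFc := continuous_ftV hWi
  have hFi : Integrable (ftV d n W) :=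
    ⟨hFc.aestronglyMeasurable, lt_of_le_of_lt hWa ENNReal.ofReal_lt_top⟩
  have hinv := pairSp_inversion hW.continuous hWi hFi
  have hT0 : 0 ≤ c * M / L ^ 2 := by positivity
  refine norm_tsum_sub_integral_le (F := fun z => W z * Ψ fun j => c * ⟪z.1 j, z.2 j⟫) hL0 _
    (fun B z hz => hS B z (left_ne_zero_of_mul hz))
    (fun B => integrable_localised hFi hPi hinv hΨ B) fun B => ?_
  exact norm_box_error_le hd hL hc hcL rfl hT0 hR0 hR1
    ((lintegral_weylR (by omega) hL hT0).trans (ENNReal.ofReal_le_ofReal hR)) ha hb hPi hP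
    hFc.measurable hWa
    (fun j i => lintegral_ftV_mul_coord hW hs _ _ (pairingV_single_fst j i)
      (hWd _ (Or.inl ⟨j, i, rfl⟩)))
    (fun j i => lintegral_ftV_mul_coord hW hs _ _ (pairingV_single_snd j i)
      (hWd _ (Or.inr ⟨j, i, rfl⟩))) hinv hΨ B

theorem statement19 (d : ℕ) (hd : 3 ≤ d) (γ : ℝ) (hγ : 0 < γ) (hγ' : γ < 1)
    (χ₀ : ℝ → ℝ) (hχs : ContDiff ℝ (⊤ : ℕ∞) χ₀)
    (hχ1 : ∀ z : ℝ, |z| ≤ 1 / 2 → χ₀ z = 1)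
    (hχ0 : ∀ z : ℝ, 1 ≤ |z| → χ₀ z = 0) :
    ∃ η₀ : ℝ, 0 < η₀ ∧ ∀ η : ℝ, 0 < η → η ≤ η₀ →
    ∃ C : ℝ, 1 ≤ C ∧
    ∀ A B₀ : ℝ, 1 ≤ A → 1 ≤ B₀ →
    ∃ C' : ℝ, 1 ≤ C' ∧
    ∀ L : ℝ, C' ≤ L →
    ∀ δ : ℝ, 0 < δ → δ < 1 → δ⁻¹ ≤ L ^ (η ^ 2) →
    ∀ n : ℕ, 0 < n → (n : ℝ) ≤ Real.log L ^ 3 →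
    ∀ prec : Fin n → Fin n → Prop,
      (∀ j, ¬prec j j) → (∀ j₁ j₂ j₃, prec j₁ j₂ → prec j₂ j₃ → prec j₁ j₃) →
    ∀ lamv : Fin n → ℝ, (∀ j, 1 ≤ lamv j) → (∀ j, lamv j ≤ Real.log L ^ 4) →
    ∀ av bv : Fin n → EuclideanSpace ℝ (Fin d),
    ∀ xt yt : Fin n →
        (Fin n → EuclideanSpace ℝ (Fin d)) × (Fin n → EuclideanSpace ℝ (Fin d)) →
        EuclideanSpace ℝ (Fin d),
      (∀ j, (∀ z, xt j z = z.1 j) ∨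
        ∃ j', prec j' j ∧
          ((∀ z, xt j z = z.1 j + z.1 j') ∨ (∀ z, xt j z = z.1 j - z.1 j') ∨
            (∀ z, xt j z = z.1 j + z.2 j') ∨ (∀ z, xt j z = z.1 j - z.2 j'))) →
      (∀ j, (∀ z, yt j z = z.2 j) ∨
        ∃ j'', prec j'' j ∧
          ((∀ z, yt j z = z.2 j + z.1 j'') ∨ (∀ z, yt j z = z.2 j - z.1 j'') ∨
            (∀ z, yt j z = z.2 j + z.2 j'') ∨ (∀ z, yt j z = z.2 j - z.2 j''))) →
    ∀ W : (Fin n → EuclideanSpace ℝ (Fin d)) × (Fin n → EuclideanSpace ℝ (Fin d)) → ℂ,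
      ContDiff ℝ 1 W →
      (∀ z, W z ≠ 0 → ∀ j, ‖xt j z - av j‖ ≤ lamv j ∧ ‖yt j z - bv j‖ ≤ lamv j) →
      (∫⁻ ξ, (‖ftV d n W ξ‖₊ : ℝ≥0∞)) ≤ ENNReal.ofReal (A ^ n) →
      (∀ v : (Fin n → EuclideanSpace ℝ (Fin d)) × (Fin n → EuclideanSpace ℝ (Fin d)),
        ((∃ (j : Fin n) (i : Fin d), v = (Pi.single j (EuclideanSpace.single i (1 : ℝ)), 0)) ∨
          (∃ (j : Fin n) (i : Fin d), v = (0, Pi.single j (EuclideanSpace.single i (1 : ℝ))))) →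
        (∫⁻ ξ, (‖ftV d n (fun z => fderiv ℝ W z v) ξ‖₊ : ℝ≥0∞)) ≤ ENNReal.ofReal (A ^ n)) →
    ∀ J : Finset (Fin n),
    ∀ Ψ₁ : ({j : Fin n // j ∉ J} → ℝ) → ℂ,
      ContDiff ℝ (⊤ : ℕ∞) Ψ₁ →
      (∀ l : List {j : Fin n // j ∉ J},
        (∫⁻ ω : {j : Fin n // j ∉ J} → ℝ,
            (‖pderivList (l.map fun j => Pi.single j (1 : ℝ)) Ψ₁ ω‖₊ : ℝ≥0∞))
          ≤ ENNReal.ofReal (B₀ ^ n * (Nat.factorial (4 * l.length) : ℝ))) →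
      (∫⁻ ω : {j : Fin n // j ∉ J} → ℝ,
          ENNReal.ofReal (⨆ j : {j : Fin n // j ∉ J}, jap (ω j) ^ (1 - η / 2)) *
            (‖Ψ₁ ω‖₊ : ℝ≥0∞))
        ≤ ENNReal.ofReal (B₀ ^ n) →
      ‖(∑' z : {z : (Fin n → EuclideanSpace ℝ (Fin d)) ×
            (Fin n → EuclideanSpace ℝ (Fin d)) //
            (∀ j, z.1 j ∈ ZLat d L) ∧ ∀ j, z.2 j ∈ ZLat d L},
          W z.1 * PsiFun χ₀ J Ψ₁ (fun j => L ^ (2 * γ) * δ * ⟪z.1.1 j, z.1.2 j⟫)) -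
        ((L ^ (2 * (d : ℝ) * (n : ℝ)) : ℝ) : ℂ) *
          ∫ z : (Fin n → EuclideanSpace ℝ (Fin d)) × (Fin n → EuclideanSpace ℝ (Fin d)),
            W z * PsiFun χ₀ J Ψ₁ (fun j => L ^ (2 * γ) * δ * ⟪z.1 j, z.2 j⟫)‖
        ≤ (∏ j, lamv j) ^ C * (C' * L ^ (2 * (d : ℝ) - 2 * γ) * δ⁻¹) ^ n *
            L ^ (-min (2 * γ) (min 1 (2 * ((d : ℝ) - 1) * (1 - γ))) + η) := by
  refine ⟨errExp d γ, errExp_pos hd hγ hγ', fun η hη hη' => ?_⟩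
  have hd' : (3 : ℝ) ≤ d := by exact_mod_cast hd
  refine ⟨2 * (d : ℝ), by linarith, fun A B₀ hA hB => ?_⟩
  obtain ⟨g, hgm, -, hgd, hgu⟩ := exists_recip_density hχs hχ1 hχ0
  set ε := η / (4 * d) with hε
  have hε0 : 0 < ε := by positivity
  set K := ⌈4 / ε⌉₊ + 3 with hK
  obtain ⟨Cg, hCg, hgK⟩ := hgd K
  obtain ⟨L₁, hL₁⟩ := Filter.eventually_atTop.1
    ((eventually_mul_log_pow_le 2 0 0 hε0).and
      ((eventually_mul_log_pow_le ((8 * (K : ℝ)) ^ 8) 0 24 hε0).and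
        ((eventually_mul_log_pow_le (20 * 2 ^ (d - 1)) 1 1 (by positivity : 0 < η / 4)).and
          (eventually_mul_log_pow_le (1 + 3 * (d : ℝ)) 0 3 (half_pos hη)))))
  refine ⟨max 1 (max L₁ (7 ^ (2 * d) * A * B₀ * Cg * diffC d)), le_max_left _ _, ?_⟩
  intro L hL δ hδ hδ1 _ n _ hnL prec hirr htr lamv hl _ av bv xt yt hxt hyt W hW hsupp hWa hWd
    J Ψ₁ hΨ₁ hΨd _
  have hL1 : 1 ≤ L := (le_max_left _ _).trans hL
  have hL0 : 0 < L := by linarith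
  obtain ⟨h2, hfac, hlog1, hlog3⟩ :=
    hL₁ L (((le_max_left _ _).trans (le_max_right _ _)).trans hL)
  rw [pow_zero, mul_one] at h2
  have hMn : (8 * (K : ℝ) * n) ^ 8 ≤ L ^ ε := by
    refine le_trans ?_ hfac
    rw [mul_pow, zero_add, show (24 : ℕ) = 3 * 8 from rfl, pow_mul]
    gcongr
  have hLM : L ^ 4 ≤ (L ^ ε) ^ (K - 3) := by
    rw [← Real.rpow_natCast, ← Real.rpow_natCast, ← Real.rpow_mul hL0.le]
    refine Real.rpow_le_rpow_of_exponent_le hL1 ?_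
    have h4 := Nat.le_ceil (4 / ε)
    rw [div_le_iff₀ hε0] at h4
    rw [hK, Nat.add_sub_cancel]
    push_cast
    linarith
  obtain ⟨hPi, hP, hΨ⟩ := psiDensity_spec (J := J) hgm hCg hgK hgu (Nat.le_add_left 3 _) hL1 h2
    hLM hMn (by positivity : 0 ≤ B₀ ^ n) hΨ₁ hΨd
  obtain ⟨S, hScard, hS⟩ := exists_boxes (d := d) hirr htr hl hxt hyt
  have hc : 0 < L ^ (2 * γ) * δ := mul_pos (Real.rpow_pos_of_pos hL0 _) hδ
  have hLγ : 0 ≤ L ^ (2 * γ) := Real.rpow_nonneg hL0.le _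
  have hcγ : L ^ (2 * γ) * δ ≤ L ^ (2 * γ) := mul_le_of_le_one_right hLγ hδ1.le
  have hcL : L ^ (2 * γ) * δ ≤ L ^ 2 := by
    refine hcγ.trans ?_
    rw [← Real.rpow_natCast]
    refine Real.rpow_le_rpow_of_exponent_le hL1 ?_
    push_cast
    linarith
  have hT0 : 0 ≤ L ^ (2 * γ) * δ * L ^ ε / L ^ 2 := by positivity
  have hT : L ^ (2 * γ) * δ * L ^ ε / L ^ 2 ≤ L ^ (2 * γ - 2 + ε) := by
    rw [Real.rpow_add hL0, Real.rpow_sub hL0, Real.rpow_two, div_mul_eq_mul_div]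
    gcongr
  have hR1 : L ^ (-errExp d γ + η / 2) ≤ 1 :=
    Real.rpow_le_one_of_one_le_of_nonpos hL1 (by linarith)
  have key := lattice_sum_sub_integral_le hd hL1 (Real.rpow_nonneg hL0.le _) hc hcL
    (Real.rpow_nonneg hL0.le _) hR1 (weyl_remainder_le hd hη hL1 hT0 hT hlog1)
    (by positivity : 0 ≤ A ^ n) (by positivity) hW (fun B z hz => hS B z (hsupp z hz)) hWa hWd
    hPi hP hΨ
  have hN : L ^ (2 * (d : ℝ) * (n : ℝ)) = (L ^ 2) ^ (d * n) := by
    rw [← pow_mul, ← Real.rpow_natCast]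
    push_cast
    rw [mul_assoc]
  rw [hN]
  exact key.trans (count_mul_error_le hl hη hL1 hδ hA hB hCg hnL hlog3
    ((le_max_right _ _).trans (le_max_right _ _)) hScard)
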